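/- Let γ = 6/5, −23/18 < δ < −1, s > 5/2 and a > 0. Then the function w₀(x) = (a² + |x|²)^{−1/4} belongs to H_{s,δ}(ℝ³), and for the initial data (w₀, v₀ = 0) there exist T > 0 and a unique solution (w, v) ∈ C([0,T], H_{s,δ}) ∩ C¹([0,T], H_{s−1,δ+1}) of the Euler–Poisson–Makino system with adiabatic exponent γ = 6/5, with w(0,·) = w₀ and v(0,·) = 0. -/

import Mathlib

open MeasureTheory Real Set
open scoped FourierTransform ENNReal NNReal

noncomputable section

abbrev E3 : Type := EuclideanSpace ℝ (Fin 3)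

/-- A dyadic partition of unity on ℝ³ as in the paper: `ψ j ∈ C_0^∞`, nonnegative,
`supp ψ₀ ⊆ {|x| ≤ 2}`, `ψ₀ = 1` on `{|x| ≤ 1}`, for `j ≥ 1`
`supp ψ_j ⊆ {2^(j-2) ≤ |x| ≤ 2^(j+1)}`, `ψ_j = 1` on `{2^(j-1) ≤ |x| ≤ 2^j}`, and
`|∂^α ψ_j| ≤ C_α 2^(-|α| j)` with `C_α` independent of `j`. -/
structure DyadicPartition where
  ψ : ℕ → E3 → ℝ
  smooth : ∀ j, ContDiff ℝ (⊤ : ℕ∞) (ψ j)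
  nonneg : ∀ j x, 0 ≤ ψ j x
  compSupp : ∀ j, HasCompactSupport (ψ j)
  supp_zero : ∀ x : E3, ψ 0 x ≠ 0 → ‖x‖ ≤ 2
  one_zero : ∀ x : E3, ‖x‖ ≤ 1 → ψ 0 x = 1
  supp_succ : ∀ j : ℕ, 1 ≤ j → ∀ x : E3, ψ j x ≠ 0 →
    (2:ℝ) ^ ((j:ℤ) - 2) ≤ ‖x‖ ∧ ‖x‖ ≤ (2:ℝ) ^ ((j:ℤ) + 1)
  one_succ : ∀ j : ℕ, 1 ≤ j → ∀ x : E3,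
    (2:ℝ) ^ ((j:ℤ) - 1) ≤ ‖x‖ → ‖x‖ ≤ (2:ℝ) ^ (j:ℤ) → ψ j x = 1
  deriv_bound : ∀ n : ℕ, ∃ C : ℝ, ∀ (j : ℕ) (x : E3),
    ‖iteratedFDeriv ℝ n (ψ j) x‖ ≤ C * (2:ℝ) ^ (-(n:ℤ) * (j:ℤ))

/-- The squared `H^s` norm `∫ (1+|ξ|²)^s |𝓕f(ξ)|² dξ` of a complex-valued function. -/
def HsNormSq (s : ℝ) (f : E3 → ℂ) : ℝ≥0∞ :=
  ∫⁻ ξ : E3, ENNReal.ofReal ((1 + ‖ξ‖ ^ 2) ^ s) * (‖𝓕 f ξ‖₊ : ℝ≥0∞) ^ 2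

/-- The squared weighted Sobolev norm
`‖u‖²_{H_{s,δ}} = Σ_j 2^{(3/2+δ)2j} ‖(ψ_j u)_{2^j}‖²_{H^s}`,
where `(ψ_j u)_{2^j}(x) = ψ_j(2^j x) u(2^j x)`. -/
def HwNormSq (P : DyadicPartition) (s δ : ℝ) (u : E3 → ℝ) : ℝ≥0∞ :=
  ∑' j : ℕ, ENNReal.ofReal ((2:ℝ) ^ ((3 + 2 * δ) * (j:ℝ))) *
    HsNormSq s (fun x : E3 =>
      ((P.ψ j (((2:ℝ) ^ (j:ℕ)) • x) * u (((2:ℝ) ^ (j:ℕ)) • x) : ℝ) : ℂ))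

/-- Membership in the weighted Sobolev space `H_{s,δ}` (for functions). -/
def MemH (P : DyadicPartition) (s δ : ℝ) (u : E3 → ℝ) : Prop :=
  LocallyIntegrable u volume ∧ HwNormSq P s δ u < ⊤

/-- The weighted Sobolev norm `‖u‖_{H_{s,δ}}`. -/
def Hnorm (P : DyadicPartition) (s δ : ℝ) (u : E3 → ℝ) : ℝ :=
  Real.sqrt (HwNormSq P s δ u).toReal

/-- The squared weighted `L²_δ` norm `∫ (1+|x|)^{2δ} |u(x)|² dx`. -/
def L2wNormSq (δ : ℝ) (u : E3 → ℝ) : ℝ≥0∞ :=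
  ∫⁻ x : E3, ENNReal.ofReal ((1 + ‖x‖) ^ (2 * δ)) * (‖u x‖₊ : ℝ≥0∞) ^ 2

/-- The weighted `L²_δ` norm. -/
def L2wNorm (δ : ℝ) (u : E3 → ℝ) : ℝ :=
  Real.sqrt (L2wNormSq δ u).toReal

/-- Membership in `L²_δ`. -/
def MemL2w (δ : ℝ) (u : E3 → ℝ) : Prop :=
  AEStronglyMeasurable u volume ∧ L2wNormSq δ u < ⊤

/-- The partial derivative `∂_a f (x)`. -/
def pd (f : E3 → ℝ) (a : Fin 3) (x : E3) : ℝ :=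
  fderiv ℝ f x (EuclideanSpace.single a 1)

/-- `t ↦ u(t,·)` is a continuous curve in `H_{s,δ}` on `[0,T]`. -/
def HContOn (P : DyadicPartition) (s δ T : ℝ) (u : ℝ → E3 → ℝ) : Prop :=
  (∀ t ∈ Icc (0:ℝ) T, MemH P s δ (u t)) ∧
  ∀ t ∈ Icc (0:ℝ) T, ∀ ε > (0:ℝ), ∃ η > (0:ℝ), ∀ t' ∈ Icc (0:ℝ) T,
    |t' - t| < η → Hnorm P s δ (fun x => u t' x - u t x) < ε

/-- `t ↦ u(t,·)` is a `C¹` curve in `H_{s,δ}` on `[0,T]`: there is a curve `u'`,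
continuous with values in `H_{s,δ}`, such that the difference quotients of `u`
converge to `u'` in the `H_{s,δ}` norm. -/
def HC1On (P : DyadicPartition) (s δ T : ℝ) (u : ℝ → E3 → ℝ) : Prop :=
  ∃ u' : ℝ → E3 → ℝ, HContOn P s δ T u' ∧
    ∀ t ∈ Icc (0:ℝ) T, ∀ ε > (0:ℝ), ∃ η > (0:ℝ), ∀ t' ∈ Icc (0:ℝ) T, t' ≠ t →
      |t' - t| < η →
      Hnorm P s δ (fun x => (u t' x - u t x) / (t' - t) - u' t x) < ε

/-- The Makino constant `c_{K,γ} = (2√(Kγ)/(γ-1))^{-2/(γ-1)}`. -/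
def makinoConst (K γ : ℝ) : ℝ := (2 * Real.sqrt (K * γ) / (γ - 1)) ^ (-2 / (γ - 1))

/-- The density associated to the Makino variable `w`: `ρ = c_{K,γ} w^{2/(γ-1)}`. -/
def makinoDensity (K γ : ℝ) (w : E3 → ℝ) (y : E3) : ℝ :=
  makinoConst K γ * w y ^ (2 / (γ - 1))

/-- The Newtonian potential `φ(x) = -∫ ρ(y)/|x-y| dy`, which solves `Δφ = 4πρ`. -/
def newtonPotential (ρ : E3 → ℝ) (x : E3) : ℝ := -∫ y : E3, ρ y / ‖x - y‖

/-- `(w,v)` is a classical solution on `[0,T] × ℝ³` of the Euler–Poisson–Makino system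
`∂ₜw + vᵃ∂ₐw + ((γ-1)/2) w ∂ₐvᵃ = 0`,
`∂ₜvᵃ + vᵇ∂ᵦvᵃ + ((γ-1)/2) w ∂ᵃw = -∂ᵃφ`, where `φ` is the Newtonian potential of
`ρ = c_{K,γ} w^{2/(γ-1)}` (so that `Δφ = 4πρ`). -/
def IsMakinoSolution (K γ T : ℝ) (w : ℝ → E3 → ℝ) (v : Fin 3 → ℝ → E3 → ℝ) : Prop :=
  ∀ t ∈ Icc (0:ℝ) T, ∀ x : E3,
    DifferentiableAt ℝ (w t) x ∧
    (∀ a : Fin 3, DifferentiableAt ℝ (fun y => v a t y) x) ∧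
    DifferentiableAt ℝ (newtonPotential (makinoDensity K γ (w t))) x ∧
    (∃ dw : ℝ, HasDerivWithinAt (fun τ => w τ x) dw (Icc (0:ℝ) T) t ∧
      dw + (∑ a : Fin 3, v a t x * pd (w t) a x) +
        (γ - 1) / 2 * w t x * (∑ a : Fin 3, pd (fun y => v a t y) a x) = 0) ∧
    (∀ a : Fin 3, ∃ dv : ℝ, HasDerivWithinAt (fun τ => v a τ x) dv (Icc (0:ℝ) T) t ∧
      dv + (∑ b : Fin 3, v b t x * pd (fun y => v a t y) b x) +
        (γ - 1) / 2 * w t x * pd (w t) a x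
        = -pd (newtonPotential (makinoDensity K γ (w t))) a x)

/-- `(w,v)` is a solution of the Euler–Poisson–Makino system on `[0,T]` in the class
`C([0,T],H_{s,δ}) ∩ C¹([0,T],H_{s-1,δ+1})` with nonnegative `w` and initial data
`(w₀,v₀)`. -/
def MakinoClass (P : DyadicPartition) (K γ s δ T : ℝ)
    (w₀ : E3 → ℝ) (v₀ : Fin 3 → E3 → ℝ)
    (w : ℝ → E3 → ℝ) (v : Fin 3 → ℝ → E3 → ℝ) : Prop :=
  w 0 = w₀ ∧ (∀ a, v a 0 = v₀ a) ∧
  IsMakinoSolution K γ T w v ∧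
  HContOn P s δ T w ∧ (∀ a, HContOn P s δ T (v a)) ∧
  HC1On P (s - 1) (δ + 1) T w ∧ (∀ a, HC1On P (s - 1) (δ + 1) T (v a)) ∧
  (∀ t ∈ Icc (0:ℝ) T, ∀ x, 0 ≤ w t x)

namespace StaticMakino

/-! ### Formal power series in `(t, u)` and their majorants -/

/-- Formal power series in `t` whose coefficients are formal power series in `u`. -/
abbrev DSeries : Type := PowerSeries (PowerSeries ℝ)

/-- The coefficient of `t ^ n * u ^ k`. -/
def cf (f : DSeries) (n k : ℕ) : ℝ := PowerSeries.coeff k (PowerSeries.coeff n f)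

/-- The series with prescribed coefficients. -/
def ofCf (c : ℕ → ℕ → ℝ) : DSeries := PowerSeries.mk fun n => PowerSeries.mk fun k => c n k

@[simp] lemma cf_ofCf (c : ℕ → ℕ → ℝ) (n k : ℕ) : cf (ofCf c) n k = c n k := by
  simp [cf, ofCf]

lemma cf_ext {f g : DSeries} (h : ∀ n k, cf f n k = cf g n k) : f = g := by
  ext n k; exact h n k

@[simp] lemma cf_add (f g : DSeries) (n k : ℕ) : cf (f + g) n k = cf f n k + cf g n k := by
  simp [cf]

@[simp] lemma cf_sub (f g : DSeries) (n k : ℕ) : cf (f - g) n k = cf f n k - cf g n k := by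
  simp [cf]

lemma cf_mul (f g : DSeries) (n k : ℕ) :
    cf (f * g) n k = ∑ p ∈ Finset.HasAntidiagonal.antidiagonal n, ∑ q ∈ Finset.HasAntidiagonal.antidiagonal k,
      cf f p.1 q.1 * cf g p.2 q.2 := by
  simp [cf, PowerSeries.coeff_mul]

/-- A polynomial in `u`, viewed as a series in `(t, u)`. -/
def cu (p : Polynomial ℝ) : DSeries := PowerSeries.C (p : PowerSeries ℝ)

lemma cf_cu (p : Polynomial ℝ) (n k : ℕ) : cf (cu p) n k = if n = 0 then p.coeff k else 0 := by
  unfold cf cu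
  rw [PowerSeries.coeff_C]
  split_ifs <;> simp

/-- The formal derivative with respect to `u`. -/
def dU (f : DSeries) : DSeries := ofCf fun n k => ((k : ℝ) + 1) * cf f n (k + 1)

/-- The formal derivative with respect to `t`. -/
def dT (f : DSeries) : DSeries := ofCf fun n k => ((n : ℝ) + 1) * cf f (n + 1) k

/-- The formal primitive with respect to `t` vanishing at `t = 0`. -/
def intT (f : DSeries) : DSeries := ofCf fun n k => if n = 0 then 0 else cf f (n - 1) k / n

/-- The coefficients of the power series solution `g` of
`u (2 - u) g' + 3 (1 - u) g = Q (1 - u) F`. -/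
def gCoef (Q : ℝ) (F : ℕ → ℝ) : ℕ → ℝ
  | 0 => Q * F 0 / 3
  | k + 1 => (((k : ℝ) + 3) * gCoef Q F k + Q * (F (k + 1) - F k)) / (2 * k + 5)

/-- The formal solution `g` of `u (2 - u) g' + 3 (1 - u) g = Q (1 - u) F`. -/
def gSol (Q : ℝ) (f : DSeries) : DSeries := ofCf fun n k => gCoef Q (cf f n) k

/-- The base sequence of the majorants. -/
def phi (m : ℕ) : ℝ := 1 / ((m : ℝ) + 10) ^ 2

/-- The derivative of the base sequence. -/
def phiD (m : ℕ) : ℝ := ((m : ℝ) + 1) * phi (m + 1)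

lemma phi_pos (m : ℕ) : 0 < phi m := by unfold phi; positivity

lemma sum_phi_le (N : ℕ) : ∑ i ∈ Finset.range N, phi i ≤ 1 / 9 - 1 / ((N : ℝ) + 9) := by
  induction N with
  | zero => simp
  | succ n ih =>
    rw [Finset.sum_range_succ]
    have : phi n ≤ 1 / ((n : ℝ) + 9) - 1 / ((n : ℝ) + 10) := by
      unfold phi
      rw [div_sub_div _ _ (by positivity) (by positivity), div_le_div_iff₀ (by positivity)
        (by positivity)]
      nlinarith [(Nat.cast_nonneg n : (0 : ℝ) ≤ n)]
    push_cast
    have e : (n : ℝ) + 1 + 9 = n + 10 := by ring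
    rw [e]; linarith

lemma phi_conv (m : ℕ) : ∑ p ∈ Finset.HasAntidiagonal.antidiagonal m, phi p.1 * phi p.2 ≤ phi m := by
  have h1 : ∀ p ∈ Finset.HasAntidiagonal.antidiagonal m,
      phi p.1 * phi p.2 ≤ phi m * (2 * phi p.1 + 2 * phi p.2) := by
    intro p hp
    have hm : (m : ℝ) = p.1 + p.2 := by
      rw [← Finset.HasAntidiagonal.mem_antidiagonal.1 hp]; push_cast; ring
    unfold phi
    rw [hm]
    have ha : (0 : ℝ) ≤ p.1 := Nat.cast_nonneg _
    have hb : (0 : ℝ) ≤ p.2 := Nat.cast_nonneg _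
    generalize (p.1 : ℝ) = x at *
    generalize (p.2 : ℝ) = y at *
    rw [show 1 / (x + y + 10) ^ 2 * (2 * (1 / (x + 10) ^ 2) + 2 * (1 / (y + 10) ^ 2))
      = ((2 * (y + 10) ^ 2 + 2 * (x + 10) ^ 2) / (x + y + 10) ^ 2) *
        (1 / (x + 10) ^ 2 * (1 / (y + 10) ^ 2)) by field_simp]
    refine le_mul_of_one_le_left (by positivity) ?_
    rw [le_div_iff₀ (by positivity)]
    nlinarith [sq_nonneg (x - y), mul_nonneg ha hb]
  refine (Finset.sum_le_sum h1).trans ?_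
  rw [← Finset.mul_sum, Finset.sum_add_distrib, ← Finset.mul_sum, ← Finset.mul_sum]
  have e1 : ∑ p ∈ Finset.HasAntidiagonal.antidiagonal m, phi p.1 = ∑ i ∈ Finset.range (m + 1), phi i :=
    Finset.Nat.sum_antidiagonal_eq_sum_range_succ_mk (fun p => phi p.1) m
  have e2 : ∑ p ∈ Finset.HasAntidiagonal.antidiagonal m, phi p.2 = ∑ p ∈ Finset.HasAntidiagonal.antidiagonal m, phi p.1 :=
    (Finset.Nat.sum_antidiagonal_swap (f := fun p : ℕ × ℕ => phi p.1) (n := m))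
  rw [e2, e1]
  have h2 := sum_phi_le (m + 1)
  have h3 : 0 ≤ 1 / (((m + 1 : ℕ) : ℝ) + 9) := by positivity
  have := phi_pos m
  nlinarith

lemma phi_phiD_conv (m : ℕ) : ∑ p ∈ Finset.HasAntidiagonal.antidiagonal m, phi p.1 * phiD p.2 ≤ phiD m := by
  have h1 : ∑ p ∈ Finset.HasAntidiagonal.antidiagonal m, phi p.1 * phi (p.2 + 1) ≤ phi (m + 1) := by
    refine le_trans ?_ (phi_conv (m + 1))
    rw [Finset.Nat.antidiagonal_succ']
    simp only [Finset.sum_cons, Finset.sum_map]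
    have := mul_pos (phi_pos (m + 1)) (phi_pos 0)
    simp
    linarith
  calc ∑ p ∈ Finset.HasAntidiagonal.antidiagonal m, phi p.1 * phiD p.2
      ≤ ∑ p ∈ Finset.HasAntidiagonal.antidiagonal m, ((m : ℝ) + 1) * (phi p.1 * phi (p.2 + 1)) := by
        refine Finset.sum_le_sum fun p hp => ?_
        have hm : (m : ℝ) = p.1 + p.2 := by
          rw [← Finset.HasAntidiagonal.mem_antidiagonal.1 hp]; push_cast; ring
        have := mul_pos (phi_pos p.1) (phi_pos (p.2 + 1))
        have ha : (0 : ℝ) ≤ p.1 := Nat.cast_nonneg _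
        unfold phiD
        rw [hm]
        nlinarith
    _ = ((m : ℝ) + 1) * ∑ p ∈ Finset.HasAntidiagonal.antidiagonal m, phi p.1 * phi (p.2 + 1) := by
        rw [Finset.mul_sum]
    _ ≤ phiD m := by unfold phiD; gcongr

lemma phi_le_succ (m : ℕ) : phi m ≤ 121 / 100 * phi (m + 1) := by
  unfold phi
  push_cast
  rw [mul_one_div, div_le_div_iff₀ (by positivity) (by positivity)]
  nlinarith [(Nat.cast_nonneg m : (0 : ℝ) ≤ m)]

lemma phi_le_phiD (m : ℕ) : phi m ≤ 2 * phiD m := by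
  have := phi_le_succ m
  have h := phi_pos (m + 1)
  unfold phiD
  nlinarith [mul_nonneg (Nat.cast_nonneg m : (0 : ℝ) ≤ m) h.le]

/-- The coefficients of the majorant `∑ ψ m * ((4/5) u + L t) ^ m`. -/
def bw (L : ℝ) (ψ : ℕ → ℝ) (n k : ℕ) : ℝ :=
  ((n + k).choose n : ℝ) * ψ (n + k) * (4 / 5) ^ k * L ^ n

/-- `f` is majorised by `M * ∑ ψ m * ((4/5) u + L t) ^ m`. -/
def Bd (L : ℝ) (ψ : ℕ → ℝ) (M : ℝ) (f : DSeries) : Prop := ∀ n k, |cf f n k| ≤ M * bw L ψ n k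

lemma bw_nonneg {L : ℝ} (hL : 0 ≤ L) {ψ : ℕ → ℝ} (hψ : ∀ m, 0 ≤ ψ m) (n k : ℕ) :
    0 ≤ bw L ψ n k := by
  unfold bw; have := hψ (n + k); positivity

lemma sum_choose_mul_choose (h : ℕ × ℕ → ℝ) (n k : ℕ) :
    ∑ p ∈ Finset.HasAntidiagonal.antidiagonal n, ∑ q ∈ Finset.HasAntidiagonal.antidiagonal k,
      ((p.1 + q.1).choose p.1 : ℝ) * ((p.2 + q.2).choose p.2 : ℝ) * h (p.1 + q.1, p.2 + q.2)
      = ((n + k).choose n : ℝ) * ∑ r ∈ Finset.HasAntidiagonal.antidiagonal (n + k), h r := by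
  have h1 : ∀ r ∈ Finset.HasAntidiagonal.antidiagonal (n + k), ((n + k).choose n : ℝ) * h r
      = ∑ p ∈ Finset.HasAntidiagonal.antidiagonal n, (r.1.choose p.1 : ℝ) * (r.2.choose p.2 : ℝ) * h r := by
    intro r hr
    rw [← Finset.HasAntidiagonal.mem_antidiagonal.1 hr, Nat.add_choose_eq]
    push_cast
    rw [Finset.sum_mul]
  rw [Finset.mul_sum, Finset.sum_congr rfl h1,
    Finset.sum_comm (s := Finset.HasAntidiagonal.antidiagonal (n + k))]
  refine Finset.sum_congr rfl fun p hp => ?_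
  have hp' := Finset.HasAntidiagonal.mem_antidiagonal.1 hp
  refine Finset.sum_of_injOn (fun q => (p.1 + q.1, p.2 + q.2)) ?_ ?_ ?_ ?_
  · intro q _ q' _ hq
    simp only [Prod.mk.injEq, add_right_inj] at hq
    exact Prod.ext hq.1 hq.2
  · intro q hq
    have := Finset.HasAntidiagonal.mem_antidiagonal.1 (Finset.mem_coe.1 hq)
    rw [Finset.mem_coe, Finset.HasAntidiagonal.mem_antidiagonal]
    simp only
    omega
  · intro r hr hr'
    have hr1 := Finset.HasAntidiagonal.mem_antidiagonal.1 hr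
    by_cases c1 : r.1 < p.1
    · simp [Nat.choose_eq_zero_of_lt c1]
    by_cases c2 : r.2 < p.2
    · simp [Nat.choose_eq_zero_of_lt c2]
    refine absurd ?_ hr'
    refine ⟨(r.1 - p.1, r.2 - p.2), ?_, ?_⟩
    · rw [Finset.mem_coe, Finset.HasAntidiagonal.mem_antidiagonal]; simp only; omega
    · ext <;> simp only <;> omega
  · intro q _; rfl

lemma Bd.mul {L : ℝ} (hL : 0 ≤ L) {ψ₁ ψ₂ ψ₃ : ℕ → ℝ}
    (h : ∀ m, ∑ p ∈ Finset.HasAntidiagonal.antidiagonal m, ψ₁ p.1 * ψ₂ p.2 ≤ ψ₃ m) {M N : ℝ}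
    (hM : 0 ≤ M) (hN : 0 ≤ N) {f g : DSeries} (hf : Bd L ψ₁ M f) (hg : Bd L ψ₂ N g) :
    Bd L ψ₃ (M * N) (f * g) := by
  intro n k
  rw [cf_mul]
  calc |∑ p ∈ Finset.HasAntidiagonal.antidiagonal n, ∑ q ∈ Finset.HasAntidiagonal.antidiagonal k, cf f p.1 q.1 * cf g p.2 q.2|
      ≤ ∑ p ∈ Finset.HasAntidiagonal.antidiagonal n, ∑ q ∈ Finset.HasAntidiagonal.antidiagonal k,
        (M * bw L ψ₁ p.1 q.1) * (N * bw L ψ₂ p.2 q.2) := by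
        refine (Finset.abs_sum_le_sum_abs _ _).trans (Finset.sum_le_sum fun p _ => ?_)
        refine (Finset.abs_sum_le_sum_abs _ _).trans (Finset.sum_le_sum fun q _ => ?_)
        rw [abs_mul]
        exact mul_le_mul (hf _ _) (hg _ _) (abs_nonneg _) ((abs_nonneg _).trans (hf _ _))
    _ = ∑ p ∈ Finset.HasAntidiagonal.antidiagonal n, ∑ q ∈ Finset.HasAntidiagonal.antidiagonal k,
        (M * N * ((4 / 5) ^ k * L ^ n)) * (((p.1 + q.1).choose p.1 : ℝ) *
          ((p.2 + q.2).choose p.2 : ℝ) *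
          (fun r : ℕ × ℕ => ψ₁ r.1 * ψ₂ r.2) (p.1 + q.1, p.2 + q.2)) := by
        refine Finset.sum_congr rfl fun p hp => Finset.sum_congr rfl fun q hq => ?_
        rw [← Finset.HasAntidiagonal.mem_antidiagonal.1 hp, ← Finset.HasAntidiagonal.mem_antidiagonal.1 hq]
        simp only [bw, pow_add]
        ring
    _ = M * N * ((4 / 5) ^ k * L ^ n) * (((n + k).choose n : ℝ) *
          ∑ r ∈ Finset.HasAntidiagonal.antidiagonal (n + k), ψ₁ r.1 * ψ₂ r.2) := by
        rw [← sum_choose_mul_choose]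
        simp only [Finset.mul_sum]
    _ ≤ M * N * ((4 / 5) ^ k * L ^ n) * (((n + k).choose n : ℝ) * ψ₃ (n + k)) := by
        gcongr
        exact h _
    _ = M * N * bw L ψ₃ n k := by unfold bw; ring

lemma Bd.add {L : ℝ} {ψ : ℕ → ℝ} {M N : ℝ} {f g : DSeries} (hf : Bd L ψ M f)
    (hg : Bd L ψ N g) : Bd L ψ (M + N) (f + g) := by
  intro n k
  rw [cf_add, add_mul]
  exact (abs_add_le _ _).trans (add_le_add (hf n k) (hg n k))

lemma Bd.sub {L : ℝ} {ψ : ℕ → ℝ} {M N : ℝ} {f g : DSeries} (hf : Bd L ψ M f)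
    (hg : Bd L ψ N g) : Bd L ψ (M + N) (f - g) := by
  intro n k
  rw [cf_sub, add_mul]
  exact (abs_sub _ _).trans (add_le_add (hf n k) (hg n k))

lemma Bd.mono {L : ℝ} (hL : 0 ≤ L) {ψ : ℕ → ℝ} (hψ : ∀ m, 0 ≤ ψ m) {M N : ℝ} {f : DSeries}
    (hf : Bd L ψ M f) (h : M ≤ N) : Bd L ψ N f := fun n k =>
  (hf n k).trans (mul_le_mul_of_nonneg_right h (bw_nonneg hL hψ n k))

lemma Bd.mul_phi {L : ℝ} (hL : 0 ≤ L) {M N : ℝ} (hM : 0 ≤ M) (hN : 0 ≤ N) {f g : DSeries}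
    (hf : Bd L phi M f) (hg : Bd L phi N g) : Bd L phi (M * N) (f * g) :=
  Bd.mul hL phi_conv hM hN hf hg

lemma Bd.mul_phiD {L : ℝ} (hL : 0 ≤ L) {M N : ℝ} (hM : 0 ≤ M) (hN : 0 ≤ N) {f g : DSeries}
    (hf : Bd L phi M f) (hg : Bd L phiD N g) : Bd L phiD (M * N) (f * g) :=
  Bd.mul hL phi_phiD_conv hM hN hf hg

lemma Bd.toD {L : ℝ} (hL : 0 ≤ L) {M : ℝ} (hM : 0 ≤ M) {f : DSeries} (hf : Bd L phi M f) :
    Bd L phiD (2 * M) f := fun n k => (hf n k).trans <| by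
  have : bw L phi n k ≤ 2 * bw L phiD n k := by
    unfold bw
    calc ((n + k).choose n : ℝ) * phi (n + k) * (4 / 5) ^ k * L ^ n
        ≤ ((n + k).choose n : ℝ) * (2 * phiD (n + k)) * (4 / 5) ^ k * L ^ n := by
          gcongr; exact phi_le_phiD _
      _ = _ := by ring
  nlinarith

lemma Bd.dU {L : ℝ} {M : ℝ} {f : DSeries} (hf : Bd L phi M f) :
    Bd L phiD (4 / 5 * M) (dU f) := by
  intro n k
  rw [StaticMakino.dU, cf_ofCf, abs_mul, abs_of_nonneg (by positivity)]
  refine (mul_le_mul_of_nonneg_left (hf n (k + 1)) (by positivity)).trans (le_of_eq ?_)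
  have h : ((k : ℝ) + 1) * ((n + (k + 1)).choose n : ℝ)
      = ((n + k).choose n : ℝ) * ((n + k : ℕ) + 1 : ℝ) := by
    have := Nat.add_one_mul_choose_eq (n + k) k
    have e1 : (n + (k + 1)).choose n = (n + k).succ.choose k.succ := by
      rw [show n + (k + 1) = n + k.succ by rfl, Nat.choose_symm_add]; rfl
    have e2 : (n + k).choose n = (n + k).choose k := Nat.choose_symm_add
    rw [e1, e2]
    exact_mod_cast (by linarith : (k + 1) * (n + k).succ.choose k.succ
      = (n + k).choose k * (n + k + 1))
  unfold bw phiD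
  rw [show n + (k + 1) = n + k + 1 by ring] at *
  linear_combination (M * phi (n + k + 1) * (4 / 5) ^ (k + 1) * L ^ n) * h

lemma Bd.intT {L : ℝ} (hL : 0 < L) {M : ℝ} (hM : 0 ≤ M) {f : DSeries} (hf : Bd L phiD M f) :
    Bd L phi (M / L) (intT f) := by
  intro n k
  rw [StaticMakino.intT, cf_ofCf]
  rcases n with _ | n
  · simp only [if_true, abs_zero]
    exact mul_nonneg (by positivity) (bw_nonneg hL.le (fun m => (phi_pos m).le) _ _)
  · rw [if_neg (by omega), abs_div, Nat.add_sub_cancel, Nat.abs_cast,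
      div_le_iff₀ (by positivity)]
    refine (hf n k).trans (le_of_eq ?_)
    have h : ((n + k : ℕ) + 1 : ℝ) * ((n + k).choose n : ℝ)
        = ((n + 1 + k).choose (n + 1) : ℝ) * ((n : ℝ) + 1) := by
      have := Nat.add_one_mul_choose_eq (n + k) n
      rw [show n + 1 + k = (n + k).succ by simp; ring]
      exact_mod_cast this
    unfold bw phiD
    rw [show n + 1 + k = n + k + 1 by ring] at *
    push_cast at h ⊢
    field_simp
    linear_combination (M * phi (n + k + 1) * L ^ (n + 1)) * h

lemma bw_le_succ {L : ℝ} (hL : 0 ≤ L) (n k : ℕ) :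
    bw L phi n k ≤ 38 / 25 * bw L phi n (k + 1) := by
  unfold bw
  have h1 : ((n + k).choose n : ℝ) ≤ ((n + (k + 1)).choose n : ℝ) := by
    exact_mod_cast Nat.choose_le_succ (n + k) n
  have h2 := phi_le_succ (n + k)
  have h3 := phi_pos (n + k + 1)
  calc ((n + k).choose n : ℝ) * phi (n + k) * (4 / 5) ^ k * L ^ n
      ≤ ((n + (k + 1)).choose n : ℝ) * (121 / 100 * phi (n + k + 1)) * (4 / 5) ^ k * L ^ n := by
        gcongr
        exact (phi_pos _).le
    _ = 605 / 400 * (((n + (k + 1)).choose n : ℝ) * phi (n + (k + 1)) * (4 / 5) ^ (k + 1)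
        * L ^ n) := by rw [← add_assoc]; ring
    _ ≤ _ := by
        refine mul_le_mul_of_nonneg_right (by norm_num) ?_
        have := phi_pos (n + (k + 1))
        positivity

lemma Bd.gSol {L : ℝ} (hL : 0 ≤ L) {M : ℝ} (hM : 0 ≤ M) (Q : ℝ) {f : DSeries}
    (hf : Bd L phi M f) : Bd L phi (6 * |Q| * M) (gSol Q f) := by
  intro n k
  rw [StaticMakino.gSol, cf_ofCf]
  have hQ := mul_nonneg (abs_nonneg Q) hM
  induction k with
  | zero =>
    have h0 := hf n 0
    have hb := bw_nonneg hL (fun m => (phi_pos m).le) n 0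
    rw [gCoef, abs_div, abs_mul, abs_of_pos (by norm_num : (0 : ℝ) < 3)]
    have := mul_le_mul_of_nonneg_left h0 (abs_nonneg Q)
    nlinarith [mul_nonneg hQ hb]
  | succ k ih =>
    have hb := bw_nonneg hL (fun m => (phi_pos m).le) n (k + 1)
    have hs := bw_le_succ hL n k
    have hk : (0 : ℝ) ≤ k := Nat.cast_nonneg k
    rw [gCoef, abs_div, abs_of_pos (by positivity : (0 : ℝ) < 2 * k + 5),
      div_le_iff₀ (by positivity)]
    have h1 : |Q * (cf f n (k + 1) - cf f n k)| ≤ |Q| * M * (63 / 25 * bw L phi n (k + 1)) := by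
      rw [abs_mul, mul_assoc]
      refine mul_le_mul_of_nonneg_left ?_ (abs_nonneg Q)
      have := abs_sub (cf f n (k + 1)) (cf f n k)
      have := hf n (k + 1)
      have := hf n k
      have := mul_le_mul_of_nonneg_left hs hM
      linarith
    have h2 : |((k : ℝ) + 3) * gCoef Q (cf f n) k|
        ≤ ((k : ℝ) + 3) * (6 * |Q| * M * (38 / 25 * bw L phi n (k + 1))) := by
      rw [abs_mul, abs_of_pos (by positivity : (0 : ℝ) < k + 3)]
      refine mul_le_mul_of_nonneg_left (ih.trans ?_) (by positivity)
      exact mul_le_mul_of_nonneg_left hs (by linarith)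
    have h3 := abs_add_le (((k : ℝ) + 3) * gCoef Q (cf f n) k) (Q * (cf f n (k + 1) - cf f n k))
    have h4 := mul_nonneg hQ hb
    nlinarith [mul_nonneg hk h4]

lemma exists_Bd_cu (p : Polynomial ℝ) : ∃ M, 0 ≤ M ∧ ∀ L, 0 ≤ L → Bd L phi M (cu p) := by
  refine ⟨∑ k ∈ p.support, |p.coeff k| / (phi k * (4 / 5) ^ k),
    Finset.sum_nonneg fun k _ => div_nonneg (abs_nonneg _) (mul_nonneg (phi_pos k).le (by positivity)), ?_⟩
  intro L hL n k
  have hnn : 0 ≤ ∑ k ∈ p.support, |p.coeff k| / (phi k * (4 / 5) ^ k) :=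
    Finset.sum_nonneg fun k _ => div_nonneg (abs_nonneg _) (mul_nonneg (phi_pos k).le (by positivity))
  rw [cf_cu]
  split_ifs with hn
  · subst hn
    by_cases hk : k ∈ p.support
    · have h1 := Finset.single_le_sum (f := fun k => |p.coeff k| / (phi k * (4 / 5) ^ k))
        (fun k _ => div_nonneg (abs_nonneg _) (mul_nonneg (phi_pos k).le (by positivity))) hk
      have hpos : 0 < phi k * (4 / 5 : ℝ) ^ k := mul_pos (phi_pos k) (by positivity)
      have h2 : bw L phi 0 k = phi k * (4 / 5) ^ k := by simp [bw]
      rw [h2]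
      exact (div_le_iff₀ hpos).1 h1
    · rw [Polynomial.notMem_support_iff.1 hk, abs_zero]
      exact mul_nonneg hnn (bw_nonneg hL (fun m => (phi_pos m).le) _ _)
  · rw [abs_zero]
    exact mul_nonneg hnn (bw_nonneg hL (fun m => (phi_pos m).le) _ _)

lemma Bd.pow {L : ℝ} (hL : 0 ≤ L) {M : ℝ} (hM : 0 ≤ M) {f : DSeries} (hf : Bd L phi M f)
    (j : ℕ) : Bd L phi (M ^ (j + 1)) (f ^ (j + 1)) := by
  induction j with
  | zero => simpa using hf
  | succ j ih =>
    rw [pow_succ _ (j + 1), pow_succ _ (j + 1)]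
    exact ih.mul_phi hL (by positivity) hM hf

/-! ### The formal Cauchy problem -/

/-- `f` and `g` agree up to order `t ^ N`. -/
def Agr (N : ℕ) (f g : DSeries) : Prop := ∀ n < N, ∀ k, cf f n k = cf g n k

lemma Agr.add {N : ℕ} {f f' g g' : DSeries} (hf : Agr N f f') (hg : Agr N g g') :
    Agr N (f + g) (f' + g') := fun n hn k => by rw [cf_add, cf_add, hf n hn k, hg n hn k]

lemma Agr.sub {N : ℕ} {f f' g g' : DSeries} (hf : Agr N f f') (hg : Agr N g g') :
    Agr N (f - g) (f' - g') := fun n hn k => by rw [cf_sub, cf_sub, hf n hn k, hg n hn k]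

lemma Agr.mul {N : ℕ} {f f' g g' : DSeries} (hf : Agr N f f') (hg : Agr N g g') :
    Agr N (f * g) (f' * g') := fun n hn k => by
  rw [cf_mul, cf_mul]
  refine Finset.sum_congr rfl fun p hp => Finset.sum_congr rfl fun q _ => ?_
  have := Finset.HasAntidiagonal.mem_antidiagonal.1 hp
  rw [hf p.1 (by omega), hg p.2 (by omega)]

lemma Agr.refl (N : ℕ) (f : DSeries) : Agr N f f := fun _ _ _ => rfl

lemma Agr.pow {N : ℕ} {f f' : DSeries} (hf : Agr N f f') (j : ℕ) : Agr N (f ^ j) (f' ^ j) := by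
  induction j with
  | zero => simpa using Agr.refl N 1
  | succ j ih => rw [pow_succ, pow_succ]; exact ih.mul hf

lemma Agr.dU {N : ℕ} {f f' : DSeries} (hf : Agr N f f') : Agr N (dU f) (dU f') :=
  fun n hn k => by rw [StaticMakino.dU, StaticMakino.dU, cf_ofCf, cf_ofCf, hf n hn]

lemma Agr.gSol {N : ℕ} (Q : ℝ) {f f' : DSeries} (hf : Agr N f f') :
    Agr N (gSol Q f) (gSol Q f') := fun n hn k => by
  have : cf f n = cf f' n := funext (hf n hn)
  rw [StaticMakino.gSol, StaticMakino.gSol, cf_ofCf, cf_ofCf, this]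

lemma Agr.intT {N : ℕ} {f f' : DSeries} (hf : Agr N f f') :
    Agr (N + 1) (intT f) (intT f') := fun n hn k => by
  rw [StaticMakino.intT, StaticMakino.intT, cf_ofCf, cf_ofCf]
  split_ifs with h
  · rfl
  · rw [hf (n - 1) (by omega)]

lemma dT_intT (f : DSeries) : dT (intT f) = f := by
  refine cf_ext fun n k => ?_
  rw [dT, intT, cf_ofCf, cf_ofCf, if_neg (by omega)]
  push_cast
  have : (n : ℝ) + 1 ≠ 0 := by positivity
  field_simp

lemma dT_add (f g : DSeries) : dT (f + g) = dT f + dT g := by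
  refine cf_ext fun n k => ?_
  simp only [dT, cf_ofCf, cf_add]; ring

lemma dT_cu (p : Polynomial ℝ) : dT (cu p) = 0 := by
  refine cf_ext fun n k => ?_
  rw [dT, cf_ofCf, cf_cu, if_neg (by omega), mul_zero]
  simp [cf]

/-- A quasilinear formal Cauchy problem with a nonlocal term, solved with geometric bounds. -/
theorem exists_formal_solution (A₁ A₂ A₃ B₁ B₂ B₃ B₄ : Polynomial ℝ) (Q : ℝ) :
    ∃ L M : ℝ, 0 < L ∧ 0 ≤ M ∧ ∃ ω ν : DSeries,
      dT ω = cu A₁ * (ν * dU ω) + cu A₂ * (ν * ω) + cu A₃ * (ω * dU ν) ∧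
      dT ν = cu B₁ * (ν * ν) + cu B₂ * (ν * dU ν) + cu B₃ * (ω * ω) + cu B₄ * (ω * dU ω)
        - gSol Q (ω ^ 10) ∧
      (∀ k, cf ω 0 k = if k = 0 then 1 else 0) ∧ (∀ k, cf ν 0 k = 0) ∧
      Bd L phi M ω ∧ Bd L phi M ν := by
  obtain ⟨a₁, ha₁, hA₁⟩ := exists_Bd_cu A₁
  obtain ⟨a₂, ha₂, hA₂⟩ := exists_Bd_cu A₂
  obtain ⟨a₃, ha₃, hA₃⟩ := exists_Bd_cu A₃
  obtain ⟨b₁, hb₁, hB₁⟩ := exists_Bd_cu B₁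
  obtain ⟨b₂, hb₂, hB₂⟩ := exists_Bd_cu B₂
  obtain ⟨b₃, hb₃, hB₃⟩ := exists_Bd_cu B₃
  obtain ⟨b₄, hb₄, hB₄⟩ := exists_Bd_cu B₄
  obtain ⟨m₀, hm₀, hI⟩ := exists_Bd_cu 1
  set M : ℝ := m₀ + 1 with hMdef
  have hM : 0 ≤ M := by positivity
  set Fω : DSeries → DSeries → DSeries := fun ω ν =>
    cu A₁ * (ν * dU ω) + cu A₂ * (ν * ω) + cu A₃ * (ω * dU ν) with hFω
  set Fν : DSeries → DSeries → DSeries := fun ω ν =>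
    cu B₁ * (ν * ν) + cu B₂ * (ν * dU ν) + cu B₃ * (ω * ω) + cu B₄ * (ω * dU ω)
        - gSol Q (ω ^ 10) with hFν
  set Kω : ℝ := a₁ * (M * (4 / 5 * M)) + 2 * (a₂ * (M * M)) + a₃ * (M * (4 / 5 * M)) with hKω
  set Kν : ℝ := 2 * (b₁ * (M * M)) + b₂ * (M * (4 / 5 * M)) + 2 * (b₃ * (M * M)) +
    b₄ * (M * (4 / 5 * M)) + 2 * (6 * |Q| * M ^ (9 + 1)) with hKν
  have hKω0 : 0 ≤ Kω := by positivity
  have hKν0 : 0 ≤ Kν := by positivity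
  set L : ℝ := Kω + Kν + 1 with hLdef
  have hL : 0 < L := by positivity
  have hφ : ∀ m, 0 ≤ phi m := fun m => (phi_pos m).le
  have bω : ∀ ω ν, Bd L phi M ω → Bd L phi M ν → Bd L phiD Kω (Fω ω ν) := by
    intro ω ν h1 h2
    have hD : 0 ≤ 4 / 5 * M := by positivity
    exact (((hA₁ L hL.le).mul_phiD hL.le ha₁ (by positivity) (h2.mul_phiD hL.le hM hD h1.dU)).add
      (((hA₂ L hL.le).mul_phi hL.le ha₂ (by positivity) (h2.mul_phi hL.le hM hM h1)).toD hL.le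
        (by positivity))).add
      ((hA₃ L hL.le).mul_phiD hL.le ha₃ (by positivity) (h1.mul_phiD hL.le hM hD h2.dU))
  have bν : ∀ ω ν, Bd L phi M ω → Bd L phi M ν → Bd L phiD Kν (Fν ω ν) := by
    intro ω ν h1 h2
    have hD : 0 ≤ 4 / 5 * M := by positivity
    exact ((((((hB₁ L hL.le).mul_phi hL.le hb₁ (by positivity)
      (h2.mul_phi hL.le hM hM h2)).toD hL.le (by positivity)).add
      ((hB₂ L hL.le).mul_phiD hL.le hb₂ (by positivity) (h2.mul_phiD hL.le hM hD h2.dU))).add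
      (((hB₃ L hL.le).mul_phi hL.le hb₃ (by positivity) (h1.mul_phi hL.le hM hM h1)).toD hL.le
        (by positivity))).add
      ((hB₄ L hL.le).mul_phiD hL.le hb₄ (by positivity) (h1.mul_phiD hL.le hM hD h1.dU))).sub
      (((h1.pow hL.le hM 9).gSol hL.le (by positivity) Q).toD hL.le (by positivity))
  have gω : ∀ N ω ν ω' ν', Agr N ω ω' → Agr N ν ν' → Agr N (Fω ω ν) (Fω ω' ν') := by
    intro N ω ν ω' ν' h1 h2
    exact (((Agr.refl _ _).mul (h2.mul h1.dU)).add ((Agr.refl _ _).mul (h2.mul h1))).add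
      ((Agr.refl _ _).mul (h1.mul h2.dU))
  have gν : ∀ N ω ν ω' ν', Agr N ω ω' → Agr N ν ν' → Agr N (Fν ω ν) (Fν ω' ν') := by
    intro N ω ν ω' ν' h1 h2
    exact (((((Agr.refl _ _).mul (h2.mul h2)).add ((Agr.refl _ _).mul (h2.mul h2.dU))).add
      ((Agr.refl _ _).mul (h1.mul h1))).add ((Agr.refl _ _).mul (h1.mul h1.dU))).sub
      ((h1.pow 10).gSol Q)
  let T : DSeries × DSeries → DSeries × DSeries := fun z =>
    (cu 1 + intT (Fω z.1 z.2), intT (Fν z.1 z.2))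
  let S : ℕ → DSeries × DSeries := fun N => T^[N] (cu 1, 0)
  have S_succ : ∀ N, S (N + 1) = T (S N) := fun N => Function.iterate_succ_apply' T N _
  have bS : ∀ N, Bd L phi M (S N).1 ∧ Bd L phi M (S N).2 := by
    intro N
    induction N with
    | zero =>
      refine ⟨(hI L hL.le).mono hL.le hφ (by linarith), fun n k => ?_⟩
      simp only [S, Function.iterate_zero, id, cf, map_zero, abs_zero]
      exact mul_nonneg hM (bw_nonneg hL.le hφ _ _)
    | succ N ih =>
      rw [S_succ]
      have e1 : Kω / L ≤ 1 := by rw [div_le_one hL]; linarith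
      have e2 : Kν / L ≤ 1 := by rw [div_le_one hL]; linarith
      exact ⟨((hI L hL.le).add ((bω _ _ ih.1 ih.2).intT hL hKω0)).mono hL.le hφ (by linarith),
        ((bν _ _ ih.1 ih.2).intT hL hKν0).mono hL.le hφ (by linarith)⟩
  have aS : ∀ N, Agr N (S N).1 (S (N + 1)).1 ∧ Agr N (S N).2 (S (N + 1)).2 := by
    intro N
    induction N with
    | zero => exact ⟨fun n hn => absurd hn (by omega), fun n hn => absurd hn (by omega)⟩
    | succ N ih =>
      have h1 : Agr (N + 1) (T (S N)).1 (T (S (N + 1))).1 :=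
        (Agr.refl _ _).add (gω _ _ _ _ _ ih.1 ih.2).intT
      have h2 : Agr (N + 1) (T (S N)).2 (T (S (N + 1))).2 := (gν _ _ _ _ _ ih.1 ih.2).intT
      rw [← S_succ, ← S_succ] at h1 h2
      exact ⟨h1, h2⟩
  have aS' : ∀ N j, Agr N (S N).1 (S (N + j)).1 ∧ Agr N (S N).2 (S (N + j)).2 := by
    intro N j
    induction j with
    | zero => exact ⟨Agr.refl _ _, Agr.refl _ _⟩
    | succ j ih =>
      have := aS (N + j)
      refine ⟨fun n hn k => (ih.1 n hn k).trans (this.1 n (by omega) k),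
        fun n hn k => (ih.2 n hn k).trans (this.2 n (by omega) k)⟩
  set ω : DSeries := ofCf fun n k => cf (S (n + 1)).1 n k with hω
  set ν : DSeries := ofCf fun n k => cf (S (n + 1)).2 n k with hν
  have aω : ∀ N, Agr N ω (S N).1 := fun N n hn k => by
    rw [hω, cf_ofCf]
    obtain ⟨j, rfl⟩ := Nat.exists_eq_add_of_le (Nat.succ_le_of_lt hn)
    exact (aS' (n + 1) j).1 n (by omega) k
  have aν : ∀ N, Agr N ν (S N).2 := fun N n hn k => by
    rw [hν, cf_ofCf]
    obtain ⟨j, rfl⟩ := Nat.exists_eq_add_of_le (Nat.succ_le_of_lt hn)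
    exact (aS' (n + 1) j).2 n (by omega) k
  have eω : ω = cu 1 + intT (Fω ω ν) := by
    refine cf_ext fun n k => ?_
    rw [aω (n + 1) n (by omega) k, S_succ]
    exact ((Agr.refl (n + 1) (cu 1)).add (gω n _ _ _ _ (aω n) (aν n)).intT n (by omega) k).symm
  have eν : ν = intT (Fν ω ν) := by
    refine cf_ext fun n k => ?_
    rw [aν (n + 1) n (by omega) k, S_succ]
    exact ((gν n _ _ _ _ (aω n) (aν n)).intT n (by omega) k).symm
  refine ⟨L, M, hL, hM, ω, ν, ?_, ?_, ?_, ?_, ?_, ?_⟩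
  · conv_lhs => rw [eω]
    rw [dT_add, dT_cu, zero_add, dT_intT]
  · conv_lhs => rw [eν]
    rw [dT_intT]
  · intro k
    rw [eω, cf_add, cf_cu, intT, cf_ofCf]
    simp [Polynomial.coeff_one]
  · intro k
    rw [eν, intT, cf_ofCf]
    simp
  · intro n k
    rw [aω (n + 1) n (by omega) k]
    exact (bS _).1 n k
  · intro n k
    rw [aν (n + 1) n (by omega) k]
    exact (bS _).2 n k

lemma choose_mul_le_one (n k : ℕ) :
    ((n + k).choose n : ℝ) * (9 / 10) ^ k * (1 / 10) ^ n ≤ 1 := by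
  have h := add_pow (1 / 10 : ℝ) (9 / 10) (n + k)
  rw [show (1 / 10 : ℝ) + 9 / 10 = 1 by norm_num, one_pow] at h
  have := Finset.single_le_sum (f := fun m => (1 / 10 : ℝ) ^ m * (9 / 10) ^ (n + k - m) *
    ((n + k).choose m : ℝ)) (s := Finset.range (n + k + 1)) (fun m _ => by positivity)
    (Finset.mem_range.2 (by omega : n < n + k + 1))
  rw [← h] at this
  refine le_trans (le_of_eq ?_) this
  simp only [Nat.add_sub_cancel_left]
  ring

lemma Bd.geometric {L M : ℝ} (hL : 0 < L) (hM : 0 ≤ M) {f : DSeries} (hf : Bd L phi M f)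
    (n k : ℕ) : |cf f n k| ≤ M * ((8 / 9) ^ k * (10 * L) ^ n) := by
  refine (hf n k).trans (mul_le_mul_of_nonneg_left ?_ hM)
  have h1 : phi (n + k) ≤ 1 := by
    unfold phi
    rw [div_le_one (by positivity)]
    nlinarith [(Nat.cast_nonneg (n + k) : (0 : ℝ) ≤ (n + k : ℕ))]
  have h2 := choose_mul_le_one n k
  have h3 := (phi_pos (n + k)).le
  have e : bw L phi n k = (((n + k).choose n : ℝ) * (9 / 10) ^ k * (1 / 10) ^ n) * phi (n + k) *
      ((8 / 9) ^ k * (10 * L) ^ n) := by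
    have e1 : (4 / 5 : ℝ) ^ k = (9 / 10) ^ k * (8 / 9) ^ k := by rw [← mul_pow]; norm_num
    have e2 : L ^ n = (1 / 10) ^ n * (10 * L) ^ n := by
      rw [← mul_pow]; congr 1; ring
    unfold bw
    rw [e1, e2]; ring
  rw [e]
  refine mul_le_of_le_one_left (by positivity) ?_
  exact mul_le_one₀ h2 h3 h1

/-! ### Evaluation of convergent series -/

/-- The double series converges absolutely for `|t| < r` and `|u| < 9/8`. -/
def Conv (r : ℝ) (f : DSeries) : Prop := ∀ τ σ : ℝ, 0 ≤ τ → τ < r → 0 ≤ σ → σ < 9 / 8 →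
  Summable fun p : ℕ × ℕ => |cf f p.1 p.2| * (τ ^ p.1 * σ ^ p.2)

/-- The value of a double series at `(t, u)`. -/
def Ev (f : DSeries) (t u : ℝ) : ℝ := ∑' p : ℕ × ℕ, cf f p.1 p.2 * (t ^ p.1 * u ^ p.2)

lemma Bd.conv {L M : ℝ} (hL : 0 < L) (hM : 0 ≤ M) {f : DSeries} (hf : Bd L phi M f) :
    Conv (1 / (10 * L)) f := by
  intro τ σ h1 h2 h3 h4
  have hτ : 10 * L * τ < 1 := by
    rw [lt_div_iff₀ (by positivity)] at h2; linarith
  have s1 : Summable fun n : ℕ => (10 * L * τ) ^ n := summable_geometric_of_lt_one (by positivity) hτ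
  have s2 : Summable fun n : ℕ => (8 / 9 * σ) ^ n :=
    summable_geometric_of_lt_one (by positivity) (by linarith)
  refine Summable.of_nonneg_of_le (fun p => by positivity) (fun p => ?_)
    ((s1.mul_of_nonneg s2 (fun _ => by positivity) (fun _ => by positivity)).mul_left M)
  calc |cf f p.1 p.2| * (τ ^ p.1 * σ ^ p.2)
      ≤ M * ((8 / 9) ^ p.2 * (10 * L) ^ p.1) * (τ ^ p.1 * σ ^ p.2) :=
        mul_le_mul_of_nonneg_right (hf.geometric hL hM _ _) (by positivity)
    _ = _ := by rw [mul_pow _ τ, mul_pow _ σ]; ring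

lemma Conv.summable {r : ℝ} {f : DSeries} (hf : Conv r f) {t u : ℝ} (ht : |t| < r)
    (hu : |u| < 9 / 8) : Summable fun p : ℕ × ℕ => cf f p.1 p.2 * (t ^ p.1 * u ^ p.2) := by
  refine Summable.of_norm ?_
  simpa [abs_mul, abs_pow] using hf _ _ (abs_nonneg t) ht (abs_nonneg u) hu

lemma Conv.add {r : ℝ} {f g : DSeries} (hf : Conv r f) (hg : Conv r g) : Conv r (f + g) := by
  intro τ σ h1 h2 h3 h4
  refine Summable.of_nonneg_of_le (fun p => by positivity) (fun p => ?_)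
    ((hf τ σ h1 h2 h3 h4).add (hg τ σ h1 h2 h3 h4))
  rw [cf_add, ← add_mul]
  exact mul_le_mul_of_nonneg_right (abs_add_le _ _) (by positivity)

lemma Ev_add {r : ℝ} {f g : DSeries} (hf : Conv r f) (hg : Conv r g) {t u : ℝ} (ht : |t| < r)
    (hu : |u| < 9 / 8) : Ev (f + g) t u = Ev f t u + Ev g t u := by
  unfold Ev
  rw [← (hf.summable ht hu).tsum_add (hg.summable ht hu)]
  simp only [cf_add, add_mul]

lemma Ev_sub {r : ℝ} {f g : DSeries} (hf : Conv r f) (hg : Conv r g) {t u : ℝ} (ht : |t| < r)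
    (hu : |u| < 9 / 8) : Ev (f - g) t u = Ev f t u - Ev g t u := by
  unfold Ev
  rw [← (hf.summable ht hu).tsum_sub (hg.summable ht hu)]
  simp only [cf_sub, sub_mul]

/-- The antidiagonals of `ℕ × ℕ` are products of antidiagonals. -/
instance instHasAntidiagonalProd : Finset.HasAntidiagonal (ℕ × ℕ) where
  antidiagonal n := ((Finset.HasAntidiagonal.antidiagonal n.1) ×ˢ
    (Finset.HasAntidiagonal.antidiagonal n.2)).map (Equiv.prodProdProdComm ℕ ℕ ℕ ℕ).toEmbedding
  mem_antidiagonal := by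
    rintro ⟨a, b⟩ ⟨⟨c, d⟩, ⟨e, f⟩⟩
    simp only [Finset.mem_map_equiv, Finset.mem_product, Finset.HasAntidiagonal.mem_antidiagonal,
      Equiv.prodProdProdComm_symm, Equiv.prodProdProdComm_apply, Prod.mk_add_mk, Prod.mk.injEq]

lemma sum_antidiagonal_prod (F : (ℕ × ℕ) × (ℕ × ℕ) → ℝ) (p : ℕ × ℕ) :
    ∑ kl ∈ Finset.HasAntidiagonal.antidiagonal p, F kl
      = ∑ a ∈ Finset.HasAntidiagonal.antidiagonal p.1,
        ∑ b ∈ Finset.HasAntidiagonal.antidiagonal p.2, F ((a.1, b.1), (a.2, b.2)) := by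
  rw [← Finset.sum_product']
  show ∑ kl ∈ Finset.map _ _, F kl = _
  rw [Finset.sum_map]
  rfl

lemma sum_antidiagonal_terms (f g : DSeries) (t u : ℝ) (p : ℕ × ℕ) :
    ∑ kl ∈ Finset.HasAntidiagonal.antidiagonal p,
      (cf f kl.1.1 kl.1.2 * (t ^ kl.1.1 * u ^ kl.1.2)) *
        (cf g kl.2.1 kl.2.2 * (t ^ kl.2.1 * u ^ kl.2.2))
      = cf (f * g) p.1 p.2 * (t ^ p.1 * u ^ p.2) := by
  rw [sum_antidiagonal_prod, cf_mul, Finset.sum_mul]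
  refine Finset.sum_congr rfl fun a ha => ?_
  rw [Finset.sum_mul]
  refine Finset.sum_congr rfl fun b hb => ?_
  rw [← Finset.HasAntidiagonal.mem_antidiagonal.1 ha, ← Finset.HasAntidiagonal.mem_antidiagonal.1 hb,
    pow_add, pow_add]
  ring

lemma Conv.mul {r : ℝ} {f g : DSeries} (hf : Conv r f) (hg : Conv r g) : Conv r (f * g) := by
  intro τ σ h1 h2 h3 h4
  have hs : Summable fun p : ℕ × ℕ => ∑ kl ∈ Finset.HasAntidiagonal.antidiagonal p,
      (|cf f kl.1.1 kl.1.2| * (τ ^ kl.1.1 * σ ^ kl.1.2)) *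
        (|cf g kl.2.1 kl.2.2| * (τ ^ kl.2.1 * σ ^ kl.2.2)) :=
    summable_sum_mul_antidiagonal_of_summable_mul
      (f := fun q : ℕ × ℕ => |cf f q.1 q.2| * (τ ^ q.1 * σ ^ q.2))
      (g := fun q : ℕ × ℕ => |cf g q.1 q.2| * (τ ^ q.1 * σ ^ q.2))
      ((hf τ σ h1 h2 h3 h4).mul_of_nonneg (hg τ σ h1 h2 h3 h4) (fun _ => by positivity)
        (fun _ => by positivity))
  refine Summable.of_nonneg_of_le (fun p => mul_nonneg (abs_nonneg _) (by positivity))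
    (fun p => ?_) hs
  rw [← abs_of_nonneg (by positivity : 0 ≤ τ ^ p.1 * σ ^ p.2), ← abs_mul,
    ← sum_antidiagonal_terms]
  refine (Finset.abs_sum_le_sum_abs _ _).trans (le_of_eq (Finset.sum_congr rfl fun kl _ => ?_))
  simp only [abs_mul, abs_pow, abs_of_nonneg h1, abs_of_nonneg h3]

lemma Ev_mul {r : ℝ} {f g : DSeries} (hf : Conv r f) (hg : Conv r g) {t u : ℝ} (ht : |t| < r)
    (hu : |u| < 9 / 8) : Ev (f * g) t u = Ev f t u * Ev g t u := by
  have hs : Summable fun x : (ℕ × ℕ) × (ℕ × ℕ) => (cf f x.1.1 x.1.2 * (t ^ x.1.1 * u ^ x.1.2)) *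
        (cf g x.2.1 x.2.2 * (t ^ x.2.1 * u ^ x.2.2)) :=
    ((hf.summable ht hu).norm.mul_norm (hg.summable ht hu).norm).of_norm
  unfold Ev
  rw [(hf.summable ht hu).tsum_mul_tsum_eq_tsum_sum_antidiagonal (hg.summable ht hu) hs]
  simp only [sum_antidiagonal_terms]

lemma hasSum_cu (p : Polynomial ℝ) (t u : ℝ) :
    HasSum (fun q : ℕ × ℕ => cf (cu p) q.1 q.2 * (t ^ q.1 * u ^ q.2)) (p.eval u) := by
  have : p.eval u = ∑ q ∈ p.support.map ⟨fun k => ((0 : ℕ), k), fun _ _ h => (Prod.ext_iff.1 h).2⟩,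
      cf (cu p) q.1 q.2 * (t ^ q.1 * u ^ q.2) := by
    rw [Finset.sum_map, Polynomial.eval_eq_sum, Polynomial.sum]
    refine Finset.sum_congr rfl fun k _ => ?_
    show p.coeff k * u ^ k = cf (cu p) 0 k * (t ^ 0 * u ^ k)
    simp [cf_cu]
  rw [this]
  refine hasSum_sum_of_ne_finset_zero fun q hq => ?_
  rw [cf_cu]
  split_ifs with h
  · have : p.coeff q.2 = 0 := by
      by_contra hc
      exact hq (Finset.mem_map.2 ⟨q.2, Polynomial.mem_support_iff.2 hc, Prod.ext h.symm rfl⟩)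
    rw [this, zero_mul]
  · rw [zero_mul]

lemma Ev_cu (p : Polynomial ℝ) (t u : ℝ) : Ev (cu p) t u = p.eval u := (hasSum_cu p t u).tsum_eq

lemma Conv.cu (r : ℝ) (p : Polynomial ℝ) : Conv r (cu p) := by
  intro τ σ h1 h2 h3 h4
  have := (hasSum_cu p τ σ).summable.norm
  simpa only [Real.norm_eq_abs, abs_mul, abs_of_nonneg h1, abs_of_nonneg h3, abs_pow] using this

lemma Conv.pow {r : ℝ} {f : DSeries} (hf : Conv r f) (j : ℕ) : Conv r (f ^ (j + 1)) := by
  induction j with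
  | zero => simpa using hf
  | succ j ih => rw [pow_succ]; exact ih.mul hf

lemma Ev_pow {r : ℝ} {f : DSeries} (hf : Conv r f) {t u : ℝ} (ht : |t| < r)
    (hu : |u| < 9 / 8) (j : ℕ) : Ev (f ^ (j + 1)) t u = Ev f t u ^ (j + 1) := by
  induction j with
  | zero => simp
  | succ j ih => rw [pow_succ, Ev_mul (hf.pow j) hf ht hu, ih, pow_succ _ (j + 1)]

lemma succ_mul_pow_mul_sub_le {σ σ' : ℝ} (h : 0 ≤ σ) (h' : σ ≤ σ') (k : ℕ) :
    ((k : ℝ) + 1) * σ ^ k * (σ' - σ) ≤ σ' ^ (k + 1) - σ ^ (k + 1) := by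
  induction k with
  | zero => simp
  | succ k ih =>
    have h1 := mul_le_mul_of_nonneg_left ih h
    have h2 : 0 ≤ (σ' - σ) * (σ' ^ (k + 1) - σ ^ (k + 1)) :=
      mul_nonneg (by linarith) (sub_nonneg.2 (pow_le_pow_left₀ h h' _))
    push_cast
    rw [pow_succ σ' (k + 1), pow_succ σ (k + 1)]
    rw [pow_succ σ k] at *
    nlinarith

lemma succ_mul_pow_le {σ σ' : ℝ} (h : 0 ≤ σ) (h' : σ < σ') (k : ℕ) :
    ((k : ℝ) + 1) * σ ^ k ≤ (σ' - σ)⁻¹ * σ' ^ (k + 1) := by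
  have h1 := succ_mul_pow_mul_sub_le h h'.le k
  have h2 : 0 ≤ σ ^ (k + 1) := by positivity
  rw [inv_mul_eq_div, le_div_iff₀ (by linarith)]
  linarith

/-- Increasing the exponent of `u`. -/
def succU (p : ℕ × ℕ) : ℕ × ℕ := (p.1, p.2 + 1)

/-- Increasing the exponent of `t`. -/
def succT (p : ℕ × ℕ) : ℕ × ℕ := (p.1 + 1, p.2)

lemma succU_injective : Function.Injective succU := by
  rintro ⟨a, b⟩ ⟨c, d⟩ h; simpa [succU] using h

lemma succT_injective : Function.Injective succT := by
  rintro ⟨a, b⟩ ⟨c, d⟩ h; simpa [succT] using h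

lemma Conv.dU {r : ℝ} {f : DSeries} (hf : Conv r f) : Conv r (dU f) := by
  intro τ σ h1 h2 h3 h4
  obtain ⟨σ', h5, h6⟩ := exists_between h4
  have := ((hf τ σ' h1 h2 (h3.trans h5.le) h6).comp_injective succU_injective).mul_left (σ' - σ)⁻¹
  refine Summable.of_nonneg_of_le (fun p => by positivity) (fun p => ?_) this
  simp only [StaticMakino.dU, cf_ofCf, Function.comp, succU]
  rw [abs_mul, abs_of_nonneg (by positivity)]
  have h7 := mul_le_mul_of_nonneg_left (succ_mul_pow_le h3 h5 p.2)
    (by positivity : 0 ≤ |cf f p.1 (p.2 + 1)| * τ ^ p.1)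
  linarith

lemma Conv.dT {r : ℝ} {f : DSeries} (hf : Conv r f) : Conv r (dT f) := by
  intro τ σ h1 h2 h3 h4
  obtain ⟨τ', h5, h6⟩ := exists_between h2
  have := ((hf τ' σ (h1.trans h5.le) h6 h3 h4).comp_injective succT_injective).mul_left (τ' - τ)⁻¹
  refine Summable.of_nonneg_of_le (fun p => by positivity) (fun p => ?_) this
  simp only [StaticMakino.dT, cf_ofCf, Function.comp, succT]
  rw [abs_mul, abs_of_nonneg (by positivity)]
  have h7 := mul_le_mul_of_nonneg_left (succ_mul_pow_le h1 h5 p.1)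
    (by positivity : 0 ≤ |cf f (p.1 + 1) p.2| * σ ^ p.2)
  linarith

lemma Conv.hasDerivAt_u {r : ℝ} {f : DSeries} (hf : Conv r f) {t u : ℝ} (ht : |t| < r)
    (hu : |u| < 9 / 8) : HasDerivAt (Ev f t) (Ev (StaticMakino.dU f) t u) u := by
  obtain ⟨σ, h5, h6⟩ := exists_between hu
  have h0 : 0 ≤ σ := (abs_nonneg u).trans h5.le
  have hsupp : ∀ (F : ℕ × ℕ → ℝ), (∀ n, F (n, 0) = 0) → Function.support F ⊆ Set.range succU := by
    rintro F hF ⟨n, k⟩ hk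
    rcases k with _ | k
    · exact absurd (hF n) hk
    · exact ⟨(n, k), rfl⟩
  have key : HasDerivAt (fun z => ∑' p : ℕ × ℕ, cf f p.1 p.2 * (t ^ p.1 * z ^ p.2))
      (∑' p : ℕ × ℕ, cf f p.1 p.2 * (t ^ p.1 * ((p.2 : ℝ) * u ^ (p.2 - 1)))) u := by
    refine hasDerivAt_tsum_of_isPreconnected (t := Ioo (-σ) σ)
      (u := fun p : ℕ × ℕ => |cf f p.1 p.2| * (|t| ^ p.1 * ((p.2 : ℝ) * σ ^ (p.2 - 1))))
      (g' := fun p z => cf f p.1 p.2 * (t ^ p.1 * ((p.2 : ℝ) * z ^ (p.2 - 1)))) ?_ isOpen_Ioo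
      isPreconnected_Ioo ?_ ?_ (abs_lt.1 h5) (hf.summable ht hu) (abs_lt.1 h5)
    · rw [← succU_injective.summable_iff]
      · refine (hf.dU |t| σ (abs_nonneg _) ht h0 h6).congr fun p => ?_
        simp only [StaticMakino.dU, cf_ofCf, Function.comp, succU]
        rw [abs_mul, abs_of_nonneg (by positivity)]
        push_cast
        ring
      · rintro ⟨n, k⟩ hk
        rcases k with _ | k
        · simp
        · exact absurd ⟨(n, k), rfl⟩ hk
    · intro p z _
      exact ((hasDerivAt_pow p.2 z).const_mul _).const_mul _
    · intro p z hz
      have hz' : |z| ≤ σ := (abs_lt.2 hz).le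
      rw [Real.norm_eq_abs, abs_mul, abs_mul, abs_mul, abs_pow, abs_pow, Nat.abs_cast]
      gcongr
  have e : Ev (StaticMakino.dU f) t u
      = ∑' p : ℕ × ℕ, cf f p.1 p.2 * (t ^ p.1 * ((p.2 : ℝ) * u ^ (p.2 - 1))) := by
    rw [← succU_injective.tsum_eq (hsupp _ (by intro n; simp))]
    unfold Ev
    refine tsum_congr fun p => ?_
    simp only [StaticMakino.dU, cf_ofCf, succU]
    push_cast
    ring
  rw [e]
  exact key

lemma Conv.hasDerivAt_t {r : ℝ} {f : DSeries} (hf : Conv r f) {t u : ℝ} (ht : |t| < r)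
    (hu : |u| < 9 / 8) : HasDerivAt (fun s => Ev f s u) (Ev (StaticMakino.dT f) t u) t := by
  obtain ⟨τ, h5, h6⟩ := exists_between ht
  have h0 : 0 ≤ τ := (abs_nonneg t).trans h5.le
  have hsupp : ∀ (F : ℕ × ℕ → ℝ), (∀ n, F (0, n) = 0) → Function.support F ⊆ Set.range succT := by
    rintro F hF ⟨n, k⟩ hk
    rcases n with _ | n
    · exact absurd (hF k) hk
    · exact ⟨(n, k), rfl⟩
  have key : HasDerivAt (fun z => ∑' p : ℕ × ℕ, cf f p.1 p.2 * (z ^ p.1 * u ^ p.2))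
      (∑' p : ℕ × ℕ, cf f p.1 p.2 * (((p.1 : ℝ) * t ^ (p.1 - 1)) * u ^ p.2)) t := by
    refine hasDerivAt_tsum_of_isPreconnected (t := Ioo (-τ) τ)
      (u := fun p : ℕ × ℕ => |cf f p.1 p.2| * (((p.1 : ℝ) * τ ^ (p.1 - 1)) * |u| ^ p.2))
      (g' := fun p z => cf f p.1 p.2 * (((p.1 : ℝ) * z ^ (p.1 - 1)) * u ^ p.2)) ?_ isOpen_Ioo
      isPreconnected_Ioo ?_ ?_ (abs_lt.1 h5) (hf.summable ht hu) (abs_lt.1 h5)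
    · rw [← succT_injective.summable_iff]
      · refine (hf.dT τ |u| h0 h6 (abs_nonneg _) hu).congr fun p => ?_
        simp only [StaticMakino.dT, cf_ofCf, Function.comp, succT]
        rw [abs_mul, abs_of_nonneg (by positivity)]
        push_cast
        ring
      · rintro ⟨n, k⟩ hk
        rcases n with _ | n
        · simp
        · exact absurd ⟨(n, k), rfl⟩ hk
    · intro p z _
      exact ((hasDerivAt_pow p.1 z).mul_const _).const_mul _
    · intro p z hz
      have hz' : |z| ≤ τ := (abs_lt.2 hz).le
      rw [Real.norm_eq_abs, abs_mul, abs_mul, abs_mul, abs_pow, abs_pow, Nat.abs_cast]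
      gcongr
  have e : Ev (StaticMakino.dT f) t u
      = ∑' p : ℕ × ℕ, cf f p.1 p.2 * (((p.1 : ℝ) * t ^ (p.1 - 1)) * u ^ p.2) := by
    rw [← succT_injective.tsum_eq (hsupp _ (by intro n; simp))]
    unfold Ev
    refine tsum_congr fun p => ?_
    simp only [StaticMakino.dT, cf_ofCf, succT]
    push_cast
    ring
  rw [e]
  exact key

/-- Uniform bound on `[-T, T] × [-1, 1]`. -/
lemma Conv.exists_bound {r : ℝ} {f : DSeries} (hf : Conv r f) {T : ℝ} (hT0 : 0 ≤ T) (hT : T < r) :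
    ∃ C, 0 ≤ C ∧ ∀ t u : ℝ, |t| ≤ T → |u| ≤ 1 → |Ev f t u| ≤ C := by
  have hs := hf T 1 hT0 hT zero_le_one (by norm_num)
  refine ⟨∑' p : ℕ × ℕ, |cf f p.1 p.2| * (T ^ p.1 * 1 ^ p.2),
    tsum_nonneg fun p => by positivity, fun t u ht hu => ?_⟩
  rw [← Real.norm_eq_abs]
  refine tsum_of_norm_bounded hs.hasSum fun p => ?_
  rw [Real.norm_eq_abs, abs_mul, abs_mul, abs_pow, abs_pow]
  gcongr

lemma Conv.exists_lipschitz {r : ℝ} {f : DSeries} (hf : Conv r f) {T : ℝ} (hT0 : 0 ≤ T)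
    (hT : T < r) : ∃ C, 0 ≤ C ∧ ∀ t t' u : ℝ, t ∈ Icc 0 T → t' ∈ Icc 0 T → |u| ≤ 1 →
      |Ev f t' u - Ev f t u| ≤ C * |t' - t| := by
  obtain ⟨C, hC, h⟩ := hf.dT.exists_bound hT0 hT
  refine ⟨C, hC, fun t t' u ht ht' hu => ?_⟩
  refine (convex_Icc 0 T).norm_image_sub_le_of_norm_hasDerivWithin_le (f := fun s => Ev f s u)
    (f' := fun s => Ev (StaticMakino.dT f) s u) (fun s hs => ?_) (fun s hs => ?_) ht ht'
  · refine (hf.hasDerivAt_t ?_ (by linarith)).hasDerivWithinAt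
    rw [abs_of_nonneg hs.1]; exact hs.2.trans_lt hT
  · exact h s u (by rw [abs_of_nonneg hs.1]; exact hs.2) hu

lemma Conv.exists_taylor {r : ℝ} {f : DSeries} (hf : Conv r f) {T : ℝ} (hT0 : 0 ≤ T)
    (hT : T < r) : ∃ C, 0 ≤ C ∧ ∀ t t' u : ℝ, t ∈ Icc 0 T → t' ∈ Icc 0 T → t' ≠ t → |u| ≤ 1 →
      |(Ev f t' u - Ev f t u) / (t' - t) - Ev (StaticMakino.dT f) t u| ≤ C * |t' - t| := by
  obtain ⟨C, hC, h⟩ := hf.dT.exists_lipschitz hT0 hT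
  refine ⟨C, hC, fun t t' u ht ht' hne hu => ?_⟩
  have hsub : uIcc t t' ⊆ Icc 0 T := (ordConnected_Icc.uIcc_subset ht ht')
  have hd : ∀ s ∈ uIcc t t', HasDerivWithinAt
      (fun s => Ev f s u - s * Ev (StaticMakino.dT f) t u)
      (Ev (StaticMakino.dT f) s u - 1 * Ev (StaticMakino.dT f) t u) (uIcc t t') s := by
    intro s hs
    have hs' := hsub hs
    refine HasDerivAt.hasDerivWithinAt ?_
    refine (hf.hasDerivAt_t ?_ (by linarith)).sub ((hasDerivAt_id s).mul_const _)
    rw [abs_of_nonneg hs'.1]; exact hs'.2.trans_lt hT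
  have := (convex_uIcc t t').norm_image_sub_le_of_norm_hasDerivWithin_le (C := C * |t' - t|)
    hd (fun s hs => ?_) left_mem_uIcc right_mem_uIcc
  · have hne' : t' - t ≠ 0 := sub_ne_zero.2 hne
    have e : (Ev f t' u - Ev f t u) / (t' - t) - Ev (StaticMakino.dT f) t u
        = ((Ev f t' u - t' * Ev (StaticMakino.dT f) t u) -
          (Ev f t u - t * Ev (StaticMakino.dT f) t u)) / (t' - t) := by
      field_simp; ring
    rw [e, abs_div, div_le_iff₀ (abs_pos.2 hne')]
    exact this
  · rw [one_mul]
    refine (h t s u ht (hsub hs) hu).trans ?_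
    refine mul_le_mul_of_nonneg_left ?_ hC
    exact abs_sub_left_of_mem_uIcc hs

lemma gSol_equation (Q : ℝ) (F : DSeries) :
    cu (Polynomial.X * (2 - Polynomial.X)) * dU (gSol Q F)
      + cu (3 * (1 - Polynomial.X)) * gSol Q F
      = cu (Polynomial.C Q * (1 - Polynomial.X)) * F := by
  ext n : 1
  have hd : PowerSeries.coeff n (dU (gSol Q F))
      = PowerSeries.mk fun k => ((k : ℝ) + 1) * gCoef Q (cf F n) (k + 1) := by
    ext k; simp [dU, gSol, ofCf, cf]
  have hg : PowerSeries.coeff n (gSol Q F) = PowerSeries.mk (gCoef Q (cf F n)) := by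
    ext k; simp [gSol, ofCf]
  have hF : PowerSeries.coeff n F = PowerSeries.mk (cf F n) := by
    ext k; simp [cf]
  simp only [cu, map_add, PowerSeries.coeff_C_mul, hd, hg, hF]
  push_cast
  ext k
  have c2 : ((2 : Polynomial ℝ) : PowerSeries ℝ) = PowerSeries.C 2 := by
    rw [← Polynomial.coe_C]; rfl
  have c3 : ((3 : Polynomial ℝ) : PowerSeries ℝ) = PowerSeries.C 3 := by
    rw [← Polynomial.coe_C]; rfl
  simp only [c2, c3, sub_mul, mul_sub, mul_assoc, one_mul, map_add, map_sub,
    PowerSeries.coeff_C_mul]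
  rcases k with _ | k
  · simp only [PowerSeries.coeff_zero_X_mul, PowerSeries.coeff_mk]
    rw [gCoef]; ring
  · rcases k with _ | k <;>
    simp only [PowerSeries.coeff_zero_X_mul, PowerSeries.coeff_succ_X_mul,
      PowerSeries.coeff_mk, PowerSeries.coeff_C_mul]
    · have h : gCoef Q (cf F n) (0 + 1) = ((((0 : ℕ) : ℝ) + 3) * gCoef Q (cf F n) 0 +
        Q * (cf F n (0 + 1) - cf F n 0)) / (2 * ((0 : ℕ) : ℝ) + 5) := rfl
      rw [h]
      push_cast
      ring
    · have h : gCoef Q (cf F n) (k + 1 + 1) = ((((k + 1 : ℕ) : ℝ) + 3) * gCoef Q (cf F n) (k + 1) +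
        Q * (cf F n (k + 1 + 1) - cf F n (k + 1))) / (2 * ((k + 1 : ℕ) : ℝ) + 5) := rfl
      rw [h]
      push_cast
      field_simp
      ring

/-! ### Weighted symbol estimates and the weighted Sobolev norm -/

lemma exists_fourier_decay (N : ℕ) : ∃ C : ℝ, 0 ≤ C ∧ ∀ (G : E3 → ℂ) (A : ℝ), 0 ≤ A →
    ContDiff ℝ (⊤ : ℕ∞) G → tsupport G ⊆ Metric.closedBall 0 2 →
    (∀ k ≤ N, ∀ x, ‖iteratedFDeriv ℝ k G x‖ ≤ A) →
    ∀ n ≤ N, ∀ ξ : E3, ‖ξ‖ ^ n * ‖𝓕 G ξ‖ ≤ C * A := by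
  set V : ℝ := (volume : Measure E3).real (Metric.closedBall 0 2) with hV
  have hV0 : 0 ≤ V := measureReal_nonneg
  refine ⟨2 ^ N * ((N + 1) * V), by positivity, fun G A hA hG hsupp hb n hn ξ => ?_⟩
  have hcs : HasCompactSupport G :=
    HasCompactSupport.of_support_subset_isCompact (isCompact_closedBall (0 : E3) 2)
      ((subset_tsupport G).trans hsupp)
  have hint : ∀ k : ℕ, Integrable (fun v => ‖iteratedFDeriv ℝ k G v‖) := fun k =>
    ((hG.continuous_iteratedFDeriv (by exact_mod_cast le_top)).integrable_of_hasCompactSupport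
      (hcs.iteratedFDeriv k)).norm
  have h1 := Real.pow_mul_norm_iteratedFDeriv_fourier_le (K := 0) (N := ⊤) (f := G) hG
    (fun k m hk _ => by
      have : k = 0 := by simpa using hk
      subst this
      simpa using hint m) (k := 0) (n := n) (by simp) (by exact_mod_cast le_top) ξ
  simp only [norm_iteratedFDeriv_zero] at h1
  refine h1.trans ?_
  have h2 : ∀ k ≤ N, ∫ v, ‖iteratedFDeriv ℝ k G v‖ ≤ A * V := by
    intro k hk
    rw [← setIntegral_eq_integral_of_forall_compl_eq_zero (s := Metric.closedBall (0 : E3) 2)]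
    · refine (Real.le_norm_self _).trans ?_
      refine norm_setIntegral_le_of_norm_le_const (measure_closedBall_lt_top) fun x _ => ?_
      rw [norm_norm]; exact hb k hk x
    · intro x hx
      rw [norm_eq_zero]
      by_contra h
      exact hx (hsupp (support_iteratedFDeriv_subset k h))
  have h3 : ∑ p ∈ Finset.range (0 + 1) ×ˢ Finset.range (n + 1),
      ∫ v, ‖v‖ ^ p.1 * ‖iteratedFDeriv ℝ p.2 G v‖ ≤ ((n : ℝ) + 1) * (A * V) := by
    rw [Finset.sum_product]
    simp only [zero_add, Finset.range_one, Finset.sum_singleton, pow_zero, one_mul]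
    refine (Finset.sum_le_card_nsmul _ _ (A * V) fun k hk => h2 k ?_).trans ?_
    · have := Finset.mem_range.1 hk; omega
    · simp
  have hs0 : 0 ≤ ∑ p ∈ Finset.range (0 + 1) ×ˢ Finset.range (n + 1),
      ∫ v, ‖v‖ ^ p.1 * ‖iteratedFDeriv ℝ p.2 G v‖ :=
    Finset.sum_nonneg fun p _ => integral_nonneg fun v => by positivity
  have hnN : (n : ℝ) ≤ N := by exact_mod_cast hn
  have h4 : (2 : ℝ) ^ n ≤ 2 ^ N := pow_le_pow_right₀ (by norm_num) hn
  simp only [pow_zero, one_mul, Nat.cast_zero, mul_zero, zero_add]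
  calc (2 : ℝ) ^ n * _ ≤ 2 ^ N * (((n : ℝ) + 1) * (A * V)) := by gcongr
    _ ≤ 2 ^ N * (((N : ℝ) + 1) * (A * V)) := by gcongr
    _ = _ := by ring

lemma exists_HsNormSq_le (s : ℝ) {N : ℕ} (hN : s + 2 ≤ N) : ∃ C : ℝ, 0 ≤ C ∧
    ∀ (G : E3 → ℂ) (A : ℝ), 0 ≤ A →
    ContDiff ℝ (⊤ : ℕ∞) G → tsupport G ⊆ Metric.closedBall 0 2 →
    (∀ k ≤ N, ∀ x, ‖iteratedFDeriv ℝ k G x‖ ≤ A) →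
    HsNormSq s G ≤ ENNReal.ofReal (C * A ^ 2) := by
  obtain ⟨C, hC, h⟩ := exists_fourier_decay N
  have hint : Integrable (fun ξ : E3 => (1 + ‖ξ‖ ^ 2) ^ (-(4 : ℝ) / 2)) :=
    integrable_rpow_neg_one_add_norm_sq (by simp; norm_num)
  set J := ∫ ξ : E3, (1 + ‖ξ‖ ^ 2) ^ (-(4 : ℝ) / 2) with hJ
  have hJ0 : 0 ≤ J := integral_nonneg fun _ => by positivity
  refine ⟨2 ^ N * (2 * C ^ 2) * J, by positivity, fun G A hA hG hsupp hb => ?_⟩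
  have hpt : ∀ ξ : E3, ENNReal.ofReal ((1 + ‖ξ‖ ^ 2) ^ s) * (‖𝓕 G ξ‖₊ : ℝ≥0∞) ^ 2
      ≤ ENNReal.ofReal (2 ^ N * (2 * C ^ 2) * A ^ 2 * (1 + ‖ξ‖ ^ 2) ^ (-(4 : ℝ) / 2)) := by
    intro ξ
    have e : (‖𝓕 G ξ‖₊ : ℝ≥0∞) ^ 2 = ENNReal.ofReal (‖𝓕 G ξ‖ ^ 2) := by
      rw [ENNReal.ofReal_pow (norm_nonneg _), ofReal_norm]; rfl
    rw [e, ← ENNReal.ofReal_mul (by positivity)]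
    refine ENNReal.ofReal_le_ofReal ?_
    have h0 := h G A hA hG hsupp hb 0 (Nat.zero_le _) ξ
    have h1 := h G A hA hG hsupp hb N le_rfl ξ
    rw [pow_zero, one_mul] at h0
    set r := ‖ξ‖ ^ 2 with hr
    have hr0 : 0 ≤ r := by positivity
    have h2 : ‖𝓕 G ξ‖ ^ 2 ≤ (C * A) ^ 2 := pow_le_pow_left₀ (norm_nonneg _) h0 2
    have h3 : r ^ N * ‖𝓕 G ξ‖ ^ 2 ≤ (C * A) ^ 2 := by
      have := pow_le_pow_left₀ (by positivity) h1 2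
      calc r ^ N * ‖𝓕 G ξ‖ ^ 2 = (‖ξ‖ ^ N * ‖𝓕 G ξ‖) ^ 2 := by rw [hr]; ring
        _ ≤ _ := this
    have h4 : (1 + r) ^ N ≤ 2 ^ N * (1 + r ^ N) := by
      have := add_pow_le (zero_le_one) hr0 N
      calc (1 + r) ^ N ≤ 2 ^ (N - 1) * (1 ^ N + r ^ N) := this
        _ ≤ 2 ^ N * (1 + r ^ N) := by
          rw [one_pow]
          gcongr
          · norm_num
          · omega
    have h5 : (1 + r) ^ s ≤ (1 + r) ^ N * (1 + r) ^ (-(4 : ℝ) / 2) := by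
      rw [← Real.rpow_natCast, ← Real.rpow_add (by positivity)]
      exact Real.rpow_le_rpow_of_exponent_le (by linarith) (by linarith)
    have hq : 0 ≤ (1 + r) ^ (-(4 : ℝ) / 2) := by positivity
    calc (1 + r) ^ s * ‖𝓕 G ξ‖ ^ 2
        ≤ ((2 ^ N * (1 + r ^ N)) * (1 + r) ^ (-(4 : ℝ) / 2)) * ‖𝓕 G ξ‖ ^ 2 := by
          gcongr
          exact h5.trans (mul_le_mul_of_nonneg_right h4 hq)
      _ = 2 ^ N * (1 + r) ^ (-(4 : ℝ) / 2) * (‖𝓕 G ξ‖ ^ 2 + r ^ N * ‖𝓕 G ξ‖ ^ 2) := by ring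
      _ ≤ 2 ^ N * (1 + r) ^ (-(4 : ℝ) / 2) * ((C * A) ^ 2 + (C * A) ^ 2) := by gcongr
      _ = _ := by ring
  refine (lintegral_mono hpt).trans ?_
  rw [← ofReal_integral_eq_lintegral_ofReal (hint.const_mul _)
    (Filter.Eventually.of_forall fun _ => by positivity), integral_const_mul, ← hJ]
  refine ENNReal.ofReal_le_ofReal (le_of_eq (by ring))

/-- `f` is smooth and `|D^k f| ≤ B (1 + |x|)^(-p-k)` for `k ≤ N`. -/
def SymB (N : ℕ) (p B : ℝ) (f : E3 → ℝ) : Prop := ContDiff ℝ (⊤ : ℕ∞) f ∧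
  ∀ k ≤ N, ∀ x : E3, ‖iteratedFDeriv ℝ k f x‖ ≤ B * (1 + ‖x‖) ^ (-p - k)

lemma tsupport_psi_subset (P : DyadicPartition) (j : ℕ) :
    tsupport (P.ψ j) ⊆ {x : E3 | (2 : ℝ) ^ j ≤ 4 * (1 + ‖x‖) ∧ ‖x‖ ≤ 2 * 2 ^ j} := by
  refine closure_minimal (fun x hx => ?_) ?_
  · rcases j with _ | j
    · have := P.supp_zero x hx
      refine ⟨?_, ?_⟩
      · simp; linarith [norm_nonneg x]
      · simpa using this
    · obtain ⟨h1, h2⟩ := P.supp_succ (j + 1) (by omega) x hx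
      refine ⟨?_, ?_⟩
      · rw [zpow_sub₀ (by norm_num), zpow_natCast, div_le_iff₀ (by positivity)] at h1
        norm_num at h1 ⊢
        linarith
      · rw [zpow_add₀ (by norm_num), zpow_natCast] at h2
        norm_num at h2 ⊢
        linarith
  · have h1 : IsClosed {x : E3 | (2 : ℝ) ^ j ≤ 4 * (1 + ‖x‖)} :=
      isClosed_le (by fun_prop) (by fun_prop)
    have h2 : IsClosed {x : E3 | ‖x‖ ≤ 2 * 2 ^ j} := isClosed_le (by fun_prop) (by fun_prop)
    exact h1.inter h2

lemma SymB.nonneg {N : ℕ} {p B : ℝ} {f : E3 → ℝ} (hf : SymB N p B f) : 0 ≤ B := by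
  have := (norm_nonneg _).trans (hf.2 0 (Nat.zero_le _) 0)
  simpa using this

lemma exists_HwNormSq_le (P : DyadicPartition) (s δ p : ℝ) (hp : 0 ≤ p) (hδ : δ + 3 / 2 < p) :
    ∃ N : ℕ, ∃ C : ℝ, 0 ≤ C ∧ ∀ (f : E3 → ℝ) (B : ℝ), SymB N p B f →
      HwNormSq P s δ f ≤ ENNReal.ofReal (C * B ^ 2) := by
  obtain ⟨N, hN⟩ := exists_nat_ge (s + 2)
  obtain ⟨C, hC, h⟩ := exists_HsNormSq_le s hN
  choose D hD using P.deriv_bound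
  have hD0 : ∀ n, 0 ≤ D n := fun n => by simpa using (norm_nonneg _).trans (hD n 0 0)
  set D' := ∑ n ∈ Finset.range (N + 1), D n with hD'
  have hD'0 : 0 ≤ D' := Finset.sum_nonneg fun n _ => hD0 n
  have hDD : ∀ n ≤ N, D n ≤ D' := fun n hn =>
    Finset.single_le_sum (fun n _ => hD0 n) (Finset.mem_range.2 (by omega))
  set E : ℝ := 2 ^ N * D' * 4 ^ (p + N) with hE
  have hE0 : 0 ≤ E := by positivity
  -- the geometric ratio
  set q : ℝ := 2 ^ (3 + 2 * δ - 2 * p) with hq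
  have hq1 : q < 1 := Real.rpow_lt_one_of_one_lt_of_neg (by norm_num) (by linarith)
  have hq0 : 0 ≤ q := by positivity
  have hqs : Summable fun j : ℕ => q ^ j := summable_geometric_of_lt_one hq0 hq1
  refine ⟨N, C * E ^ 2 * ∑' j : ℕ, q ^ j, mul_nonneg (by positivity)
    (tsum_nonneg fun j => by positivity), fun f B hf => ?_⟩
  have hB := hf.nonneg
  have hterm : ∀ j : ℕ, ENNReal.ofReal ((2 : ℝ) ^ ((3 + 2 * δ) * (j : ℝ))) *
      HsNormSq s (fun x : E3 =>
        ((P.ψ j (((2 : ℝ) ^ (j : ℕ)) • x) * f (((2 : ℝ) ^ (j : ℕ)) • x) : ℝ) : ℂ))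
      ≤ ENNReal.ofReal (C * E ^ 2 * B ^ 2 * q ^ j) := by
    intro j
    set lam : ℝ := 2 ^ j with hlam
    have hl1 : 1 ≤ lam := one_le_pow₀ (by norm_num)
    have hl0 : 0 < lam := by positivity
    set g : E3 → ℝ := fun x => P.ψ j x * f x with hg
    have hgs : ContDiff ℝ (⊤ : ℕ∞) g := (P.smooth j).mul hf.1
    set g' : E3 → ℝ := fun x => g (lam • x) with hg'
    have hg's : ContDiff ℝ (⊤ : ℕ∞) g' := hgs.comp (contDiff_const_smul lam)
    have htg : tsupport g ⊆ tsupport (P.ψ j) := tsupport_mul_subset_left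
    -- derivative bound
    have hbd : ∀ k ≤ N, ∀ x, ‖iteratedFDeriv ℝ k g' x‖ ≤ E * B * lam ^ (-p) := by
      intro k hk x
      rw [hg', iteratedFDeriv_comp_const_smul lam (hgs.of_le (by exact_mod_cast le_top)),
        norm_smul, Real.norm_eq_abs, abs_of_pos (by positivity)]
      set y := lam • x with hy
      by_cases hys : y ∈ tsupport (P.ψ j)
      swap
      · have : iteratedFDeriv ℝ k g y = 0 := by
          by_contra hne
          exact hys (htg (support_iteratedFDeriv_subset k hne))
        rw [this, norm_zero, mul_zero]; positivity
      obtain ⟨hy1, -⟩ := tsupport_psi_subset P j hys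
      have hm := norm_iteratedFDeriv_mul_le (N := ((⊤ : ℕ∞) : WithTop ℕ∞)) (P.smooth j) hf.1 y (n := k)
        (by exact_mod_cast le_top)
      have hterm : ∀ i ∈ Finset.range (k + 1), (k.choose i : ℝ) * ‖iteratedFDeriv ℝ i (P.ψ j) y‖ *
          ‖iteratedFDeriv ℝ (k - i) f y‖
          ≤ (k.choose i : ℝ) * (D' * B * 4 ^ (p + N) * (lam ^ k)⁻¹ * lam ^ (-p)) := by
        intro i hi
        have hik : i ≤ k := by have := Finset.mem_range.1 hi; omega
        have h1 : ‖iteratedFDeriv ℝ i (P.ψ j) y‖ ≤ D' * (lam ^ i)⁻¹ := by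
          refine (hD i j y).trans ?_
          have : (2 : ℝ) ^ (-(i : ℤ) * (j : ℤ)) = (lam ^ i)⁻¹ := by
            rw [hlam, ← pow_mul, neg_mul, zpow_neg, ← Nat.cast_mul, zpow_natCast, mul_comm i j]
          rw [this]
          exact mul_le_mul_of_nonneg_right (hDD i (by omega)) (by positivity)
        have h2 : ‖iteratedFDeriv ℝ (k - i) f y‖ ≤ B * (4 ^ (p + N) * lam ^ (-p) * (lam ^ (k - i))⁻¹) := by
          refine (hf.2 (k - i) (by omega) y).trans (mul_le_mul_of_nonneg_left ?_ hB)
          have hk0 : (0 : ℝ) ≤ (k - i : ℕ) := Nat.cast_nonneg _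
          have hkN : ((k - i : ℕ) : ℝ) ≤ N := by exact_mod_cast (by omega : k - i ≤ N)
          have h3 : (1 + ‖y‖) ^ (-p - ((k - i : ℕ) : ℝ)) ≤ (lam / 4) ^ (-p - ((k - i : ℕ) : ℝ)) :=
            Real.rpow_le_rpow_of_nonpos (by positivity) (by linarith) (by linarith)
          refine h3.trans ?_
          rw [Real.div_rpow hl0.le (by norm_num), div_eq_mul_inv, ← Real.rpow_neg (by norm_num),
            Real.rpow_sub hl0, Real.rpow_natCast, div_eq_mul_inv]
          have h4 : (4 : ℝ) ^ (-(-p - ((k - i : ℕ) : ℝ))) ≤ 4 ^ (p + N) :=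
            Real.rpow_le_rpow_of_exponent_le (by norm_num) (by linarith)
          have h5 : 0 ≤ lam ^ (-p) * (lam ^ (k - i))⁻¹ := by positivity
          nlinarith
        have e : (lam ^ k)⁻¹ = (lam ^ i)⁻¹ * (lam ^ (k - i))⁻¹ := by
          rw [← mul_inv, ← pow_add]; congr 2; omega
        rw [mul_assoc]
        refine mul_le_mul_of_nonneg_left ?_ (by positivity)
        refine (mul_le_mul h1 h2 (norm_nonneg _) (by positivity)).trans (le_of_eq ?_)
        rw [e]; ring
      have hs := hm.trans (Finset.sum_le_sum hterm)
      rw [← Finset.sum_mul] at hs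
      have hch : ∑ i ∈ Finset.range (k + 1), (k.choose i : ℝ) = 2 ^ k := by
        exact_mod_cast Nat.sum_range_choose k
      rw [hch] at hs
      calc lam ^ k * ‖iteratedFDeriv ℝ k g y‖
          ≤ lam ^ k * (2 ^ k * (D' * B * 4 ^ (p + N) * (lam ^ k)⁻¹ * lam ^ (-p))) := by
            gcongr
        _ = 2 ^ k * D' * 4 ^ (p + N) * B * lam ^ (-p) := by field_simp
        _ ≤ 2 ^ N * D' * 4 ^ (p + N) * B * lam ^ (-p) := by
            gcongr
            norm_num
    set G : E3 → ℂ := fun x => ((g' x : ℝ) : ℂ) with hG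
    have hGeq : G = Complex.ofRealLI ∘ g' := rfl
    have hGs : ContDiff ℝ (⊤ : ℕ∞) G := Complex.ofRealCLM.contDiff.comp hg's
    have hGb : ∀ k ≤ N, ∀ x, ‖iteratedFDeriv ℝ k G x‖ ≤ E * B * lam ^ (-p) := by
      intro k hk x
      rw [hGeq, LinearIsometry.norm_iteratedFDeriv_comp_left _ hg's.contDiffAt
        (by exact_mod_cast le_top)]
      exact hbd k hk x
    have hGt : tsupport G ⊆ Metric.closedBall 0 2 := by
      refine closure_minimal (fun x hx => ?_) Metric.isClosed_closedBall
      have hne : g (lam • x) ≠ 0 := by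
        intro h0; apply hx; simp [hG, hg', h0]
      have := (tsupport_psi_subset P j (htg (subset_tsupport g hne))).2
      rw [norm_smul, Real.norm_eq_abs, abs_of_pos hl0] at this
      rw [mem_closedBall_zero_iff]
      nlinarith
    have hH := h G (E * B * lam ^ (-p)) (by positivity) hGs hGt hGb
    calc _ ≤ ENNReal.ofReal ((2 : ℝ) ^ ((3 + 2 * δ) * (j : ℝ))) *
          ENNReal.ofReal (C * (E * B * lam ^ (-p)) ^ 2) := by gcongr
      _ = ENNReal.ofReal (C * E ^ 2 * B ^ 2 * q ^ j) := by
        rw [← ENNReal.ofReal_mul (by positivity)]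
        congr 1
        have e1 : (lam ^ (-p)) ^ 2 = (2 : ℝ) ^ (-(2 * p) * (j : ℝ)) := by
          rw [hlam, ← Real.rpow_natCast, ← Real.rpow_mul (by norm_num), ← Real.rpow_natCast,
            ← Real.rpow_mul (by norm_num)]
          congr 1; push_cast; ring
        have e2 : q ^ j = (2 : ℝ) ^ ((3 + 2 * δ) * (j : ℝ)) * (2 : ℝ) ^ (-(2 * p) * (j : ℝ)) := by
          rw [hq, ← Real.rpow_natCast, ← Real.rpow_mul (by norm_num), ← Real.rpow_add (by norm_num)]
          congr 1; ring
        rw [e2, ← e1]; ring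
  refine (ENNReal.tsum_le_tsum hterm).trans ?_
  rw [← ENNReal.ofReal_tsum_of_nonneg (fun j => by positivity) (hqs.mul_left _), tsum_mul_left]
  exact ENNReal.ofReal_le_ofReal (le_of_eq (by ring))

lemma SymB.add {N : ℕ} {p A B : ℝ} {f g : E3 → ℝ} (hf : SymB N p A f) (hg : SymB N p B g) :
    SymB N p (A + B) (fun x => f x + g x) := by
  refine ⟨hf.1.add hg.1, fun k hk x => ?_⟩
  have h : iteratedFDeriv ℝ k (fun x => f x + g x) x = iteratedFDeriv ℝ k f x + iteratedFDeriv ℝ k g x :=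
    iteratedFDeriv_add_apply (hf.1.contDiffAt.of_le (by exact_mod_cast le_top))
      (hg.1.contDiffAt.of_le (by exact_mod_cast le_top))
  rw [h, add_mul]
  exact (norm_add_le _ _).trans (add_le_add (hf.2 k hk x) (hg.2 k hk x))

lemma SymB.const_mul {N : ℕ} {p A : ℝ} {f : E3 → ℝ} (hf : SymB N p A f) (c : ℝ) :
    SymB N p (|c| * A) (fun x => c * f x) := by
  refine ⟨contDiff_const.mul hf.1, fun k hk x => ?_⟩
  have h : iteratedFDeriv ℝ k (fun x => c * f x) x = c • iteratedFDeriv ℝ k f x :=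
    iteratedFDeriv_const_smul_apply (a := c) (hf.1.contDiffAt.of_le (by exact_mod_cast le_top))
  rw [h, norm_smul, Real.norm_eq_abs, mul_assoc]
  exact mul_le_mul_of_nonneg_left (hf.2 k hk x) (abs_nonneg c)

lemma SymB.mono {N : ℕ} {p q A B : ℝ} {f : E3 → ℝ} (hf : SymB N p A f) (hq : q ≤ p)
    (hAB : A ≤ B) : SymB N q B f := by
  refine ⟨hf.1, fun k hk x => (hf.2 k hk x).trans ?_⟩
  have := hf.nonneg
  gcongr
  · exact this.trans hAB
  · linarith [norm_nonneg x]

lemma SymB.mul {N : ℕ} {p q A B : ℝ} {f g : E3 → ℝ} (hf : SymB N p A f) (hg : SymB N q B g) :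
    SymB N (p + q) (2 ^ N * A * B) (fun x => f x * g x) := by
  have hA := hf.nonneg
  have hB := hg.nonneg
  refine ⟨hf.1.mul hg.1, fun k hk x => ?_⟩
  have h0 : 0 < 1 + ‖x‖ := by linarith [norm_nonneg x]
  refine (norm_iteratedFDeriv_mul_le (N := ((⊤ : ℕ∞) : WithTop ℕ∞)) hf.1 hg.1 x
    (by exact_mod_cast le_top)).trans ?_
  have h1 : ∀ i ∈ Finset.range (k + 1), (k.choose i : ℝ) * ‖iteratedFDeriv ℝ i f x‖ *
      ‖iteratedFDeriv ℝ (k - i) g x‖ ≤ (k.choose i : ℝ) * (A * B * (1 + ‖x‖) ^ (-(p + q) - k)) := by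
    intro i hi
    have hik : i ≤ k := by have := Finset.mem_range.1 hi; omega
    rw [mul_assoc]
    refine mul_le_mul_of_nonneg_left ?_ (by positivity)
    refine (mul_le_mul (hf.2 i (by omega) x) (hg.2 (k - i) (by omega) x) (norm_nonneg _)
      (by positivity)).trans (le_of_eq ?_)
    have e : (1 + ‖x‖) ^ (-(p + q) - (k : ℝ)) = (1 + ‖x‖) ^ (-p - (i : ℝ)) *
        (1 + ‖x‖) ^ (-q - ((k - i : ℕ) : ℝ)) := by
      rw [← Real.rpow_add h0]
      congr 1
      rw [Nat.cast_sub hik]; ring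
    rw [e]; ring
  refine (Finset.sum_le_sum h1).trans ?_
  rw [← Finset.sum_mul]
  have hch : ∑ i ∈ Finset.range (k + 1), (k.choose i : ℝ) = 2 ^ k := by
    exact_mod_cast Nat.sum_range_choose k
  rw [hch, ← mul_assoc, ← mul_assoc]
  gcongr
  norm_num

lemma symB_const (N : ℕ) (c : ℝ) : SymB N 0 |c| (fun _ => c) := by
  refine ⟨contDiff_const, fun k _ x => ?_⟩
  rcases k with _ | k
  · simp
  · rw [iteratedFDeriv_succ_const]
    simp only [Pi.zero_apply, norm_zero]
    positivity

lemma symB_coord (N : ℕ) (i : Fin 3) : SymB N (-1) 1 (fun x => x i) := by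
  have hL : (fun x : E3 => x i) = (EuclideanSpace.proj i : E3 →L[ℝ] ℝ) := rfl
  have hfd : fderiv ℝ (fun x : E3 => x i) = fun _ => (EuclideanSpace.proj i : E3 →L[ℝ] ℝ) := by
    ext x : 1; rw [hL, ContinuousLinearMap.fderiv]
  refine ⟨by rw [hL]; exact ContinuousLinearMap.contDiff _, fun k _ x => ?_⟩
  have h0 : 0 < 1 + ‖x‖ := by linarith [norm_nonneg x]
  rcases k with _ | k
  · rw [norm_iteratedFDeriv_zero]
    have := PiLp.norm_apply_le x i
    simp
    linarith [Real.norm_eq_abs (x i)]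
  · rw [← norm_iteratedFDeriv_fderiv, hfd]
    rcases k with _ | k
    · rw [norm_iteratedFDeriv_zero]
      simp
      refine ContinuousLinearMap.opNorm_le_bound _ zero_le_one fun y => ?_
      simpa using PiLp.norm_apply_le y i
    · rw [iteratedFDeriv_succ_const]
      simp only [Pi.zero_apply, norm_zero]
      positivity

/-- Composition of a symbol of order zero with a function of one variable whose successive
derivatives are the `h k`. -/
lemma exists_symB_comp {U : E3 → ℝ} (N : ℕ) {B₀ : ℝ} (hU : SymB N 0 B₀ U)
    (hU1 : ∀ x, U x ∈ Icc (-1 : ℝ) 1) : ∃ C : ℝ, 0 ≤ C ∧ ∀ (h : ℕ → ℝ → ℝ) (B : ℝ),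
      (∀ k, ∀ u ∈ Ioo (-(9 / 8) : ℝ) (9 / 8), HasDerivAt (h k) (h (k + 1) u) u) →
      (∀ k ≤ N, ∀ u ∈ Icc (-1 : ℝ) 1, |h k u| ≤ B) → SymB N 0 (C * B) (fun x => h 0 (U x)) := by
  have hB₀ := hU.nonneg
  set D : ℝ := max B₀ 1 with hD
  have hD1 : 1 ≤ D := le_max_right _ _
  refine ⟨N.factorial * D ^ N, by positivity, fun h B hd hb => ?_⟩
  set s : Set ℝ := Ioo (-(9 / 8) : ℝ) (9 / 8) with hs
  have hso : IsOpen s := isOpen_Ioo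
  have hsu : UniqueDiffOn ℝ s := hso.uniqueDiffOn
  have hsub : Icc (-1 : ℝ) 1 ⊆ s := fun u hu => ⟨by linarith [hu.1], by linarith [hu.2]⟩
  have hit : ∀ m, ∀ u ∈ s, iteratedDerivWithin m (h 0) s u = h m u := by
    intro m
    induction m with
    | zero => intro u _; simp
    | succ m ih =>
      intro u hu
      rw [iteratedDerivWithin_succ, derivWithin_congr ih (ih u hu)]
      exact ((hd m u hu).hasDerivWithinAt).derivWithin (hsu u hu)
  have hh : ContDiffOn ℝ (⊤ : ℕ∞) (h 0) s := by
    refine contDiffOn_of_differentiableOn_deriv fun m _ => ?_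
    refine DifferentiableOn.congr (f := h m) (fun u hu => ?_) (hit m)
    exact (hd m u hu).differentiableAt.differentiableWithinAt
  have hmaps : MapsTo U univ s := fun x _ => hsub (hU1 x)
  have hB : 0 ≤ B := (abs_nonneg _).trans (hb 0 (Nat.zero_le _) 0 (by norm_num))
  refine ⟨?_, fun k hk x => ?_⟩
  · rw [← contDiffOn_univ]
    exact hh.comp hU.1.contDiffOn hmaps
  · have h0 : 0 < 1 + ‖x‖ := by linarith [norm_nonneg x]
    have key := norm_iteratedFDerivWithin_comp_le hh hU.1.contDiffOn (n := k)
      (by exact_mod_cast le_top) hsu uniqueDiffOn_univ hmaps (mem_univ x) (C := B)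
      (D := D / (1 + ‖x‖)) (fun i hi => ?_) (fun i hi1 hi => ?_)
    · rw [iteratedFDerivWithin_univ] at key
      refine key.trans ?_
      rw [neg_zero, zero_sub, Real.rpow_neg h0.le, Real.rpow_natCast, div_pow]
      have hf : (k.factorial : ℝ) ≤ N.factorial := by exact_mod_cast Nat.factorial_le hk
      have hDk : D ^ k ≤ D ^ N := pow_le_pow_right₀ hD1 hk
      calc (k.factorial : ℝ) * B * (D ^ k / (1 + ‖x‖) ^ k)
          ≤ N.factorial * B * (D ^ N / (1 + ‖x‖) ^ k) := by gcongr
        _ = _ := by rw [div_eq_mul_inv]; ring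
    · rw [norm_iteratedFDerivWithin_eq_norm_iteratedDerivWithin, hit i _ (hsub (hU1 x))]
      exact hb i (by omega) _ (hU1 x)
    · rw [iteratedFDerivWithin_univ]
      refine (hU.2 i (by omega) x).trans ?_
      rw [neg_zero, zero_sub, Real.rpow_neg h0.le, Real.rpow_natCast, div_pow, div_eq_mul_inv]
      refine mul_le_mul_of_nonneg_right ?_ (by positivity)
      exact (le_max_left B₀ 1).trans (le_self_pow₀ hD1 (by omega))

lemma exists_symB_sq_add (N : ℕ) (a : ℝ) : ∃ B, SymB N (-2) B (fun x => a ^ 2 + ‖x‖ ^ 2) := by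
  have hi : ∀ i : Fin 3, SymB N (-2) (2 ^ N * 1 * 1) (fun x => x i * x i) := fun i =>
    ((symB_coord N i).mul (symB_coord N i)).mono (by norm_num) le_rfl
  have h := ((symB_const N (a ^ 2)).mono (by norm_num : (-2 : ℝ) ≤ 0) le_rfl).add
    ((hi 0).add ((hi 1).add (hi 2)))
  refine ⟨|a ^ 2| + (2 ^ N * 1 * 1 + (2 ^ N * 1 * 1 + 2 ^ N * 1 * 1)), ?_⟩
  convert h using 2 with x
  rw [EuclideanSpace.norm_sq_eq, Fin.sum_univ_three]
  simp only [Real.norm_eq_abs, sq_abs]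
  ring

lemma one_add_norm_sq_le {a : ℝ} (ha : 0 < a) : ∃ c : ℝ, 0 < c ∧ ∀ x : E3,
    (1 + ‖x‖) ^ 2 ≤ c * (a ^ 2 + ‖x‖ ^ 2) := by
  refine ⟨2 / a ^ 2 + 2, by positivity, fun x => ?_⟩
  have h1 : 2 / a ^ 2 * a ^ 2 = 2 := by field_simp
  have h2 : 0 ≤ 2 / a ^ 2 * ‖x‖ ^ 2 := by positivity
  nlinarith [sq_nonneg (1 - ‖x‖), sq_nonneg a]

lemma exists_symB_rpow (N : ℕ) {a : ℝ} (ha : 0 < a) (e : ℝ) :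
    ∃ B, SymB N (-(2 * e)) B (fun x => (a ^ 2 + ‖x‖ ^ 2) ^ e) := by
  obtain ⟨B₀, hB₀⟩ := exists_symB_sq_add N a
  obtain ⟨c, hc, hcx⟩ := one_add_norm_sq_le ha
  have hB := hB₀.nonneg
  set q : E3 → ℝ := fun x => a ^ 2 + ‖x‖ ^ 2 with hq
  have hq0 : ∀ x, 0 < q x := fun x => by simp only [hq]; positivity
  set g : ℝ → ℝ := fun r => r ^ e with hg
  have hgs : ContDiffOn ℝ (⊤ : ℕ∞) g (Ioi 0) := fun r hr =>
    (contDiffAt_id.rpow_const_of_ne (ne_of_gt hr)).contDiffWithinAt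
  set C := ∑ i ∈ Finset.range (N + 1), ‖iteratedFDerivWithin ℝ i g (Ioi 0) 1‖ with hC
  have hC0 : 0 ≤ C := Finset.sum_nonneg fun _ _ => norm_nonneg _
  set D : ℝ := max (B₀ * c) 1 with hD
  have hD1 : 1 ≤ D := le_max_right _ _
  -- comparison of `q ^ e` with the weight
  obtain ⟨M, hM⟩ : ∃ M : ℝ, 0 ≤ M ∧ ∀ x, (q x) ^ e ≤ M * (1 + ‖x‖) ^ (2 * e) := by
    have hup : ∀ x, q x ≤ (a ^ 2 + 1) * (1 + ‖x‖) ^ 2 := fun x => by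
      simp only [hq]
      nlinarith [norm_nonneg x, sq_nonneg a, mul_nonneg (sq_nonneg a) (norm_nonneg x),
        mul_nonneg (sq_nonneg a) (sq_nonneg ‖x‖)]
    have hlo : ∀ x, c⁻¹ * (1 + ‖x‖) ^ 2 ≤ q x := fun x => by
      rw [inv_mul_eq_div, div_le_iff₀ hc, mul_comm]; exact hcx x
    have hpow : ∀ x : E3, ((1 + ‖x‖) ^ 2) ^ e = (1 + ‖x‖) ^ (2 * e) := fun x => by
      rw [← Real.rpow_natCast, ← Real.rpow_mul (by positivity)]; norm_num
    rcases le_total 0 e with he | he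
    · refine ⟨(a ^ 2 + 1) ^ e, by positivity, fun x => ?_⟩
      rw [← hpow, ← Real.mul_rpow (by positivity) (by positivity)]
      exact Real.rpow_le_rpow (hq0 x).le (hup x) he
    · refine ⟨(c⁻¹) ^ e, by positivity, fun x => ?_⟩
      rw [← hpow, ← Real.mul_rpow (by positivity) (by positivity)]
      exact Real.rpow_le_rpow_of_nonpos (by positivity) (hlo x) he
  refine ⟨M * (N.factorial * C * D ^ N), ?_, fun k hk x => ?_⟩
  · rw [contDiff_iff_contDiffAt]
    exact fun x => hB₀.1.contDiffAt.rpow_const_of_ne (hq0 x).ne'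
  have h0 : 0 < 1 + ‖x‖ := by linarith [norm_nonneg x]
  have hlam := hq0 x
  set lam := q x with hlamdef
  set f : E3 → ℝ := fun y => lam⁻¹ * q y with hf
  have hfs : ContDiff ℝ (⊤ : ℕ∞) f := contDiff_const.mul hB₀.1
  have hmaps : MapsTo f univ (Ioi 0) := fun y _ => mul_pos (inv_pos.2 hlam) (hq0 y)
  have hfx : f x = 1 := inv_mul_cancel₀ hlam.ne'
  have hfun : (fun y => q y ^ e) = fun y => lam ^ e * (g ∘ f) y := by
    ext y
    simp only [hg, hf, Function.comp]
    rw [← Real.mul_rpow hlam.le (by have := hq0 y; positivity), mul_inv_cancel_left₀ hlam.ne']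
  have key := norm_iteratedFDerivWithin_comp_le hgs hfs.contDiffOn (n := k)
      (by exact_mod_cast le_top) isOpen_Ioi.uniqueDiffOn uniqueDiffOn_univ hmaps (mem_univ x)
      (C := C) (D := D / (1 + ‖x‖)) (fun i hi => ?_) (fun i hi1 hi => ?_)
  · rw [iteratedFDerivWithin_univ] at key
    have hgf : ContDiff ℝ (⊤ : ℕ∞) (g ∘ f) := by
      rw [← contDiffOn_univ]; exact hgs.comp hfs.contDiffOn hmaps
    have e1 : iteratedFDeriv ℝ k (fun y => lam ^ e * (g ∘ f) y) x
        = lam ^ e • iteratedFDeriv ℝ k (g ∘ f) x :=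
      iteratedFDeriv_const_smul_apply (a := lam ^ e) (hgf.contDiffAt.of_le (by exact_mod_cast le_top))
    rw [hfun, e1, norm_smul, Real.norm_eq_abs, abs_of_pos (by positivity)]
    have hfk : (k.factorial : ℝ) ≤ N.factorial := by exact_mod_cast Nat.factorial_le hk
    have hDk : D ^ k ≤ D ^ N := pow_le_pow_right₀ hD1 hk
    have e2 : (1 + ‖x‖) ^ (-(-(2 * e)) - (k : ℝ)) = (1 + ‖x‖) ^ (2 * e) * ((1 + ‖x‖) ^ k)⁻¹ := by
      rw [neg_neg, Real.rpow_sub h0, Real.rpow_natCast, div_eq_mul_inv]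
    have hM0 := hM.1
    calc lam ^ e * ‖iteratedFDeriv ℝ k (g ∘ f) x‖
        ≤ (M * (1 + ‖x‖) ^ (2 * e)) * (k.factorial * C * (D / (1 + ‖x‖)) ^ k) := by
          have := hM.2 x
          gcongr
      _ = (M * (1 + ‖x‖) ^ (2 * e)) * (k.factorial * C * (D ^ k / (1 + ‖x‖) ^ k)) := by
          rw [div_pow]
      _ ≤ (M * (1 + ‖x‖) ^ (2 * e)) * (N.factorial * C * (D ^ N / (1 + ‖x‖) ^ k)) := by gcongr
      _ = _ := by rw [e2, div_eq_mul_inv]; ring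
  · rw [hfx]
    exact Finset.single_le_sum (f := fun i => ‖iteratedFDerivWithin ℝ i g (Ioi 0) 1‖)
      (fun _ _ => norm_nonneg _) (Finset.mem_range.2 (by omega))
  · rw [iteratedFDerivWithin_univ]
    have h1 := ((hB₀.const_mul lam⁻¹).2 i (by omega) x)
    refine h1.trans ?_
    rw [abs_of_pos (inv_pos.2 hlam)]
    have e2 : (1 + ‖x‖) ^ (-(-2 : ℝ) - (i : ℝ)) = (1 + ‖x‖) ^ 2 * ((1 + ‖x‖) ^ i)⁻¹ := by
      rw [neg_neg, Real.rpow_sub h0, Real.rpow_natCast, div_eq_mul_inv]; norm_num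
    rw [e2, div_pow, div_eq_mul_inv, ← mul_assoc]
    refine mul_le_mul_of_nonneg_right ?_ (by positivity)
    refine le_trans ?_ (le_self_pow₀ hD1 (by omega))
    refine le_trans ?_ (le_max_left (B₀ * c) 1)
    have h2 := hcx x
    calc lam⁻¹ * B₀ * (1 + ‖x‖) ^ 2 ≤ lam⁻¹ * B₀ * (c * lam) := by gcongr
      _ = B₀ * c := by field_simp

/-- `f` satisfies symbol estimates of weight `p` to every order. -/
def SymS (p : ℝ) (f : E3 → ℝ) : Prop := ∀ N, ∃ B, SymB N p B f

lemma SymS.mul {p q : ℝ} {f g : E3 → ℝ} (hf : SymS p f) (hg : SymS q g) :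
    SymS (p + q) (fun x => f x * g x) := fun N => by
  obtain ⟨A, hA⟩ := hf N
  obtain ⟨B, hB⟩ := hg N
  exact ⟨_, hA.mul hB⟩

lemma memH_of_symS (P : DyadicPartition) (s : ℝ) {δ p : ℝ} (hp : 0 ≤ p) (hδ : δ + 3 / 2 < p)
    {f : E3 → ℝ} (hf : SymS p f) : MemH P s δ f := by
  obtain ⟨N, C, hC, h⟩ := exists_HwNormSq_le P s δ p hp hδ
  obtain ⟨B, hB⟩ := hf N
  exact ⟨hB.1.continuous.locallyIntegrable, (h f B hB).trans_lt ENNReal.ofReal_lt_top⟩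

lemma exists_Hnorm_le (P : DyadicPartition) (s δ p : ℝ) (hp : 0 ≤ p) (hδ : δ + 3 / 2 < p) :
    ∃ N : ℕ, ∃ C : ℝ, 0 ≤ C ∧ ∀ (f : E3 → ℝ) (B : ℝ), SymB N p B f → Hnorm P s δ f ≤ C * B := by
  obtain ⟨N, C, hC, h⟩ := exists_HwNormSq_le P s δ p hp hδ
  refine ⟨N, √C, Real.sqrt_nonneg _, fun f B hf => ?_⟩
  have hB := hf.nonneg
  unfold Hnorm
  have : (HwNormSq P s δ f).toReal ≤ C * B ^ 2 :=
    ENNReal.toReal_le_of_le_ofReal (by positivity) (h f B hf)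
  refine (Real.sqrt_le_sqrt this).trans (le_of_eq ?_)
  rw [Real.sqrt_mul hC, Real.sqrt_sq hB]

lemma hContOn_of_lipschitz (P : DyadicPartition) (s : ℝ) {δ p T : ℝ} (hp : 0 ≤ p)
    (hδ : δ + 3 / 2 < p) {u : ℝ → E3 → ℝ} (h1 : ∀ t ∈ Icc (0 : ℝ) T, SymS p (u t))
    (h2 : ∀ N, ∃ B, ∀ t ∈ Icc (0 : ℝ) T, ∀ t' ∈ Icc (0 : ℝ) T,
      SymB N p (B * |t' - t|) (fun x => u t' x - u t x)) : HContOn P s δ T u := by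
  refine ⟨fun t ht => memH_of_symS P s hp hδ (h1 t ht), fun t ht ε hε => ?_⟩
  obtain ⟨N, C, hC, h⟩ := exists_Hnorm_le P s δ p hp hδ
  obtain ⟨B, hB⟩ := h2 N
  refine ⟨ε / (C * |B| + 1), by positivity, fun t' ht' htt => ?_⟩
  refine (h _ _ (hB t ht t' ht')).trans_lt ?_
  rw [lt_div_iff₀ (by positivity)] at htt
  have h3 : C * (B * |t' - t|) ≤ C * (|B| * |t' - t|) := by
    gcongr; exact le_abs_self B
  rcases eq_or_lt_of_le (abs_nonneg (t' - t)) with h0 | h0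
  · rw [← h0]; simpa using hε
  · nlinarith

lemma hC1On_of_taylor (P : DyadicPartition) (s : ℝ) {δ p T : ℝ} (hp : 0 ≤ p)
    (hδ : δ + 3 / 2 < p) {u u' : ℝ → E3 → ℝ} (h1 : HContOn P s δ T u')
    (h2 : ∀ N, ∃ B, ∀ t ∈ Icc (0 : ℝ) T, ∀ t' ∈ Icc (0 : ℝ) T, t' ≠ t →
      SymB N p (B * |t' - t|) (fun x => (u t' x - u t x) / (t' - t) - u' t x)) :
    HC1On P s δ T u := by
  refine ⟨u', h1, fun t ht ε hε => ?_⟩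
  obtain ⟨N, C, hC, h⟩ := exists_Hnorm_le P s δ p hp hδ
  obtain ⟨B, hB⟩ := h2 N
  refine ⟨ε / (C * |B| + 1), by positivity, fun t' ht' hne htt => ?_⟩
  refine (h _ _ (hB t ht t' ht' hne)).trans_lt ?_
  rw [lt_div_iff₀ (by positivity)] at htt
  have h3 : C * (B * |t' - t|) ≤ C * (|B| * |t' - t|) := by
    gcongr; exact le_abs_self B
  have h0 : 0 < |t' - t| := abs_pos.2 (sub_ne_zero.2 hne)
  nlinarith

/-! ### Curves of symbols built from convergent series -/

/-- The formal primitive with respect to `u` vanishing at `u = 0`. -/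
def intU (f : DSeries) : DSeries := ofCf fun n k => if k = 0 then 0 else cf f n (k - 1) / k

lemma dU_intU (f : DSeries) : dU (intU f) = f := by
  refine cf_ext fun n k => ?_
  simp only [dU, intU, cf_ofCf, if_neg (Nat.succ_ne_zero k), Nat.add_sub_cancel]
  push_cast
  field_simp

lemma Conv.intU {r : ℝ} {f : DSeries} (hf : Conv r f) : Conv r (intU f) := by
  intro τ σ h1 h2 h3 h4
  rw [← succU_injective.summable_iff]
  · refine Summable.of_nonneg_of_le (fun p => by simp only [Function.comp]; positivity) (fun p => ?_)
      ((hf τ σ h1 h2 h3 h4).mul_left σ)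
    simp only [Function.comp, succU, StaticMakino.intU, cf_ofCf, if_neg (Nat.succ_ne_zero p.2),
      Nat.add_sub_cancel]
    rw [abs_div, Nat.abs_cast]
    have h5 : |cf f p.1 p.2| / ((p.2 + 1 : ℕ) : ℝ) ≤ |cf f p.1 p.2| :=
      div_le_self (abs_nonneg _) (by push_cast; linarith [p.2.cast_nonneg (α := ℝ)])
    calc _ ≤ |cf f p.1 p.2| * (τ ^ p.1 * σ ^ (p.2 + 1)) := by gcongr
      _ = _ := by ring
  · rintro ⟨n, k⟩ hk
    rcases k with _ | k
    · simp [StaticMakino.intU]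
    · exact absurd ⟨(n, k), rfl⟩ hk

lemma Conv.intT {r : ℝ} {f : DSeries} (hf : Conv r f) : Conv r (intT f) := by
  intro τ σ h1 h2 h3 h4
  rw [← succT_injective.summable_iff]
  · refine Summable.of_nonneg_of_le (fun p => by simp only [Function.comp]; positivity) (fun p => ?_)
      ((hf τ σ h1 h2 h3 h4).mul_left τ)
    simp only [Function.comp, succT, StaticMakino.intT, cf_ofCf, if_neg (Nat.succ_ne_zero p.1),
      Nat.add_sub_cancel]
    rw [abs_div, Nat.abs_cast]
    have h5 : |cf f p.1 p.2| / ((p.1 + 1 : ℕ) : ℝ) ≤ |cf f p.1 p.2| :=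
      div_le_self (abs_nonneg _) (by push_cast; linarith [p.1.cast_nonneg (α := ℝ)])
    calc _ ≤ |cf f p.1 p.2| * (τ ^ (p.1 + 1) * σ ^ p.2) := by gcongr
      _ = _ := by ring
  · rintro ⟨n, k⟩ hk
    rcases n with _ | n
    · simp [StaticMakino.intT]
    · exact absurd ⟨(n, k), rfl⟩ hk

lemma cf_cu_mul (p : Polynomial ℝ) (f : DSeries) (n k : ℕ) :
    cf (cu p * f) n k = PowerSeries.coeff k ((p : PowerSeries ℝ) * PowerSeries.coeff n f) := by
  simp [cf, cu, PowerSeries.coeff_C_mul]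

/-- If `∂ₜ f = p(u) g` and `f = 1` at `t = 0`, then `f = 1 + p(u) ∫ g dt`. -/
lemma eq_one_add_of_dT_eq {p : Polynomial ℝ} {f g : DSeries} (h : dT f = cu p * g)
    (h0 : ∀ k, cf f 0 k = if k = 0 then 1 else 0) : f = cu 1 + cu p * intT g := by
  refine cf_ext fun n k => ?_
  rw [cf_add, cf_cu, cf_cu_mul]
  rcases n with _ | n
  · have : PowerSeries.coeff 0 (intT g) = 0 := by ext k; simp [intT, ofCf]
    rw [this, h0]
    simp [Polynomial.coeff_one]
  · have e : PowerSeries.coeff (n + 1) (intT g)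
        = PowerSeries.C (((n + 1 : ℕ) : ℝ)⁻¹) * PowerSeries.coeff n g := by
      ext k
      rw [PowerSeries.coeff_C_mul]
      simp only [intT, ofCf, PowerSeries.coeff_mk, if_neg (Nat.succ_ne_zero n), Nat.add_sub_cancel,
        cf, div_eq_inv_mul]
    have h1 : ((n : ℝ) + 1) * cf f (n + 1) k = cf (cu p * g) n k := by
      rw [← h]; simp [dT]
    rw [cf_cu_mul] at h1
    rw [e, mul_left_comm, PowerSeries.coeff_C_mul, ← h1, if_neg (Nat.succ_ne_zero n), zero_add]
    push_cast
    field_simp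

lemma dU_dT (f : DSeries) : dU (dT f) = dT (dU f) := by
  refine cf_ext fun n k => ?_
  simp only [dU, dT, cf_ofCf]
  ring

lemma iterate_dU_dT (f : DSeries) (k : ℕ) : dU^[k] (dT f) = dT (dU^[k] f) := by
  induction k with
  | zero => rfl
  | succ k ih => rw [Function.iterate_succ_apply', Function.iterate_succ_apply', ih, dU_dT]

lemma Conv.iterate_dU {r : ℝ} {f : DSeries} (hf : Conv r f) (k : ℕ) : Conv r (StaticMakino.dU^[k] f) := by
  induction k with
  | zero => exact hf
  | succ k ih => rw [Function.iterate_succ_apply']; exact ih.dU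

lemma Conv.hasDerivAt_iterate {r : ℝ} {f : DSeries} (hf : Conv r f) {t u : ℝ} (ht : |t| < r)
    (hu : |u| < 9 / 8) (k : ℕ) :
    HasDerivAt (Ev (StaticMakino.dU^[k] f) t) (Ev (StaticMakino.dU^[k + 1] f) t u) u := by
  rw [Function.iterate_succ_apply']
  exact (hf.iterate_dU k).hasDerivAt_u ht hu

/-- A uniform bound for finitely many constants. -/
lemma exists_uniform_bound {p : ℕ → ℝ → Prop} (hp : ∀ k, ∃ C, p k C)
    (hm : ∀ k C D, C ≤ D → p k C → p k D) (N : ℕ) : ∃ C, ∀ k ≤ N, p k C := by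
  choose c hc using hp
  refine ⟨∑ i ∈ Finset.range (N + 1), |c i|, fun k hk => hm k (c k) _ ?_ (hc k)⟩
  exact (le_abs_self _).trans (Finset.single_le_sum (f := fun i => |c i|)
    (fun _ _ => abs_nonneg _) (Finset.mem_range.2 (by omega)))

section Curves

variable {U Φ : E3 → ℝ} {r T p : ℝ} {f : DSeries}

lemma abs_lt_of_mem_Icc {t : ℝ} (hT : T < r) (ht : t ∈ Icc 0 T) : |t| < r := by
  rw [abs_of_nonneg ht.1]; exact ht.2.trans_lt hT

lemma symS_mul_ev (hΦ : SymS p Φ) (hU : SymS 0 U) (hU1 : ∀ x, U x ∈ Icc (-1 : ℝ) 1)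
    (hf : Conv r f) (hT : T < r) {t : ℝ} (ht : t ∈ Icc 0 T) :
    SymS p (fun x => Φ x * Ev f t (U x)) := by
  intro N
  obtain ⟨A, hA⟩ := hΦ N
  obtain ⟨B₀, hB₀⟩ := hU N
  obtain ⟨C, hC, h⟩ := exists_symB_comp N hB₀ hU1
  have ht' := abs_lt_of_mem_Icc hT ht
  obtain ⟨B, hB⟩ := exists_uniform_bound
    (p := fun k D => ∀ u ∈ Icc (-1 : ℝ) 1, |Ev (dU^[k] f) t u| ≤ D)
    (fun k => by
      obtain ⟨D, -, hD⟩ := (hf.iterate_dU k).exists_bound (ht.1.trans ht.2) hT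
      exact ⟨D, fun u hu => hD t u (by rw [abs_of_nonneg ht.1]; exact ht.2) (abs_le.2 hu)⟩)
    (fun k C D hCD hk u hu => (hk u hu).trans hCD) N
  refine ⟨2 ^ N * A * (C * B), ?_⟩
  have := hA.mul (h (fun k => Ev (dU^[k] f) t) B
    (fun k u hu => hf.hasDerivAt_iterate ht' (abs_lt.2 hu) k) hB)
  rwa [add_zero] at this

lemma lipschitz_mul_ev (hΦ : SymS p Φ) (hU : SymS 0 U) (hU1 : ∀ x, U x ∈ Icc (-1 : ℝ) 1)
    (hf : Conv r f) (hT0 : 0 ≤ T) (hT : T < r) (N : ℕ) :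
    ∃ B, ∀ t ∈ Icc (0 : ℝ) T, ∀ t' ∈ Icc (0 : ℝ) T, SymB N p (B * |t' - t|)
      (fun x => Φ x * Ev f t' (U x) - Φ x * Ev f t (U x)) := by
  obtain ⟨A, hA⟩ := hΦ N
  obtain ⟨B₀, hB₀⟩ := hU N
  obtain ⟨C, hC, h⟩ := exists_symB_comp N hB₀ hU1
  obtain ⟨B, hB⟩ := exists_uniform_bound
    (p := fun k D => ∀ t t' u : ℝ, t ∈ Icc 0 T → t' ∈ Icc 0 T → |u| ≤ 1 →
      |Ev (dU^[k] f) t' u - Ev (dU^[k] f) t u| ≤ D * |t' - t|)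
    (fun k => by
      obtain ⟨D, -, hD⟩ := (hf.iterate_dU k).exists_lipschitz hT0 hT
      exact ⟨D, hD⟩)
    (fun k C D hCD hk t t' u ht ht' hu => (hk t t' u ht ht' hu).trans
      (mul_le_mul_of_nonneg_right hCD (abs_nonneg _))) N
  refine ⟨2 ^ N * A * (C * B), fun t ht t' ht' => ?_⟩
  have := hA.mul (h (fun k u => Ev (dU^[k] f) t' u - Ev (dU^[k] f) t u) (B * |t' - t|)
    (fun k u hu => (hf.hasDerivAt_iterate (abs_lt_of_mem_Icc hT ht') (abs_lt.2 hu) k).sub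
      (hf.hasDerivAt_iterate (abs_lt_of_mem_Icc hT ht) (abs_lt.2 hu) k))
    (fun k hk u hu => hB k hk t t' u ht ht' (abs_le.2 hu)))
  rw [add_zero] at this
  convert this using 1
  · ring
  · ext x; simp only [Function.iterate_zero, id]; ring

lemma taylor_mul_ev (hΦ : SymS p Φ) (hU : SymS 0 U) (hU1 : ∀ x, U x ∈ Icc (-1 : ℝ) 1)
    (hf : Conv r f) (hT0 : 0 ≤ T) (hT : T < r) (N : ℕ) :
    ∃ B, ∀ t ∈ Icc (0 : ℝ) T, ∀ t' ∈ Icc (0 : ℝ) T, t' ≠ t → SymB N p (B * |t' - t|)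
      (fun x => (Φ x * Ev f t' (U x) - Φ x * Ev f t (U x)) / (t' - t)
        - Φ x * Ev (dT f) t (U x)) := by
  obtain ⟨A, hA⟩ := hΦ N
  obtain ⟨B₀, hB₀⟩ := hU N
  obtain ⟨C, hC, h⟩ := exists_symB_comp N hB₀ hU1
  obtain ⟨B, hB⟩ := exists_uniform_bound
    (p := fun k D => ∀ t t' u : ℝ, t ∈ Icc 0 T → t' ∈ Icc 0 T → t' ≠ t → |u| ≤ 1 →
      |(Ev (dU^[k] f) t' u - Ev (dU^[k] f) t u) / (t' - t) - Ev (dU^[k] (dT f)) t u|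
        ≤ D * |t' - t|)
    (fun k => by
      obtain ⟨D, -, hD⟩ := (hf.iterate_dU k).exists_taylor hT0 hT
      simp only [iterate_dU_dT]
      exact ⟨D, hD⟩)
    (fun k C D hCD hk t t' u ht ht' hne hu => (hk t t' u ht ht' hne hu).trans
      (mul_le_mul_of_nonneg_right hCD (abs_nonneg _))) N
  refine ⟨2 ^ N * A * (C * B), fun t ht t' ht' hne => ?_⟩
  have := hA.mul (h (fun k u => (Ev (dU^[k] f) t' u - Ev (dU^[k] f) t u) / (t' - t)
      - Ev (dU^[k] (dT f)) t u) (B * |t' - t|)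
    (fun k u hu => (((hf.hasDerivAt_iterate (abs_lt_of_mem_Icc hT ht') (abs_lt.2 hu) k).sub
      (hf.hasDerivAt_iterate (abs_lt_of_mem_Icc hT ht) (abs_lt.2 hu) k)).div_const _).sub
      (hf.dT.hasDerivAt_iterate (abs_lt_of_mem_Icc hT ht) (abs_lt.2 hu) k))
    (fun k hk u hu => hB k hk t t' u ht ht' hne (abs_le.2 hu)))
  rw [add_zero] at this
  convert this using 1
  · ring
  · ext x; simp only [Function.iterate_zero, id]; ring

lemma hContOn_mul_ev (P : DyadicPartition) (s : ℝ) {δ : ℝ} (hp : 0 ≤ p) (hδ : δ + 3 / 2 < p)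
    (hΦ : SymS p Φ) (hU : SymS 0 U) (hU1 : ∀ x, U x ∈ Icc (-1 : ℝ) 1)
    (hf : Conv r f) (hT0 : 0 ≤ T) (hT : T < r) :
    HContOn P s δ T (fun t x => Φ x * Ev f t (U x)) :=
  hContOn_of_lipschitz P s hp hδ (fun _ ht => symS_mul_ev hΦ hU hU1 hf hT ht)
    (lipschitz_mul_ev hΦ hU hU1 hf hT0 hT)

lemma hC1On_mul_ev (P : DyadicPartition) (s : ℝ) {δ : ℝ} (hp : 0 ≤ p) (hδ : δ + 3 / 2 < p)
    (hΦ : SymS p Φ) (hU : SymS 0 U) (hU1 : ∀ x, U x ∈ Icc (-1 : ℝ) 1)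
    (hf : Conv r f) (hT0 : 0 ≤ T) (hT : T < r) :
    HC1On P s δ T (fun t x => Φ x * Ev f t (U x)) :=
  hC1On_of_taylor P s hp hδ (hContOn_mul_ev P s hp hδ hΦ hU hU1 hf.dT hT0 hT)
    (taylor_mul_ev hΦ hU hU1 hf hT0 hT)

end Curves

lemma HC1On.congr_sub {P : DyadicPartition} {s δ T : ℝ} {u v : ℝ → E3 → ℝ} (hu : HC1On P s δ T u)
    (h : ∀ t ∈ Icc (0 : ℝ) T, ∀ t' ∈ Icc (0 : ℝ) T, ∀ x, v t' x - v t x = u t' x - u t x) :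
    HC1On P s δ T v := by
  obtain ⟨u', h1, h2⟩ := hu
  refine ⟨u', h1, fun t ht ε hε => ?_⟩
  obtain ⟨η, hη, h3⟩ := h2 t ht ε hε
  refine ⟨η, hη, fun t' ht' hne hd => ?_⟩
  simp only [h t ht t' ht']
  exact h3 t' ht' hne hd

/-! ### Divergence theorem and Riesz potentials on `ℝ³` -/

/-- The reciprocal weight `(1 + |x|)⁻¹`. -/
def wt (x : E3) : ℝ := (1 + ‖x‖)⁻¹

lemma wt_pos (x : E3) : 0 < wt x := by unfold wt; positivity

lemma wt_le_one (x : E3) : wt x ≤ 1 := inv_le_one_of_one_le₀ (by linarith [norm_nonneg x])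

lemma continuous_wt : Continuous wt := by
  unfold wt
  exact (continuous_const.add continuous_norm).inv₀ fun x => ne_of_gt (by linarith [norm_nonneg x] : 0 < 1 + ‖x‖)

lemma wt_rpow (x : E3) (r : ℝ) : wt x ^ r = (1 + ‖x‖) ^ (-r) := by
  unfold wt
  rw [Real.inv_rpow (by positivity), Real.rpow_neg (by positivity)]

lemma integrable_wt_rpow {r : ℝ} (hr : 3 < r) : Integrable (fun x : E3 => wt x ^ r) := by
  simp only [wt_rpow]
  exact integrable_one_add_norm (by simpa using hr)

lemma integrable_wt_pow_four : Integrable (fun x : E3 => wt x ^ 4) := by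
  have := integrable_wt_rpow (r := 4) (by norm_num)
  refine this.congr (Filter.Eventually.of_forall fun x => ?_)
  exact_mod_cast Real.rpow_natCast (wt x) 4

/-- A continuous function dominated by an integrable function is integrable. -/
lemma integrable_of_continuous_of_le {f : E3 → ℝ} {g : E3 → ℝ} (hf : Continuous f)
    (hg : Integrable g) (h : ∀ x, |f x| ≤ g x) : Integrable f :=
  hg.mono' hf.aestronglyMeasurable (Filter.Eventually.of_forall h)

lemma hasFDerivAt_sq_add_rpow {b : ℝ} (hb : 0 < b) (e : ℝ) (x : E3) :
    HasFDerivAt (fun y : E3 => (b + ‖y‖ ^ 2) ^ e)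
      ((2 * e * (b + ‖x‖ ^ 2) ^ (e - 1)) • innerSL ℝ x) x := by
  have h1 : HasFDerivAt (fun y : E3 => b + ‖y‖ ^ 2) (2 • innerSL ℝ x) x :=
    ((hasStrictFDerivAt_norm_sq x).hasFDerivAt).const_add b
  have h2 := (Real.hasDerivAt_rpow_const (x := b + ‖x‖ ^ 2) (p := e)
    (Or.inl (by positivity))).comp_hasFDerivAt x h1
  refine h2.congr_fderiv ?_
  ext y
  simp
  ring

lemma innerSL_single (x : E3) (i : Fin 3) : innerSL ℝ x (EuclideanSpace.single i 1) = x i := by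
  simp [innerSL_apply_apply, EuclideanSpace.inner_single_right]

lemma abs_coord_le (x : E3) (i : Fin 3) : |x i| ≤ ‖x‖ := by
  simpa using PiLp.norm_apply_le x i

/-- The integral of a partial derivative of a decaying function vanishes. -/
lemma integral_pd_eq_zero {X : E3 → ℝ} (i : Fin 3) (hX : Differentiable ℝ X) {C : ℝ}
    (hXC : ∀ x, |X x| ≤ C * wt x ^ 3) (hint : Integrable (fun x => pd X i x)) :
    ∫ x, pd X i x = 0 := by
  have hC : 0 ≤ C := by
    have := (abs_nonneg _).trans (hXC 0)
    have h0 := pow_pos (wt_pos 0) 3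
    by_contra hneg
    nlinarith
  set χ : ℝ → E3 → ℝ := fun η y => (1 + ‖y‖ ^ 2) ^ (-η) with hχ
  have hχ0 : ∀ η y, 0 < χ η y := fun η y => by simp only [hχ]; positivity
  have hχ1 : ∀ η, 0 ≤ η → ∀ y, χ η y ≤ 1 := fun η hη y =>
    Real.rpow_le_one_of_one_le_of_nonpos (by nlinarith [sq_nonneg ‖y‖]) (by linarith)
  have hχd : ∀ η y, HasFDerivAt (χ η) ((2 * (-η) * (1 + ‖y‖ ^ 2) ^ (-η - 1)) • innerSL ℝ y) y :=
    fun η y => hasFDerivAt_sq_add_rpow one_pos (-η) y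
  have hχc : ∀ η, Continuous (χ η) := fun η =>
    continuous_iff_continuousAt.2 fun y => (hχd η y).continuousAt
  have hpd : ∀ η y, fderiv ℝ (χ η) y (EuclideanSpace.single i 1)
      = (2 * (-η) * (1 + ‖y‖ ^ 2) ^ (-η - 1)) * y i := fun η y => by
    rw [(hχd η y).fderiv]
    simp [innerSL_single]
  have hpdc : ∀ η, Continuous fun y => fderiv ℝ (χ η) y (EuclideanSpace.single i 1) := fun η => by
    simp only [hpd]
    have h1 : Continuous fun y : E3 => (1 + ‖y‖ ^ 2) ^ (-η - 1) :=
      Continuous.rpow_const (by fun_prop) fun y => Or.inl (by positivity)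
    exact (continuous_const.mul h1).mul (by fun_prop)
  have hpdb : ∀ η, 0 ≤ η → ∀ y, |fderiv ℝ (χ η) y (EuclideanSpace.single i 1)|
      ≤ 4 * η * wt y := fun η hη y => by
    have hq : (1 + ‖y‖ ^ 2) ^ (-η - 1) ≤ (1 + ‖y‖ ^ 2)⁻¹ := by
      rw [← Real.rpow_neg_one]
      exact Real.rpow_le_rpow_of_exponent_le (by nlinarith [sq_nonneg ‖y‖]) (by linarith)
    have hq0 : 0 < (1 + ‖y‖ ^ 2) ^ (-η - 1) := by positivity
    rw [hpd, abs_mul, abs_mul, abs_of_pos hq0, abs_mul, abs_neg, abs_of_nonneg hη, abs_two]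
    have h1 : (1 + ‖y‖ ^ 2)⁻¹ * ‖y‖ ≤ 2 * wt y := by
      unfold wt
      rw [inv_mul_le_iff₀ (by positivity), ← mul_assoc, ← div_eq_mul_inv, le_div_iff₀ (by positivity)]
      nlinarith [norm_nonneg y, sq_nonneg (‖y‖ - 1)]
    calc 2 * η * (1 + ‖y‖ ^ 2) ^ (-η - 1) * |y i|
        ≤ 2 * η * (1 + ‖y‖ ^ 2)⁻¹ * ‖y‖ := by gcongr; exact abs_coord_le y i
      _ = 2 * η * ((1 + ‖y‖ ^ 2)⁻¹ * ‖y‖) := by ring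
      _ ≤ 2 * η * (2 * wt y) := by gcongr
      _ = _ := by ring
  have hprod : ∀ η, 0 ≤ η → ∀ y, |fderiv ℝ (χ η) y (EuclideanSpace.single i 1) * X y|
      ≤ 4 * η * C * wt y ^ 4 := fun η hη y => by
    rw [abs_mul]
    calc _ ≤ 4 * η * wt y * (C * wt y ^ 3) := by
          have h0 := (wt_pos y).le
          gcongr
          · exact hpdb η hη y
          · exact hXC y
      _ = _ := by ring
  have hint4 := integrable_wt_pow_four
  have hibp : ∀ η, 0 < η → |∫ y, χ η y * pd X i y| ≤ 4 * η * C * ∫ y, wt y ^ 4 := by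
    intro η hη
    have i1 : Integrable fun y => fderiv ℝ (χ η) y (EuclideanSpace.single i 1) * X y :=
      integrable_of_continuous_of_le ((hpdc η).mul hX.continuous) (hint4.const_mul _) (hprod η hη.le)
    have i2 : Integrable fun y => χ η y * fderiv ℝ X y (EuclideanSpace.single i 1) := by
      refine hint.norm.mono' ((hχc η).aestronglyMeasurable.mul hint.aestronglyMeasurable) ?_
      refine Filter.Eventually.of_forall fun y => ?_
      rw [norm_mul, Real.norm_of_nonneg (hχ0 η y).le]
      exact mul_le_of_le_one_left (norm_nonneg _) (hχ1 η hη.le y)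
    have i3 : Integrable fun y => χ η y * X y := by
      refine integrable_of_continuous_of_le ((hχc η).mul hX.continuous)
        ((integrable_wt_rpow (r := 3 + 2 * η) (by linarith)).const_mul (2 ^ η * C)) fun y => ?_
      have h0 := wt_pos y
      rw [abs_mul, abs_of_pos (hχ0 η y)]
      have h1 : χ η y ≤ 2 ^ η * wt y ^ (2 * η) := by
        simp only [hχ]
        rw [Real.rpow_mul h0.le, ← Real.mul_rpow (by positivity) (by positivity), Real.rpow_neg
          (by positivity), ← Real.inv_rpow (by positivity)]
        refine Real.rpow_le_rpow (by positivity) ?_ hη.le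
        unfold wt
        rw [Real.rpow_two, inv_pow, inv_le_iff_one_le_mul₀ (by positivity), mul_assoc,
          mul_comm _ (1 + ‖y‖ ^ 2), ← mul_assoc, ← div_eq_mul_inv, le_div_iff₀ (by positivity)]
        nlinarith [sq_nonneg (‖y‖ - 1)]
      calc χ η y * |X y| ≤ (2 ^ η * wt y ^ (2 * η)) * (C * wt y ^ 3) := by
            gcongr; exact hXC y
        _ = 2 ^ η * C * wt y ^ (3 + 2 * η) := by
            rw [Real.rpow_add h0, ← Real.rpow_natCast (wt y) 3]; push_cast; ring
    have := integral_mul_fderiv_eq_neg_fderiv_mul_of_integrable i1 i2 i3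
      (fun y _ => (hχd η y).differentiableAt) (fun y _ => hX y)
    have h2 : ∫ y, χ η y * pd X i y = -∫ y, fderiv ℝ (χ η) y (EuclideanSpace.single i 1) * X y := this
    rw [h2, abs_neg, ← integral_const_mul]
    exact (abs_integral_le_integral_abs).trans
      (integral_mono i1.abs (hint4.const_mul _) (hprod η hη.le))
  have hlim : Filter.Tendsto (fun n : ℕ => ∫ y, χ (1 / ((n : ℝ) + 1)) y * pd X i y) Filter.atTop
      (nhds (∫ y, pd X i y)) := by
    refine tendsto_integral_of_dominated_convergence (fun y => ‖pd X i y‖)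
      (fun n => (hχc _).aestronglyMeasurable.mul hint.aestronglyMeasurable) hint.norm ?_ ?_
    · refine fun n => Filter.Eventually.of_forall fun y => ?_
      rw [norm_mul, Real.norm_of_nonneg (hχ0 _ y).le]
      exact mul_le_of_le_one_left (norm_nonneg _) (hχ1 _ (by positivity) y)
    · refine Filter.Eventually.of_forall fun y => ?_
      have h1 : Filter.Tendsto (fun n : ℕ => -(1 / ((n : ℝ) + 1))) Filter.atTop (nhds 0) := by
        simpa using (tendsto_one_div_add_atTop_nhds_zero_nat (𝕜 := ℝ)).neg
      have h2 : Filter.Tendsto (fun n : ℕ => χ (1 / ((n : ℝ) + 1)) y) Filter.atTop (nhds 1) := by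
        have := (Real.continuous_const_rpow (a := 1 + ‖y‖ ^ 2) (by positivity)).continuousAt.tendsto.comp h1
        simpa [hχ, Function.comp_def] using this
      simpa using h2.mul_const (pd X i y)
  have hlim0 : Filter.Tendsto (fun n : ℕ => ∫ y, χ (1 / ((n : ℝ) + 1)) y * pd X i y) Filter.atTop
      (nhds 0) := by
    rw [tendsto_zero_iff_abs_tendsto_zero]
    refine squeeze_zero (fun _ => abs_nonneg _) (fun n => hibp _ (by positivity)) ?_
    have := tendsto_one_div_add_atTop_nhds_zero_nat (𝕜 := ℝ)
    have h3 := ((this.const_mul 4).mul_const C).mul_const (∫ y : E3, wt y ^ 4)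
    simpa using h3
  exact tendsto_nhds_unique hlim hlim0

/-- The local part of the Riesz kernel is integrable. -/
lemma integrable_indicator_norm_rpow {k : ℝ} (hk : k < 3) :
    Integrable (fun z : E3 => (Metric.ball (0 : E3) 1).indicator (fun z => ‖z‖ ^ (-k)) z) := by
  have e : (fun z : E3 => (Metric.ball (0 : E3) 1).indicator (fun z => ‖z‖ ^ (-k)) z)
      = fun z : E3 => (Iio (1 : ℝ)).indicator (fun r => r ^ (-k)) ‖z‖ := by
    ext z
    by_cases hz : ‖z‖ < 1
    · rw [indicator_of_mem (by simpa using hz), indicator_of_mem (by simpa using hz)]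
    · rw [indicator_of_notMem (by simpa using hz), indicator_of_notMem (by simpa using hz)]
  rw [e, integrable_fun_norm_addHaar volume (f := (Iio (1 : ℝ)).indicator (fun r : ℝ => r ^ (-k)))]
  have h1 : IntegrableOn (fun r : ℝ => r ^ (2 - k)) (Ioc 0 1) :=
    (intervalIntegrable_iff_integrableOn_Ioc_of_le zero_le_one).1
      (intervalIntegral.intervalIntegrable_rpow' (by linarith))
  have h2 : IntegrableOn (fun r : ℝ => r ^ (2 - k)) (Ioo 0 1) := h1.mono_set Ioo_subset_Ioc_self
  have h3 : IntegrableOn ((Iio (1 : ℝ)).indicator (fun r : ℝ => r ^ (2 - k))) (Ioi 0) := by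
    rw [integrableOn_indicator_iff measurableSet_Iio]
    rwa [inter_comm, Ioi_inter_Iio]
  refine h3.congr_fun (fun r hr => ?_) measurableSet_Ioi
  have hr' : (0 : ℝ) < r := hr
  by_cases h : r < 1
  · simp only [indicator_of_mem (show r ∈ Iio (1 : ℝ) from h), finrank_euclideanSpace,
      Fintype.card_fin, smul_eq_mul]
    rw [sub_eq_add_neg, Real.rpow_add hr']
    norm_num
  · simp [indicator_of_notMem (show r ∉ Iio (1 : ℝ) from h)]

/-- Uniform bounds for Riesz potentials of the weights. -/
lemma exists_riesz_bound {k β : ℝ} (hk0 : 0 < k) (hk : k < 3) (hβ : 0 < β) (hkβ : 3 < k + β) :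
    ∃ C : ℝ, 0 ≤ C ∧ ∀ x : E3, Integrable (fun y : E3 => ‖x - y‖ ^ (-k) * wt y ^ β) ∧
      ∫ y : E3, ‖x - y‖ ^ (-k) * wt y ^ β ≤ C := by
  set F : E3 → ℝ := fun z => (Metric.ball (0 : E3) 1).indicator (fun z => ‖z‖ ^ (-k)) z with hF
  set G : E3 → ℝ := fun z => wt z ^ (k + β) with hG
  have iF : Integrable F := integrable_indicator_norm_rpow hk
  have iG : Integrable G := integrable_wt_rpow hkβ
  have hF0 : ∀ z, 0 ≤ F z := fun z => indicator_nonneg (fun z _ => by positivity) z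
  have hG0 : ∀ z, 0 ≤ G z := fun z => by have := wt_pos z; simp only [hG]; positivity
  have hle : ∀ x y : E3, ‖x - y‖ ^ (-k) * wt y ^ β ≤ F (x - y) + 2 ^ k * (G (x - y) + G y) := by
    intro x y
    have hw := wt_pos y
    have hv := wt_pos (x - y)
    by_cases h : ‖x - y‖ < 1
    · have : F (x - y) = ‖x - y‖ ^ (-k) := by
        simp only [hF]; rw [indicator_of_mem (by simpa using h)]
      rw [this]
      have h1 : wt y ^ β ≤ 1 := Real.rpow_le_one hw.le (wt_le_one y) hβ.le
      have h2 : ‖x - y‖ ^ (-k) * wt y ^ β ≤ ‖x - y‖ ^ (-k) :=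
        mul_le_of_le_one_right (by positivity) h1
      have := hG0 y; have := hG0 (x - y)
      have : 0 ≤ 2 ^ k * (G (x - y) + G y) := by positivity
      linarith
    · push Not at h
      have h1 : ‖x - y‖ ^ (-k) ≤ 2 ^ k * wt (x - y) ^ k := by
        rw [Real.rpow_neg (norm_nonneg _), ← Real.inv_rpow (norm_nonneg _),
          ← Real.mul_rpow (by norm_num) hv.le]
        refine Real.rpow_le_rpow (by positivity) ?_ hk0.le
        unfold wt
        rw [← div_eq_mul_inv, inv_eq_one_div, div_le_div_iff₀ (by linarith) (by positivity)]
        linarith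
      have h2 : wt (x - y) ^ k * wt y ^ β ≤ G (x - y) + G y := by
        simp only [hG]
        rcases le_total (wt (x - y)) (wt y) with h3 | h3
        · have : wt (x - y) ^ k * wt y ^ β ≤ wt y ^ k * wt y ^ β := by gcongr
          rw [← Real.rpow_add hw] at this
          have : 0 ≤ wt (x - y) ^ (k + β) := by positivity
          linarith
        · have : wt (x - y) ^ k * wt y ^ β ≤ wt (x - y) ^ k * wt (x - y) ^ β := by gcongr
          rw [← Real.rpow_add hv] at this
          have : 0 ≤ wt y ^ (k + β) := by positivity
          linarith
      have := hF0 (x - y)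
      calc ‖x - y‖ ^ (-k) * wt y ^ β ≤ 2 ^ k * wt (x - y) ^ k * wt y ^ β := by gcongr
        _ = 2 ^ k * (wt (x - y) ^ k * wt y ^ β) := by ring
        _ ≤ 2 ^ k * (G (x - y) + G y) := by gcongr
        _ ≤ _ := by linarith
  have ib : ∀ x : E3, Integrable fun y => F (x - y) + 2 ^ k * (G (x - y) + G y) := fun x =>
    (iF.comp_sub_left x).add (((iG.comp_sub_left x).add iG).const_mul _)
  refine ⟨(∫ z, F z) + 2 ^ k * ((∫ z, G z) + ∫ z, G z), ?_, fun x => ?_⟩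
  · have := integral_nonneg (μ := volume) (f := F) hF0
    have := integral_nonneg (μ := volume) (f := G) hG0
    positivity
  · have hm : AEStronglyMeasurable (fun y : E3 => ‖x - y‖ ^ (-k) * wt y ^ β) volume := by
      refine Measurable.aestronglyMeasurable ?_
      have := continuous_wt.measurable
      fun_prop
    have hi : Integrable (fun y : E3 => ‖x - y‖ ^ (-k) * wt y ^ β) := by
      refine (ib x).mono' hm (Filter.Eventually.of_forall fun y => ?_)
      have := wt_pos y
      rw [Real.norm_of_nonneg (by positivity)]
      exact hle x y
    refine ⟨hi, (integral_mono hi (ib x) (hle x)).trans (le_of_eq ?_)⟩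
    have iGG : Integrable fun y => G (x - y) + G y := (iG.comp_sub_left x).add iG
    rw [integral_add (iF.comp_sub_left x) (iGG.const_mul _), integral_const_mul,
      integral_add (iG.comp_sub_left x) iG, integral_sub_left_eq_self F,
      integral_sub_left_eq_self G]

/-! ### The Newtonian potential of a decaying Laplacian -/

lemma pd_eq {f : E3 → ℝ} {f' : E3 →L[ℝ] ℝ} {x : E3} (h : HasFDerivAt f f' x) (i : Fin 3) :
    pd f i x = f' (EuclideanSpace.single i 1) := by rw [pd, h.fderiv]

lemma pd_add {f g : E3 → ℝ} {x : E3} (hf : DifferentiableAt ℝ f x) (hg : DifferentiableAt ℝ g x)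
    (i : Fin 3) : pd (fun y => f y + g y) i x = pd f i x + pd g i x := by
  have h : HasFDerivAt (fun y => f y + g y) _ x := hf.hasFDerivAt.add hg.hasFDerivAt
  rw [pd_eq h]; rfl

lemma pd_sub {f g : E3 → ℝ} {x : E3} (hf : DifferentiableAt ℝ f x) (hg : DifferentiableAt ℝ g x)
    (i : Fin 3) : pd (fun y => f y - g y) i x = pd f i x - pd g i x := by
  have h : HasFDerivAt (fun y => f y - g y) _ x := hf.hasFDerivAt.sub hg.hasFDerivAt
  rw [pd_eq h]; rfl

lemma pd_mul {f g : E3 → ℝ} {x : E3} (hf : DifferentiableAt ℝ f x) (hg : DifferentiableAt ℝ g x)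
    (i : Fin 3) : pd (fun y => f y * g y) i x = f x * pd g i x + pd f i x * g x := by
  have h : HasFDerivAt (fun y => f y * g y) _ x := hf.hasFDerivAt.mul hg.hasFDerivAt
  rw [pd_eq h]
  simp [pd, mul_comm]

lemma pd_const_mul {f : E3 → ℝ} {x : E3} (hf : DifferentiableAt ℝ f x) (c : ℝ)
    (i : Fin 3) : pd (fun y => c * f y) i x = c * pd f i x := by
  have h : HasFDerivAt (fun y => c * f y) _ x := hf.hasFDerivAt.const_mul c
  rw [pd_eq h]; rfl

lemma hasFDerivAt_coord (j : Fin 3) (x : E3) :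
    HasFDerivAt (fun y : E3 => y j) (EuclideanSpace.proj j : E3 →L[ℝ] ℝ) x :=
  (EuclideanSpace.proj j : E3 →L[ℝ] ℝ).hasFDerivAt

lemma abs_pd_le (f : E3 → ℝ) (i : Fin 3) (x : E3) : |pd f i x| ≤ ‖fderiv ℝ f x‖ := by
  have := (fderiv ℝ f x).le_opNorm (EuclideanSpace.single i 1)
  simpa [pd] using this

lemma continuous_pd {f : E3 → ℝ} (hf : ContDiff ℝ 1 f) (i : Fin 3) : Continuous (pd f i) :=
  (hf.continuous_fderiv (by norm_num)).clm_apply continuous_const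

/-- The regularized Newtonian kernel. -/
def ker (b : ℝ) (c y : E3) : ℝ := (b + ‖y - c‖ ^ 2) ^ (-(1 / 2) : ℝ)

section Kernel

variable {b : ℝ} (hb : 0 < b) (c : E3)

lemma ker_pos (hb : 0 < b) (c y : E3) : 0 < ker b c y := by unfold ker; positivity

lemma ker_pow (hb : 0 < b) (c y : E3) (n : ℕ) :
    ker b c y ^ n = (b + ‖y - c‖ ^ 2) ^ (-(n / 2) : ℝ) := by
  unfold ker
  rw [← Real.rpow_natCast, ← Real.rpow_mul (by positivity)]
  congr 1; ring

lemma ker_sq (hb : 0 < b) (c y : E3) : ker b c y ^ 2 * (b + ‖y - c‖ ^ 2) = 1 := by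
  rw [ker_pow hb]
  norm_num
  rw [Real.rpow_neg_one]
  exact inv_mul_cancel₀ (by positivity)

lemma ker_eq (hb : 0 < b) (c y : E3) : ker b c y = (√(b + ‖y - c‖ ^ 2))⁻¹ := by
  unfold ker
  rw [Real.rpow_neg (by positivity), Real.sqrt_eq_rpow]

lemma ker_mul_norm_le (hb : 0 < b) (c y : E3) : ker b c y * ‖y - c‖ ≤ 1 := by
  have h := ker_sq hb c y
  have h1 : (ker b c y * ‖y - c‖) ^ 2 ≤ 1 := by
    nlinarith [mul_pos (pow_pos (ker_pos hb c y) 2) hb]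
  exact (abs_le_one_iff_mul_self_le_one.2 (by nlinarith)).trans' (le_abs_self _)

lemma hasFDerivAt_ker (hb : 0 < b) (c y : E3) :
    HasFDerivAt (ker b c) (-(ker b c y ^ 3) • innerSL ℝ (y - c)) y := by
  have h := (hasFDerivAt_sq_add_rpow hb (-(1 / 2)) (y - c)).comp y
    ((hasFDerivAt_id y).sub_const c)
  refine h.congr_fderiv ?_
  rw [ker_pow hb]
  ext z
  simp
  norm_num

lemma pd_ker (hb : 0 < b) (c y : E3) (i : Fin 3) :
    pd (ker b c) i y = -(ker b c y ^ 3) * (y - c) i := by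
  rw [pd_eq (hasFDerivAt_ker hb c y)]
  simp [innerSL_single]

lemma hasFDerivAt_pd_ker (hb : 0 < b) (c y : E3) (i : Fin 3) :
    HasFDerivAt (fun y => -(ker b c y ^ 3) * (y - c) i)
      ((3 * ker b c y ^ 5 * (y - c) i) • innerSL ℝ (y - c)
        - ker b c y ^ 3 • (EuclideanSpace.proj i : E3 →L[ℝ] ℝ)) y := by
  have h1 := ((hasFDerivAt_ker hb c y).pow 3).neg
  have h2 : HasFDerivAt (fun y : E3 => (y - c) i) (EuclideanSpace.proj i : E3 →L[ℝ] ℝ) y :=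
    (hasFDerivAt_coord i y).sub_const (c i)
  refine (h1.mul h2).congr_fderiv ?_
  ext z
  simp
  ring

lemma pd_pd_ker (hb : 0 < b) (c y : E3) (i : Fin 3) :
    pd (fun y => -(ker b c y ^ 3) * (y - c) i) i y
      = 3 * ker b c y ^ 5 * (y - c) i ^ 2 - ker b c y ^ 3 := by
  rw [pd_eq (hasFDerivAt_pd_ker hb c y i)]
  simp [innerSL_single]
  ring

lemma exists_ker_le (hb : 0 < b) (c : E3) : ∃ M, 0 ≤ M ∧ ∀ y, ker b c y ≤ M * wt y := by
  obtain ⟨m, hm, h⟩ := one_add_norm_sq_le (Real.sqrt_pos.2 hb)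
  refine ⟨√m * (1 + ‖c‖), by positivity, fun y => ?_⟩
  have h1 := h (y - c)
  rw [Real.sq_sqrt hb.le] at h1
  have h2 := ker_sq hb c y
  have hk := ker_pos hb c y
  have h3 : ker b c y * (1 + ‖y - c‖) ≤ √m := by
    refine Real.le_sqrt_of_sq_le ?_
    rw [mul_pow]
    have := mul_le_mul_of_nonneg_left h1 (sq_nonneg (ker b c y))
    calc _ ≤ _ := this
      _ = m * (ker b c y ^ 2 * (b + ‖y - c‖ ^ 2)) := by ring
      _ = m := by rw [h2, mul_one]
  have h4 : 1 + ‖y‖ ≤ (1 + ‖c‖) * (1 + ‖y - c‖) := by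
    have : ‖y‖ ≤ ‖y - c‖ + ‖c‖ := by simpa using norm_add_le (y - c) c
    nlinarith [norm_nonneg c, norm_nonneg (y - c), mul_nonneg (norm_nonneg c) (norm_nonneg (y - c))]
  unfold wt
  rw [← div_eq_mul_inv, le_div_iff₀ (by positivity)]
  calc ker b c y * (1 + ‖y‖) ≤ ker b c y * ((1 + ‖c‖) * (1 + ‖y - c‖)) := by gcongr
    _ = (ker b c y * (1 + ‖y - c‖)) * (1 + ‖c‖) := by ring
    _ ≤ _ := by gcongr

lemma continuous_ker (hb : 0 < b) (c : E3) : Continuous (ker b c) :=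
  continuous_iff_continuousAt.2 fun y => (hasFDerivAt_ker hb c y).continuousAt

end Kernel

/-- Green's identity for the regularized kernel. -/
lemma integral_ker_mul {φ ρ : E3 → ℝ} {G : Fin 3 → E3 → ℝ} {C : ℝ} (hφ : Differentiable ℝ φ)
    (hφG : ∀ i x, pd φ i x = G i x) (hG : ∀ i, ContDiff ℝ 1 (G i))
    (h0 : ∀ x, |φ x| ≤ C * wt x) (h1 : ∀ i x, |G i x| ≤ C * wt x ^ 2)
    (h2 : ∀ i x, |pd (G i) i x| ≤ C * wt x ^ 3)
    (hρ : ∀ x, ∑ i, pd (G i) i x = 4 * π * ρ x) {b : ℝ} (hb : 0 < b) (c : E3) :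
    ∫ y, ker b c y * (4 * π * ρ y) = -∫ y, 3 * b * ker b c y ^ 5 * φ y := by
  obtain ⟨M, hM, hMy⟩ := exists_ker_le hb c
  have hC : 0 ≤ C := by
    have := (abs_nonneg _).trans (h0 0)
    have h0 := wt_pos 0
    by_contra hneg
    nlinarith
  have hk := fun y => ker_pos hb c y
  have hkc := continuous_ker hb c
  have hkd : ∀ y, DifferentiableAt ℝ (ker b c) y := fun y => (hasFDerivAt_ker hb c y).differentiableAt
  have hcoord : ∀ i y, ker b c y * |(y - c) i| ≤ 1 := fun i y =>
    (mul_le_mul_of_nonneg_left (abs_coord_le (y - c) i) (hk y).le).trans (ker_mul_norm_le hb c y)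
  set X : Fin 3 → E3 → ℝ := fun i y => ker b c y * G i y - φ y * (-(ker b c y ^ 3) * (y - c) i) with hX
  have hXd : ∀ i, Differentiable ℝ (X i) := fun i y =>
    ((hkd y).mul ((hG i).differentiable (by norm_num) y)).sub
      ((hφ y).mul (hasFDerivAt_pd_ker hb c y i).differentiableAt)
  have hXpd : ∀ i y, pd (X i) i y = ker b c y * pd (G i) i y
      - φ y * (3 * ker b c y ^ 5 * (y - c) i ^ 2 - ker b c y ^ 3) := by
    intro i y
    have hGd := (hG i).differentiable (by norm_num) y
    simp only [hX]
    have d1 : DifferentiableAt ℝ (fun y => ker b c y * G i y) y := (hkd y).mul hGd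
    have d2 : DifferentiableAt ℝ (fun y => φ y * (-(ker b c y ^ 3) * (y - c) i)) y :=
      (hφ y).mul (hasFDerivAt_pd_ker hb c y i).differentiableAt
    rw [pd_sub d1 d2,
      pd_mul (hkd y) hGd, pd_mul (hφ y) (hasFDerivAt_pd_ker hb c y i).differentiableAt, pd_ker hb,
      pd_pd_ker hb, hφG]
    ring
  have hXb : ∀ i y, |X i y| ≤ (M * C + C * M ^ 2) * wt y ^ 3 := by
    intro i y
    have e1 : |ker b c y * G i y| ≤ (M * wt y) * (C * wt y ^ 2) := by
      rw [abs_mul, abs_of_pos (hk y)]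
      have := (wt_pos y).le
      gcongr
      · exact hMy y
      · exact h1 i y
    have e2 : |φ y * (-(ker b c y ^ 3) * (y - c) i)| ≤ (C * wt y) * (M * wt y) ^ 2 := by
      have e3 : |-(ker b c y ^ 3) * (y - c) i| = ker b c y ^ 2 * (ker b c y * |(y - c) i|) := by
        rw [abs_mul, abs_neg, abs_of_pos (pow_pos (hk y) 3)]; ring
      rw [abs_mul, e3]
      have := (wt_pos y).le
      have := (hk y).le
      refine mul_le_mul (h0 y) ?_ (by positivity) (by positivity)
      calc _ ≤ ker b c y ^ 2 * 1 := by gcongr; exact hcoord i y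
        _ ≤ _ := by rw [mul_one]; gcongr; exact hMy y
    calc |X i y| ≤ _ := abs_sub _ _
      _ ≤ _ := add_le_add e1 e2
      _ = _ := by ring
  have hXint : ∀ i, Integrable (fun y => pd (X i) i y) := by
    intro i
    refine integrable_of_continuous_of_le (g := fun y => (M * C + C * (4 * M ^ 3)) * wt y ^ 4) ?_
      (integrable_wt_pow_four.const_mul _) fun y => ?_
    · simp only [hXpd]
      have := continuous_pd (hG i) i
      have h3 : Continuous fun y : E3 => (y - c) i :=
        (hasFDerivAt_coord i · |>.continuousAt) |> continuous_iff_continuousAt.2 |>.comp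
          (continuous_id.sub continuous_const)
      exact (hkc.mul this).sub (hφ.continuous.mul
        (((continuous_const.mul (hkc.pow 5)).mul (h3.pow 2)).sub (hkc.pow 3)))
    · rw [hXpd]
      have hw := (wt_pos y).le
      have hk' := (hk y).le
      have e1 : |ker b c y * pd (G i) i y| ≤ (M * wt y) * (C * wt y ^ 3) := by
        rw [abs_mul, abs_of_pos (hk y)]
        gcongr
        · exact hMy y
        · exact h2 i y
      have e2 : |φ y * (3 * ker b c y ^ 5 * (y - c) i ^ 2 - ker b c y ^ 3)|
          ≤ (C * wt y) * (4 * (M * wt y) ^ 3) := by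
        have e3 : |3 * ker b c y ^ 5 * (y - c) i ^ 2 - ker b c y ^ 3| ≤ 4 * ker b c y ^ 3 := by
          have e4 : 3 * ker b c y ^ 5 * (y - c) i ^ 2
              = 3 * ker b c y ^ 3 * (ker b c y * |(y - c) i|) ^ 2 := by
            rw [mul_pow, sq_abs]; ring
          have e5 : (ker b c y * |(y - c) i|) ^ 2 ≤ 1 := pow_le_one₀ (by positivity) (hcoord i y)
          have e6 : 0 ≤ ker b c y ^ 3 := by positivity
          rw [e4, abs_le]
          constructor
          · nlinarith [mul_nonneg e6 (sq_nonneg (ker b c y * |(y - c) i|))]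
          · nlinarith [mul_le_mul_of_nonneg_left e5 e6]
        rw [abs_mul]
        refine mul_le_mul (h0 y) (e3.trans ?_) (abs_nonneg _) (by positivity)
        gcongr
        exact hMy y
      calc _ ≤ _ := abs_sub _ _
        _ ≤ _ := add_le_add e1 e2
        _ = _ := by ring
  have hsum : ∫ y, ∑ i, pd (X i) i y = 0 := by
    rw [integral_finsetSum _ fun i _ => hXint i]
    exact Finset.sum_eq_zero fun i _ => integral_pd_eq_zero i (hXd i) (hXb i) (hXint i)
  have hpt : ∀ y, ∑ i, pd (X i) i y
      = ker b c y * (4 * π * ρ y) + 3 * b * ker b c y ^ 5 * φ y := by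
    intro y
    simp only [hXpd]
    rw [Finset.sum_sub_distrib, ← Finset.mul_sum, hρ]
    have e1 : ‖y - c‖ ^ 2 = ∑ i, (y - c) i ^ 2 := by
      rw [EuclideanSpace.norm_sq_eq]; simp
    have e2 : ∑ i, φ y * (3 * ker b c y ^ 5 * (y - c) i ^ 2 - ker b c y ^ 3)
        = φ y * (3 * ker b c y ^ 5 * ‖y - c‖ ^ 2 - 3 * ker b c y ^ 3) := by
      rw [e1, Fin.sum_univ_three, Fin.sum_univ_three]; ring
    rw [e2]
    have := ker_sq hb c y
    linear_combination (-(3 * ker b c y ^ 3 * φ y)) * this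
  have i1 : Integrable fun y => 3 * b * ker b c y ^ 5 * φ y := by
    refine integrable_of_continuous_of_le (g := fun y => (3 * b * M ^ 5 * C) * wt y ^ 4)
      ((continuous_const.mul (hkc.pow 5)).mul hφ.continuous)
      (integrable_wt_pow_four.const_mul _) fun y => ?_
    have hw := (wt_pos y).le
    have hk' := (hk y).le
    rw [abs_mul, abs_of_nonneg (by positivity)]
    calc _ ≤ 3 * b * (M * wt y) ^ 5 * (C * wt y) := by
          gcongr
          · exact hMy y
          · exact h0 y
      _ = (3 * b * M ^ 5 * C) * wt y ^ 4 * wt y ^ 2 := by ring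
      _ ≤ _ := mul_le_of_le_one_right (by positivity) (pow_le_one₀ hw (wt_le_one y))
  have i2 : Integrable fun y => ker b c y * (4 * π * ρ y) := by
    have : Integrable fun y => ∑ i, pd (X i) i y := integrable_finsetSum _ fun i _ => hXint i
    refine (this.sub i1).congr (Filter.Eventually.of_forall fun y => ?_)
    simp only [Pi.sub_apply, hpt]
    ring
  simp only [hpt] at hsum
  rw [integral_add i2 i1] at hsum
  linarith

lemma integral_ker_pow_five : ∫ w : E3, 3 * ker 1 0 w ^ 5 = 4 * π := by
  have e : (fun w : E3 => 3 * ker 1 0 w ^ 5)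
      = fun w : E3 => (fun r : ℝ => 3 * (1 + r ^ 2) ^ (-(5 / 2) : ℝ)) ‖w‖ := by
    ext w; rw [ker_pow one_pos]; simp
  rw [e, integral_fun_norm_addHaar volume (fun r : ℝ => 3 * (1 + r ^ 2) ^ (-(5 / 2) : ℝ))]
  have hd : ∀ r : ℝ, HasDerivAt (fun r : ℝ => r ^ 3 * (1 + r ^ 2) ^ (-(3 / 2) : ℝ))
      (r ^ 2 * (3 * (1 + r ^ 2) ^ (-(5 / 2) : ℝ))) r := by
    intro r
    have h1 : HasDerivAt (fun r : ℝ => 1 + r ^ 2) (2 * r) r := by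
      simpa using (hasDerivAt_pow 2 r).const_add 1
    have h2 := h1.rpow_const (p := -(3 / 2)) (Or.inl (by positivity))
    have h3 := (hasDerivAt_pow 3 r).mul h2
    refine HasDerivAt.congr_deriv (f := fun r : ℝ => r ^ 3 * (1 + r ^ 2) ^ (-(3 / 2) : ℝ)) h3 ?_
    have e1 : (1 + r ^ 2) ^ (-(3 / 2) : ℝ) = (1 + r ^ 2) * (1 + r ^ 2) ^ (-(5 / 2) : ℝ) := by
      rw [← Real.rpow_one_add' (by positivity) (by norm_num)]; norm_num
    have e2 : (-(3 / 2) - 1 : ℝ) = -(5 / 2) := by norm_num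
    rw [e1, e2]
    push_cast
    ring
  have hlim : Filter.Tendsto (fun r : ℝ => r ^ 3 * (1 + r ^ 2) ^ (-(3 / 2) : ℝ)) Filter.atTop
      (nhds 1) := by
    have h1 : Filter.Tendsto (fun r : ℝ => ((r⁻¹) ^ 2 + 1) ^ (-(3 / 2) : ℝ)) Filter.atTop
        (nhds (((0 : ℝ) ^ 2 + 1) ^ (-(3 / 2) : ℝ))) :=
      ((tendsto_inv_atTop_zero.pow 2).add_const 1).rpow_const (Or.inl (by norm_num))
    norm_num at h1
    refine h1.congr' ?_
    filter_upwards [Filter.eventually_gt_atTop 0] with r hr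
    have e1 : r ^ 3 = (r ^ 2)⁻¹ ^ (-(3 / 2) : ℝ) := by
      rw [← Real.rpow_natCast r 2, ← Real.rpow_neg hr.le, ← Real.rpow_mul hr.le,
        ← Real.rpow_natCast]
      norm_num
    rw [e1, ← Real.mul_rpow (by positivity) (by positivity)]
    congr 1
    field_simp
  have hint : IntegrableOn (fun r : ℝ => r ^ 2 * (3 * (1 + r ^ 2) ^ (-(5 / 2) : ℝ))) (Ioi 0) :=
    integrableOn_Ioi_deriv_of_nonneg (hd 0).continuousAt.continuousWithinAt (fun r _ => hd r)
      (fun r _ => by positivity) hlim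
  have := integral_Ioi_of_hasDerivAt_of_tendsto' (fun r _ => hd r) hint hlim
  simp only [finrank_euclideanSpace, Fintype.card_fin, smul_eq_mul]
  norm_num at this ⊢
  rw [this, Measure.real, EuclideanSpace.volume_ball_fin_three]
  simp
  rw [ENNReal.toReal_ofReal (by positivity)]
  ring

set_option maxHeartbeats 1000000 in
/-- A decaying function is the Newtonian potential of its Laplacian. -/
theorem newtonPotential_eq {φ ρ : E3 → ℝ} {G : Fin 3 → E3 → ℝ} {C : ℝ} (hφ : Differentiable ℝ φ)
    (hφG : ∀ i x, pd φ i x = G i x) (hG : ∀ i, ContDiff ℝ 1 (G i))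
    (h0 : ∀ x, |φ x| ≤ C * wt x) (h1 : ∀ i x, |G i x| ≤ C * wt x ^ 2)
    (h2 : ∀ i x, |pd (G i) i x| ≤ C * wt x ^ 3)
    (hρ : ∀ x, ∑ i, pd (G i) i x = 4 * π * ρ x) : newtonPotential ρ = φ := by
  funext c
  have hC : 0 ≤ C := by
    have := (abs_nonneg _).trans (h0 0)
    have h0 := wt_pos 0
    by_contra hneg
    nlinarith
  set ε : ℕ → ℝ := fun n => 1 / ((n : ℝ) + 1) with hε
  have hε0 : ∀ n, 0 < ε n := fun n => by simp only [hε]; positivity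
  have hεlim : Filter.Tendsto ε Filter.atTop (nhds 0) := tendsto_one_div_add_atTop_nhds_zero_nat
  have hρc : Continuous ρ := by
    have : ρ = fun x => (4 * π)⁻¹ * ∑ i, pd (G i) i x := by
      ext x; rw [hρ]; field_simp
    rw [this]
    exact continuous_const.mul (continuous_finsetSum _ fun i _ => continuous_pd (hG i) i)
  have hρb : ∀ y, |4 * π * ρ y| ≤ 3 * C * wt y ^ (3 : ℝ) := fun y => by
    rw [← hρ]
    refine (Finset.abs_sum_le_sum_abs _ _).trans ?_
    refine (Finset.sum_le_sum fun i _ => h2 i y).trans (le_of_eq ?_)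
    rw [Finset.sum_const, Finset.card_univ, Fintype.card_fin, ← Real.rpow_natCast (wt y) 3]
    simp; ring
  -- the left-hand side of the Green identity
  have hL : Filter.Tendsto (fun n => ∫ y, ker (ε n ^ 2) c y * (4 * π * ρ y)) Filter.atTop
      (nhds (∫ y, 4 * π * (ρ y / ‖c - y‖))) := by
    obtain ⟨R, -, hR⟩ := exists_riesz_bound (k := 1) (β := 3) (by norm_num) (by norm_num)
      (by norm_num) (by norm_num)
    have hne : ∀ᵐ y : E3, y ≠ c := by
      rw [ae_iff]; simp
    refine tendsto_integral_of_dominated_convergence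
      (fun y => 3 * C * (‖c - y‖ ^ (-1 : ℝ) * wt y ^ (3 : ℝ))) (fun n => ?_)
      ((hR c).1.const_mul _) (fun n => ?_) ?_
    · exact ((continuous_ker (by have := hε0 n; positivity) c).mul
        (continuous_const.mul hρc)).aestronglyMeasurable
    · filter_upwards [hne] with y hy
      have hb : 0 < ε n ^ 2 := by have := hε0 n; positivity
      have hn : 0 < ‖y - c‖ := norm_pos_iff.2 (sub_ne_zero.2 hy)
      have hk : ker (ε n ^ 2) c y ≤ ‖c - y‖ ^ (-1 : ℝ) := by
        rw [norm_sub_rev c y, Real.rpow_neg_one, ← one_div, le_div_iff₀ hn]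
        exact ker_mul_norm_le hb c y
      rw [Real.norm_eq_abs, abs_mul, abs_of_pos (ker_pos hb c y)]
      have := (wt_pos y).le
      calc _ ≤ ‖c - y‖ ^ (-1 : ℝ) * (3 * C * wt y ^ (3 : ℝ)) := by
            gcongr; exact hρb y
        _ = _ := by ring
    · filter_upwards [hne] with y hy
      have hn : 0 < ‖y - c‖ := norm_pos_iff.2 (sub_ne_zero.2 hy)
      have h3 : Filter.Tendsto (fun n => ker (ε n ^ 2) c y) Filter.atTop (nhds (‖y - c‖⁻¹)) := by
        have h4 : Filter.Tendsto (fun n => (√(ε n ^ 2 + ‖y - c‖ ^ 2))⁻¹) Filter.atTop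
            (nhds ((√(0 ^ 2 + ‖y - c‖ ^ 2))⁻¹)) :=
          (((hεlim.pow 2).add_const _).sqrt).inv₀ (by
            rw [zero_pow two_ne_zero, zero_add, Real.sqrt_sq hn.le]; exact hn.ne')
        rw [zero_pow two_ne_zero, zero_add, Real.sqrt_sq hn.le] at h4
        refine h4.congr fun n => ?_
        rw [ker_eq (by have := hε0 n; positivity)]
      have h5 := h3.mul_const (4 * π * ρ y)
      convert h5 using 2
      rw [norm_sub_rev c y]
      field_simp
  -- the right-hand side
  have hRt : ∀ n, ∫ y, 3 * ε n ^ 2 * ker (ε n ^ 2) c y ^ 5 * φ y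
      = ∫ w : E3, 3 * ker 1 0 w ^ 5 * φ (c + ε n • w) := by
    intro n
    have hn := hε0 n
    have s1 : ∫ y, 3 * ε n ^ 2 * ker (ε n ^ 2) c y ^ 5 * φ y
        = ∫ z, 3 * ε n ^ 2 * ker (ε n ^ 2) c (c + z) ^ 5 * φ (c + z) :=
      (integral_add_left_eq_self (μ := volume)
        (fun y => 3 * ε n ^ 2 * ker (ε n ^ 2) c y ^ 5 * φ y) c).symm
    have s2 := Measure.integral_comp_smul (volume : Measure E3)
      (fun z => 3 * ε n ^ 2 * ker (ε n ^ 2) c (c + z) ^ 5 * φ (c + z)) (ε n)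
    rw [s1]
    simp only [finrank_euclideanSpace, Fintype.card_fin, smul_eq_mul] at s2
    rw [abs_of_pos (by positivity)] at s2
    have s3 : ∫ z, 3 * ε n ^ 2 * ker (ε n ^ 2) c (c + z) ^ 5 * φ (c + z)
        = ε n ^ 3 * ∫ x : E3, 3 * ε n ^ 2 * ker (ε n ^ 2) c (c + ε n • x) ^ 5 * φ (c + ε n • x) := by
      rw [s2]; field_simp
    rw [s3, ← integral_const_mul]
    congr 1
    ext w
    have s4 : ker (ε n ^ 2) c (c + ε n • w) = (ε n)⁻¹ * ker 1 0 w := by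
      rw [ker_eq (by positivity), ker_eq one_pos, ← mul_inv]
      congr 1
      rw [add_sub_cancel_left, norm_smul, Real.norm_of_nonneg hn.le, sub_zero, mul_pow,
        show ε n ^ 2 + ε n ^ 2 * ‖w‖ ^ 2 = ε n ^ 2 * (1 + ‖w‖ ^ 2) by ring,
        Real.sqrt_mul (by positivity), Real.sqrt_sq hn.le]
    rw [s4]
    field_simp
  have hRl : Filter.Tendsto (fun n => ∫ w : E3, 3 * ker 1 0 w ^ 5 * φ (c + ε n • w)) Filter.atTop
      (nhds (∫ w : E3, 3 * ker 1 0 w ^ 5 * φ c)) := by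
    obtain ⟨M, hM, hMy⟩ := exists_ker_le one_pos (0 : E3)
    have hkc := continuous_ker one_pos (0 : E3)
    refine tendsto_integral_of_dominated_convergence
      (fun w => 3 * M ^ 5 * C * wt w ^ 4) (fun n => ?_)
      (integrable_wt_pow_four.const_mul _) (fun n => Filter.Eventually.of_forall fun w => ?_)
      (Filter.Eventually.of_forall fun w => ?_)
    · exact ((continuous_const.mul (hkc.pow 5)).mul (hφ.continuous.comp
        (continuous_const.add (continuous_id.const_smul (ε n))))).aestronglyMeasurable
    · have hw := (wt_pos w).le
      have hk := (ker_pos one_pos 0 w).le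
      rw [Real.norm_eq_abs, abs_mul, abs_of_nonneg (by positivity)]
      have h6 : |φ (c + ε n • w)| ≤ C :=
        (h0 _).trans (mul_le_of_le_one_right hC (wt_le_one _))
      calc _ ≤ 3 * (M * wt w) ^ 5 * C := by
            gcongr
            exact hMy w
        _ = (3 * M ^ 5 * C) * wt w ^ 4 * wt w := by ring
        _ ≤ _ := mul_le_of_le_one_right (by positivity) (wt_le_one w)
    · refine Filter.Tendsto.const_mul _ ?_
      have h7 : Filter.Tendsto (fun n => c + ε n • w) Filter.atTop (nhds (c + (0 : ℝ) • w)) :=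
        (hεlim.smul_const w).const_add c
      rw [zero_smul, add_zero] at h7
      exact (hφ.continuous.tendsto c).comp h7
  have hlim : Filter.Tendsto (fun n => ∫ y, ker (ε n ^ 2) c y * (4 * π * ρ y)) Filter.atTop
      (nhds (-∫ w : E3, 3 * ker 1 0 w ^ 5 * φ c)) := by
    refine hRl.neg.congr fun n => ?_
    rw [← hRt n, ← integral_ker_mul hφ hφG hG h0 h1 h2 hρ (by have := hε0 n; positivity) c]
  have := tendsto_nhds_unique hL hlim
  rw [integral_const_mul, integral_mul_const, integral_ker_pow_five] at this
  have hpi : (4 * π) ≠ 0 := by positivity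
  unfold newtonPotential
  have h8 : 4 * π * (∫ y, ρ y / ‖c - y‖) = 4 * π * (-φ c) := by rw [this]; ring
  rw [mul_left_cancel₀ hpi h8, neg_neg]

/-! ### The solution issued from the static data -/

section Profile

/-- The profile `(a² + |x|²)^(-1/2)`. -/
def zet (a : ℝ) (x : E3) : ℝ := (a ^ 2 + ‖x‖ ^ 2) ^ (-(1 / 2) : ℝ)

/-- The profile `(a² + |x|²)^(-1/4)` of the static Makino variable. -/
def rtz (a : ℝ) (x : E3) : ℝ := (a ^ 2 + ‖x‖ ^ 2) ^ (-(1 / 4) : ℝ)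

/-- The compactified radial coordinate `1 - a (a² + |x|²)^(-1/2)`. -/
def rad (a : ℝ) (x : E3) : ℝ := 1 - a * zet a x

variable {a : ℝ}

lemma zet_pos (ha : 0 < a) (x : E3) : 0 < zet a x := by unfold zet; positivity

lemma rtz_pos (ha : 0 < a) (x : E3) : 0 < rtz a x := by unfold rtz; positivity

lemma rtz_sq (ha : 0 < a) (x : E3) : rtz a x ^ 2 = zet a x := by
  unfold rtz zet
  rw [← Real.rpow_natCast, ← Real.rpow_mul (by positivity)]
  norm_num

lemma zet_sq_mul (ha : 0 < a) (x : E3) : zet a x ^ 2 * ‖x‖ ^ 2 = 1 - a ^ 2 * zet a x ^ 2 := by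
  have h : zet a x ^ 2 * (a ^ 2 + ‖x‖ ^ 2) = 1 := by
    unfold zet
    rw [← Real.rpow_natCast, ← Real.rpow_mul (by positivity)]
    norm_num
    rw [Real.rpow_neg_one]
    exact inv_mul_cancel₀ (by positivity)
  linear_combination h

lemma mul_zet_le_one (ha : 0 < a) (x : E3) : a * zet a x ≤ 1 := by
  have h := zet_sq_mul ha x
  have h1 := zet_pos ha x
  by_contra hlt
  push Not at hlt
  nlinarith [sq_nonneg (zet a x * ‖x‖)]

lemma rad_mem_Icc (ha : 0 < a) (x : E3) : rad a x ∈ Icc (-1 : ℝ) 1 := by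
  have h1 := mul_zet_le_one ha x
  have h2 := mul_pos ha (zet_pos ha x)
  unfold rad
  constructor <;> linarith

lemma abs_rad_lt (ha : 0 < a) (x : E3) : |rad a x| < 9 / 8 := by
  have := abs_le.2 (rad_mem_Icc ha x)
  linarith

lemma hasFDerivAt_zet (ha : 0 < a) (x : E3) :
    HasFDerivAt (zet a) (-(zet a x ^ 3) • innerSL ℝ x) x := by
  refine (hasFDerivAt_sq_add_rpow (b := a ^ 2) (by positivity) (-(1 / 2)) x).congr_fderiv ?_
  have : zet a x ^ 3 = (a ^ 2 + ‖x‖ ^ 2) ^ (-(1 / 2) - 1 : ℝ) := by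
    unfold zet
    rw [← Real.rpow_natCast, ← Real.rpow_mul (by positivity)]
    norm_num
  rw [this]
  norm_num

lemma hasFDerivAt_rtz (ha : 0 < a) (x : E3) :
    HasFDerivAt (rtz a) (-(1 / 2 * rtz a x * zet a x ^ 2) • innerSL ℝ x) x := by
  refine (hasFDerivAt_sq_add_rpow (b := a ^ 2) (by positivity) (-(1 / 4)) x).congr_fderiv ?_
  have : rtz a x * zet a x ^ 2 = (a ^ 2 + ‖x‖ ^ 2) ^ (-(1 / 4) - 1 : ℝ) := by
    unfold zet rtz
    rw [← Real.rpow_natCast ((a ^ 2 + ‖x‖ ^ 2) ^ (-(1 / 2) : ℝ)), ← Real.rpow_mul (by positivity), ← Real.rpow_add (by positivity)]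
    norm_num
  rw [mul_assoc (1 / 2 : ℝ), this]
  congr 1
  ring

lemma hasFDerivAt_rad (ha : 0 < a) (x : E3) :
    HasFDerivAt (rad a) ((a * zet a x ^ 3) • innerSL ℝ x) x := by
  refine (((hasFDerivAt_zet ha x).const_mul a).const_sub 1).congr_fderiv ?_
  ext z; simp; ring

lemma symS_zet (ha : 0 < a) : SymS 1 (zet a) := fun N => by
  have := exists_symB_rpow N ha (-(1 / 2))
  norm_num at this ⊢
  exact this

lemma symS_rtz (ha : 0 < a) : SymS (1 / 2) (rtz a) := fun N => by
  have := exists_symB_rpow N ha (-(1 / 4))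
  have e : -(2 * (-(1 / 4))) = (1 / 2 : ℝ) := by norm_num
  rw [e] at this
  exact this

lemma symS_const (c : ℝ) : SymS 0 (fun _ => c) := fun N => ⟨_, symB_const N c⟩

lemma SymS.nonneg_mono {p q : ℝ} {f : E3 → ℝ} (h : SymS p f) (hpq : q ≤ p) : SymS q f := fun N => by
  obtain ⟨B, hB⟩ := h N
  exact ⟨B, hB.1, fun k hk x => (hB.2 k hk x).trans (mul_le_mul_of_nonneg_left
    (Real.rpow_le_rpow_of_exponent_le (by linarith [norm_nonneg x]) (by linarith)) hB.nonneg)⟩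

lemma symS_rad (ha : 0 < a) : SymS 0 (rad a) := fun N => by
  obtain ⟨B, hB⟩ := ((symS_const (-a)).mul (symS_zet ha)).nonneg_mono (q := 0) (by norm_num) N
  have := (symB_const N 1).add hB
  have e : rad a = fun x => 1 + -a * zet a x := by ext x; simp only [rad]; ring
  exact ⟨_, e ▸ this⟩

lemma symS_coord_mul_zet_pow (ha : 0 < a) (i : Fin 3) :
    SymS 2 (fun x => x i * zet a x ^ 3) := by
  have h1 : SymS (-1) (fun x : E3 => x i) := fun N => ⟨1, symB_coord N i⟩
  have h2 := h1.mul ((symS_zet ha).mul ((symS_zet ha).mul (symS_zet ha)))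
  norm_num at h2
  have e : (fun x : E3 => x i * zet a x ^ 3)
      = fun x => x i * (zet a x * (zet a x * zet a x)) := by ext x; ring
  rwa [e]

lemma symS_mul_rtz_zet (ha : 0 < a) : SymS (3 / 2) (fun x => a * (rtz a x * zet a x)) := by
  have h2 := (symS_const a).mul ((symS_rtz ha).mul (symS_zet ha))
  norm_num at h2
  exact h2

variable {r t : ℝ} {f : DSeries}

lemma hasFDerivAt_ev_rad (ha : 0 < a) (hf : Conv r f) (ht : |t| < r) (x : E3) :
    HasFDerivAt (fun y => Ev f t (rad a y))
      ((Ev (dU f) t (rad a x) * (a * zet a x ^ 3)) • innerSL ℝ x) x := by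
  refine ((hf.hasDerivAt_u ht (abs_rad_lt ha x)).comp_hasFDerivAt x
    (hasFDerivAt_rad ha x)).congr_fderiv ?_
  rw [smul_smul]

lemma hasFDerivAt_rtz_mul_ev (ha : 0 < a) (hf : Conv r f) (ht : |t| < r) (x : E3) :
    HasFDerivAt (fun y => rtz a y * Ev f t (rad a y))
      ((rtz a x * (Ev (dU f) t (rad a x) * (a * zet a x ^ 3)
        - 1 / 2 * zet a x ^ 2 * Ev f t (rad a x))) • innerSL ℝ x) x := by
  refine HasFDerivAt.congr_fderiv (f := fun y => rtz a y * Ev f t (rad a y))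
    ((hasFDerivAt_rtz ha x).mul (hasFDerivAt_ev_rad ha hf ht x)) ?_
  ext z
  simp
  ring

lemma hasFDerivAt_coord_mul_ev (ha : 0 < a) (hf : Conv r f) (ht : |t| < r) (x : E3) (j : Fin 3) :
    HasFDerivAt (fun y : E3 => y j * zet a y ^ 3 * Ev f t (rad a y))
      ((x j * (zet a x ^ 3 * (Ev (dU f) t (rad a x) * (a * zet a x ^ 3))
        - 3 * zet a x ^ 5 * Ev f t (rad a x))) • innerSL ℝ x
        + (zet a x ^ 3 * Ev f t (rad a x)) • (EuclideanSpace.proj j : E3 →L[ℝ] ℝ)) x := by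
  refine HasFDerivAt.congr_fderiv (f := fun y : E3 => y j * zet a y ^ 3 * Ev f t (rad a y))
    (((hasFDerivAt_coord j x).mul ((hasFDerivAt_zet ha x).pow 3)).mul
      (hasFDerivAt_ev_rad ha hf ht x)) ?_
  ext z
  simp
  ring

lemma pd_rtz_mul_ev (ha : 0 < a) (hf : Conv r f) (ht : |t| < r) (x : E3) (i : Fin 3) :
    pd (fun y => rtz a y * Ev f t (rad a y)) i x = rtz a x * (Ev (dU f) t (rad a x)
      * (a * zet a x ^ 3) - 1 / 2 * zet a x ^ 2 * Ev f t (rad a x)) * x i := by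
  rw [pd_eq (hasFDerivAt_rtz_mul_ev ha hf ht x)]
  simp [innerSL_single]

lemma pd_coord_mul_ev (ha : 0 < a) (hf : Conv r f) (ht : |t| < r) (x : E3) (i j : Fin 3) :
    pd (fun y : E3 => y j * zet a y ^ 3 * Ev f t (rad a y)) i x
      = x j * (zet a x ^ 3 * (Ev (dU f) t (rad a x) * (a * zet a x ^ 3))
        - 3 * zet a x ^ 5 * Ev f t (rad a x)) * x i
        + if i = j then zet a x ^ 3 * Ev f t (rad a x) else 0 := by
  rw [pd_eq (hasFDerivAt_coord_mul_ev ha hf ht x j)]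
  simp [innerSL_single, eq_comm]

lemma norm_sq_eq_sum (x : E3) : ‖x‖ ^ 2 = x 0 ^ 2 + x 1 ^ 2 + x 2 ^ 2 := by
  rw [EuclideanSpace.norm_sq_eq, Fin.sum_univ_three]; simp

lemma SymS.contDiff {p : ℝ} {f : E3 → ℝ} (h : SymS p f) : ContDiff ℝ 1 f := by
  obtain ⟨B, hB⟩ := h 0
  exact hB.1.of_le (by exact_mod_cast le_top)

lemma SymS.exists_bound {p : ℝ} {f : E3 → ℝ} (h : SymS p f) :
    ∃ B, ∀ x, |f x| ≤ B * wt x ^ p ∧ ∀ i, |pd f i x| ≤ B * wt x ^ (p + 1) := by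
  obtain ⟨B, hB⟩ := h 1
  refine ⟨B, fun x => ⟨?_, fun i => (abs_pd_le f i x).trans ?_⟩⟩
  · have := hB.2 0 (by norm_num) x
    rw [norm_iteratedFDeriv_zero, Real.norm_eq_abs] at this
    rw [wt_rpow]
    simpa using this
  · have := hB.2 1 le_rfl x
    rw [norm_iteratedFDeriv_one] at this
    rw [wt_rpow]
    refine this.trans (le_of_eq ?_)
    congr 2
    push_cast; ring

/-- The potential generated by the radial profile. -/
lemma newtonPotential_radial (ha : 0 < a) {c : ℝ} {g F : DSeries} (hg : Conv r g) (ht0 : 0 ≤ t)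
    (ht : t < r)
    (hgF : ∀ u, |u| < 9 / 8 → u * (2 - u) * Ev (dU g) t u + 3 * (1 - u) * Ev g t u
      = 4 * π * c / a ^ 2 * (1 - u) * Ev F t u) :
    Differentiable ℝ (newtonPotential fun x => c * zet a x ^ 5 * Ev F t (rad a x)) ∧
    ∀ i x, pd (newtonPotential fun x => c * zet a x ^ 5 * Ev F t (rad a x)) i x
      = x i * zet a x ^ 3 * Ev g t (rad a x) := by
  have ht' : |t| < r := by rwa [abs_of_nonneg ht0]
  have hI := hg.intU
  set φ : E3 → ℝ := fun x => a⁻¹ * (Ev (intU g) t (rad a x) - Ev (intU g) t 1) with hφ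
  have hφd : ∀ x, HasFDerivAt φ ((zet a x ^ 3 * Ev g t (rad a x)) • innerSL ℝ x) x := by
    intro x
    refine (((hasFDerivAt_ev_rad ha hI ht' x).sub_const _).const_mul a⁻¹).congr_fderiv ?_
    rw [dU_intU, smul_smul]
    congr 1
    field_simp
  have hφpd : ∀ i x, pd φ i x = x i * zet a x ^ 3 * Ev g t (rad a x) := fun i x => by
    rw [pd_eq (hφd x)]
    simp [innerSL_single]; ring
  have hS : ∀ i, SymS 2 (fun x => x i * zet a x ^ 3 * Ev g t (rad a x)) := fun i =>
    symS_mul_ev (symS_coord_mul_zet_pow ha i) (symS_rad ha) (rad_mem_Icc ha) hg ht ⟨ht0, le_rfl⟩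
  choose B hB using fun i => (hS i).exists_bound
  obtain ⟨D, hD0, hD⟩ := hg.exists_bound ht0 ht
  obtain ⟨Z, hZ⟩ := (symS_zet ha).exists_bound
  have hφb : ∀ x, |φ x| ≤ D * Z * wt x := by
    intro x
    have h1 : ‖Ev (intU g) t (rad a x) - Ev (intU g) t 1‖ ≤ D * ‖rad a x - 1‖ := by
      refine (convex_Icc (-1 : ℝ) 1).norm_image_sub_le_of_norm_hasDerivWithin_le
        (f := Ev (intU g) t) (f' := Ev g t) (fun u hu => ?_) (fun u hu => ?_)
        (by constructor <;> norm_num) (rad_mem_Icc ha x)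
      · have := hI.hasDerivAt_u ht' (u := u) (by have := abs_le.2 hu; linarith)
        rw [dU_intU] at this
        exact this.hasDerivWithinAt
      · exact hD t u (abs_of_nonneg ht0).le (abs_le.2 hu)
    have h2 : ‖rad a x - 1‖ = a * zet a x := by
      rw [rad, Real.norm_eq_abs, sub_sub_cancel_left, abs_neg,
        abs_of_pos (mul_pos ha (zet_pos ha x))]
    have h3 := (hZ x).1
    rw [abs_of_pos (zet_pos ha x), Real.rpow_one] at h3
    rw [h2, Real.norm_eq_abs] at h1
    simp only [hφ]
    rw [abs_mul, abs_of_pos (inv_pos.2 ha)]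
    calc _ ≤ a⁻¹ * (D * (a * zet a x)) := by gcongr
      _ = D * zet a x := by field_simp
      _ ≤ D * (Z * wt x) := by gcongr
      _ = _ := by ring
  set C := |D * Z| + ∑ i, |B i| with hC
  have hBC : ∀ i, B i ≤ C := fun i => by
    have := Finset.single_le_sum (f := fun i => |B i|) (fun _ _ => abs_nonneg _) (Finset.mem_univ i)
    have h2 := le_abs_self (B i)
    have h3 := abs_nonneg (D * Z)
    linarith
  have hDC : D * Z ≤ C := by
    have : 0 ≤ ∑ i, |B i| := Finset.sum_nonneg fun _ _ => abs_nonneg _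
    linarith [le_abs_self (D * Z)]
  have key : (newtonPotential fun x => c * zet a x ^ 5 * Ev F t (rad a x)) = φ := by
    refine newtonPotential_eq (C := C) (fun x => (hφd x).differentiableAt) hφpd
      (fun i => (hS i).contDiff)
      (fun x => (hφb x).trans (mul_le_mul_of_nonneg_right hDC (wt_pos x).le)) (fun i x => ?_)
      (fun i x => ?_) (fun x => ?_)
    · have := ((hB i x).1).trans (mul_le_mul_of_nonneg_right (hBC i) (by have := wt_pos x; positivity))
      rw [← Real.rpow_natCast]; exact_mod_cast this
    · have := ((hB i x).2 i).trans
        (mul_le_mul_of_nonneg_right (hBC i) (by have := wt_pos x; positivity))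
      rw [← Real.rpow_natCast]
      norm_num at this ⊢
      exact this
    · simp only [pd_coord_mul_ev ha hg ht']
      rw [Fin.sum_univ_three]
      simp only [if_true]
      have h1 := hgF (rad a x) (abs_rad_lt ha x)
      have h2 := zet_sq_mul ha x
      have h3 := norm_sq_eq_sum x
      have e : rad a x * (2 - rad a x) = zet a x ^ 2 * ‖x‖ ^ 2 := by rw [h2, rad]; ring
      have e2 : 1 - rad a x = a * zet a x := by rw [rad]; ring
      rw [e, e2] at h1
      have h4 : a * zet a x ^ 6 * ‖x‖ ^ 2 * Ev (dU g) t (rad a x)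
          + 3 * a ^ 2 * zet a x ^ 5 * Ev g t (rad a x)
          = 4 * π * c * zet a x ^ 5 * Ev F t (rad a x) := by
        have : 4 * π * c / a ^ 2 * (a * zet a x) * Ev F t (rad a x) * (a * zet a x ^ 4)
            = 4 * π * c * zet a x ^ 5 * Ev F t (rad a x) := by field_simp
        rw [← this, ← h1]; ring
      rw [show 4 * π * (c * zet a x ^ 5 * Ev F t (rad a x))
        = 4 * π * c * zet a x ^ 5 * Ev F t (rad a x) by ring, ← h4]
      rw [h3] at h2 ⊢
      linear_combination (-3 * zet a x ^ 3 * Ev g t (rad a x)) * h2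
  rw [key]
  exact ⟨fun x => (hφd x).differentiableAt, hφpd⟩

end Profile

lemma cu_mul (p q : Polynomial ℝ) : cu (p * q) = cu p * cu q := by simp [cu]

lemma ev_zero {f : DSeries} {c : ℝ} (h : ∀ k, cf f 0 k = if k = 0 then c else 0) (u : ℝ) :
    Ev f 0 u = c := by
  unfold Ev
  rw [tsum_eq_single (0, 0)]
  · simp [h]
  · rintro ⟨n, k⟩ hnk
    rcases n with _ | n
    · have : k ≠ 0 := fun hk => hnk (by rw [hk])
      simp [h, this]
    · simp

section Existence

open Polynomial in
/-- The formal power series solution of the reduced system, with its radius of convergence. -/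
lemma exists_profiles (a : ℝ) (Q : ℝ) : ∃ r, 0 < r ∧ ∃ ω ν g R : DSeries,
    Conv r ω ∧ Conv r ν ∧ Conv r g ∧ Conv r R ∧ Conv r (ω ^ 10) ∧
    ω = cu 1 + cu (1 - X) * intT R ∧
    (∀ u, Ev ω 0 u = 1) ∧ (∀ u, Ev ν 0 u = 0) ∧
    (∀ t u, |t| < r → |u| < 9 / 8 → Ev (dT ω) t u =
      -(a⁻¹ ^ 3 * (1 - u) ^ 4 * (u * (2 - u))) * (Ev ν t u * Ev (dU ω) t u)
      + a⁻¹ ^ 3 * (1 - u) ^ 3 * (1 / 2 * (u * (2 - u)) - 1 / 10 * (3 - 3 * (u * (2 - u))))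
        * (Ev ν t u * Ev ω t u)
      - 1 / 10 * (a⁻¹ ^ 3 * (1 - u) ^ 4 * (u * (2 - u))) * (Ev ω t u * Ev (dU ν) t u)) ∧
    (∀ t u, |t| < r → |u| < 9 / 8 → Ev (dT ν) t u =
      -(a⁻¹ ^ 3 * (1 - u) ^ 3 * (1 - 3 * (u * (2 - u)))) * Ev ν t u ^ 2
      - a⁻¹ ^ 3 * (1 - u) ^ 4 * (u * (2 - u)) * (Ev ν t u * Ev (dU ν) t u)
      + 1 / 20 * Ev ω t u ^ 2 - 1 / 10 * (1 - u) * (Ev ω t u * Ev (dU ω) t u) - Ev g t u) ∧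
    (∀ t u, |t| < r → |u| < 9 / 8 → u * (2 - u) * Ev (dU g) t u + 3 * (1 - u) * Ev g t u
      = Q * (1 - u) * Ev (ω ^ 10) t u) ∧
    (∀ t u, |t| < r → |u| < 9 / 8 → Ev (ω ^ 10) t u = Ev ω t u ^ 10) := by
  set A₁ : ℝ[X] := C (-(a⁻¹ ^ 3)) * ((1 - X) ^ 3 * (X * (2 - X))) with hA₁
  set A₂ : ℝ[X] := C (a⁻¹ ^ 3) * ((1 - X) ^ 2 *
    (C (1 / 2) * (X * (2 - X)) - C (1 / 10) * (3 - 3 * (X * (2 - X))))) with hA₂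
  set A₃ : ℝ[X] := C (-(1 / 10) * a⁻¹ ^ 3) * ((1 - X) ^ 3 * (X * (2 - X))) with hA₃
  set B₁ : ℝ[X] := C (-(a⁻¹ ^ 3)) * ((1 - X) ^ 3 * (1 - 3 * (X * (2 - X)))) with hB₁
  set B₂ : ℝ[X] := C (-(a⁻¹ ^ 3)) * ((1 - X) ^ 4 * (X * (2 - X))) with hB₂
  obtain ⟨L, M, hL, hM, ω, ν, e1, e2, h1, h2, hω, hν⟩ := exists_formal_solution
    ((1 - X) * A₁) ((1 - X) * A₂) ((1 - X) * A₃) B₁ B₂ (C (1 / 20)) (C (-(1 / 10)) * (1 - X)) Q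
  have cω := hω.conv hL hM
  have cν := hν.conv hL hM
  have hp := hω.pow hL.le hM 9
  have cp := hp.conv hL (by positivity)
  have cg := (hp.gSol hL.le (by positivity) Q).conv hL (by positivity)
  set r := 1 / (10 * L) with hr
  have c1 := cν.mul cω.dU
  have c2 := cν.mul cω
  have c3 := cω.mul cν.dU
  have c4 := cν.mul cν
  have c5 := cν.mul cν.dU
  have c6 := cω.mul cω
  have c7 := cω.mul cω.dU
  have hc := fun p => Conv.cu r p
  refine ⟨r, by positivity, ω, ν, gSol Q (ω ^ 10),
    cu A₁ * (ν * dU ω) + cu A₂ * (ν * ω) + cu A₃ * (ω * dU ν), cω, cν, cg,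
    (((hc A₁).mul c1).add ((hc A₂).mul c2)).add ((hc A₃).mul c3), cp, ?_, ev_zero h1,
    ev_zero fun k => by rw [h2]; simp, ?_, ?_, ?_, ?_⟩
  · refine eq_one_add_of_dT_eq ?_ h1
    rw [e1, cu_mul _ A₁, cu_mul _ A₂, cu_mul _ A₃]
    ring
  · intro t u ht hu
    rw [e1, Ev_add (((hc _).mul c1).add ((hc _).mul c2)) ((hc _).mul c3) ht hu,
      Ev_add ((hc _).mul c1) ((hc _).mul c2) ht hu, Ev_mul (hc _) c1 ht hu, Ev_mul (hc _) c2 ht hu,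
      Ev_mul (hc _) c3 ht hu, Ev_mul cν cω.dU ht hu, Ev_mul cν cω ht hu, Ev_mul cω cν.dU ht hu,
      Ev_cu, Ev_cu, Ev_cu]
    simp only [hA₁, hA₂, hA₃, eval_mul, eval_sub, eval_pow, eval_X, eval_one, eval_C,
      eval_ofNat]
    ring
  · intro t u ht hu
    have d1 := (hc B₁).mul c4
    have d2 := (hc B₂).mul c5
    have d3 := (hc (C (1 / 20))).mul c6
    have d4 := (hc (C (-(1 / 10)) * (1 - X))).mul c7
    rw [e2, Ev_sub (((d1.add d2).add d3).add d4) cg ht hu, Ev_add ((d1.add d2).add d3) d4 ht hu,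
      Ev_add (d1.add d2) d3 ht hu, Ev_add d1 d2 ht hu, Ev_mul (hc _) c4 ht hu,
      Ev_mul (hc _) c5 ht hu, Ev_mul (hc _) c6 ht hu, Ev_mul (hc _) c7 ht hu, Ev_mul cν cν ht hu,
      Ev_mul cν cν.dU ht hu, Ev_mul cω cω ht hu, Ev_mul cω cω.dU ht hu, Ev_cu, Ev_cu, Ev_cu, Ev_cu]
    simp only [hB₁, hB₂, eval_mul, eval_sub, eval_pow, eval_X, eval_one, eval_C, eval_ofNat]
    ring
  · intro t u ht hu
    have := congrArg (Ev · t u) (gSol_equation Q (ω ^ 10))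
    rw [Ev_add ((hc _).mul cg.dU) ((hc _).mul cg) ht hu, Ev_mul (hc _) cg.dU ht hu,
      Ev_mul (hc _) cg ht hu, Ev_mul (hc _) cp ht hu, Ev_cu, Ev_cu, Ev_cu] at this
    simpa using this
  · intro t u ht hu
    exact Ev_pow cω ht hu 9

theorem exists_makino_solution (P : DyadicPartition) (K s δ a : ℝ) (hδ : δ < -1) (ha : 0 < a) :
    ∃ T : ℝ, 0 < T ∧ ∃ (w : ℝ → E3 → ℝ) (v : Fin 3 → ℝ → E3 → ℝ),
      MakinoClass P K (6 / 5) s δ T (fun x : E3 => (a ^ 2 + ‖x‖ ^ 2) ^ (-(1 / 4) : ℝ))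
        (fun _ _ => 0) w v := by
  set c := makinoConst K (6 / 5) with hc
  obtain ⟨r, hr, ω, ν, g, R, cω, cν, cg, cR, cp, hωR, hω0, hν0, eω, eν, eg, ep⟩ :=
    exists_profiles a (4 * π * c / a ^ 2)
  obtain ⟨D, hD0, hD⟩ := cω.exists_lipschitz (T := r / 2) (by positivity) (by linarith)
  set T := min (r / 2) (1 / (D + 1)) with hT
  have hTpos : 0 < T := by positivity
  have hTr2 : T ≤ r / 2 := min_le_left _ _
  have hTr : T < r := by linarith
  have hTD : D * T ≤ 1 := by
    calc D * T ≤ D * (1 / (D + 1)) := by gcongr; exact min_le_right _ _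
      _ ≤ 1 := by rw [mul_one_div, div_le_one (by positivity)]; linarith
  have hpos : ∀ t ∈ Icc 0 T, ∀ x, 0 ≤ Ev ω t (rad a x) := by
    intro t ht x
    have h1 := hD 0 t (rad a x) ⟨le_rfl, by positivity⟩ ⟨ht.1, ht.2.trans hTr2⟩
      (abs_le.2 (rad_mem_Icc ha x))
    rw [hω0, sub_zero, abs_of_nonneg ht.1] at h1
    have h2 : D * t ≤ D * T := by gcongr; exact ht.2
    have := (abs_le.1 h1).1
    linarith
  refine ⟨T, hTpos, fun t x => rtz a x * Ev ω t (rad a x),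
    fun i t x => x i * zet a x ^ 3 * Ev ν t (rad a x), ?_, ?_, ?_, ?_, ?_, ?_, ?_, ?_⟩
  · ext x; simp only [hω0, mul_one, rtz]
  · intro i; ext x; simp only [hν0, mul_zero]
  · intro t ht x
    have ht' := abs_lt_of_mem_Icc hTr ht
    have hu := abs_rad_lt ha x
    have hρ : makinoDensity K (6 / 5) (fun x => rtz a x * Ev ω t (rad a x))
        = fun x => c * zet a x ^ 5 * Ev (ω ^ 10) t (rad a x) := by
      ext y
      have e10 : (2 / (6 / 5 - 1) : ℝ) = ((10 : ℕ) : ℝ) := by norm_num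
      rw [makinoDensity, e10, Real.rpow_natCast, ep t _ ht' (abs_rad_lt ha y), ← rtz_sq ha]
      ring
    obtain ⟨hφd, hφpd⟩ := newtonPotential_radial ha (c := c) (F := ω ^ 10) cg ht.1
      (ht.2.trans_lt hTr) fun u hu => eg t u ht' hu
    have hz := zet_sq_mul ha x
    have hn := norm_sq_eq_sum x
    have e : rad a x * (2 - rad a x) = zet a x ^ 2 * ‖x‖ ^ 2 := by rw [hz, rad]; ring
    have e2 : 1 - rad a x = a * zet a x := by rw [rad]; ring
    have e3 : a⁻¹ ^ 3 * (a * zet a x) ^ 3 = zet a x ^ 3 := by field_simp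
    have e4 : a⁻¹ ^ 3 * (a * zet a x) ^ 4 = a * zet a x ^ 4 := by field_simp
    have f1 := eω t (rad a x) ht' hu
    have f2 := eν t (rad a x) ht' hu
    rw [e, e2, e3, e4] at f1 f2
    rw [hn] at f1 f2 hz
    refine ⟨(hasFDerivAt_rtz_mul_ev ha cω ht' x).differentiableAt,
      fun i => (hasFDerivAt_coord_mul_ev ha cν ht' x i).differentiableAt, ?_, ?_, ?_⟩
    · rw [hρ]; exact hφd x
    · refine ⟨rtz a x * Ev (dT ω) t (rad a x),
        ((cω.hasDerivAt_t ht' hu).const_mul _).hasDerivWithinAt, ?_⟩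
      simp only [pd_rtz_mul_ev ha cω ht', pd_coord_mul_ev ha cν ht', Fin.sum_univ_three, if_true, f1]
      ring
    · intro i
      refine ⟨x i * zet a x ^ 3 * Ev (dT ν) t (rad a x),
        ((cν.hasDerivAt_t ht' hu).const_mul _).hasDerivWithinAt, ?_⟩
      rw [hρ, hφpd]
      simp only [pd_rtz_mul_ev ha cω ht', pd_coord_mul_ev ha cν ht', f2]
      have hrt := rtz_sq ha x
      have hsum : ∑ b : Fin 3, x b * zet a x ^ 3 * Ev ν t (rad a x) *
          (x i * (zet a x ^ 3 * (Ev (dU ν) t (rad a x) * (a * zet a x ^ 3))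
            - 3 * zet a x ^ 5 * Ev ν t (rad a x)) * x b
            + if b = i then zet a x ^ 3 * Ev ν t (rad a x) else 0)
          = x i * zet a x ^ 3 * Ev ν t (rad a x) *
            ((x 0 ^ 2 + x 1 ^ 2 + x 2 ^ 2) *
              (zet a x ^ 3 * (Ev (dU ν) t (rad a x) * (a * zet a x ^ 3))
              - 3 * zet a x ^ 5 * Ev ν t (rad a x)) + zet a x ^ 3 * Ev ν t (rad a x)) := by
        rw [Fin.sum_univ_three]
        fin_cases i <;> simp <;> ring
      rw [hsum]
      linear_combination (1 / 10 * Ev ω t (rad a x) * (Ev (dU ω) t (rad a x)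
      * (a * zet a x ^ 3) - 1 / 2 * zet a x ^ 2 * Ev ω t (rad a x)) * x i) * hrt
  · exact hContOn_mul_ev P s (by norm_num) (by linarith) (symS_rtz ha) (symS_rad ha)
      (rad_mem_Icc ha) cω hTpos.le hTr
  · exact fun i => hContOn_mul_ev P s (by norm_num) (by linarith) (symS_coord_mul_zet_pow ha i)
      (symS_rad ha) (rad_mem_Icc ha) cν hTpos.le hTr
  · refine HC1On.congr_sub (hC1On_mul_ev P (s - 1) (δ := δ + 1) (by norm_num) (by linarith)
      (symS_mul_rtz_zet ha) (symS_rad ha) (rad_mem_Icc ha) cR.intT hTpos.le hTr) ?_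
    have key : ∀ t ∈ Icc 0 T, ∀ x, Ev ω t (rad a x)
        = 1 + a * zet a x * Ev (intT R) t (rad a x) := by
      intro t ht x
      have ht' := abs_lt_of_mem_Icc hTr ht
      have hu := abs_rad_lt ha x
      have hcu := fun p => Conv.cu r p
      conv_lhs => rw [hωR]
      rw [Ev_add (hcu _) ((hcu _).mul cR.intT) ht' hu, Ev_mul (hcu _) cR.intT ht' hu, Ev_cu, Ev_cu]
      simp [rad]
    intro t ht t' ht' x
    rw [key t ht, key t' ht']
    ring
  · exact fun i => hC1On_mul_ev P (s - 1) (δ := δ + 1) (by norm_num) (by linarith)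
      (symS_coord_mul_zet_pow ha i) (symS_rad ha) (rad_mem_Icc ha) cν hTpos.le hTr
  · intro t ht x
    exact mul_nonneg (rtz_pos ha x).le (hpos t ht x)

end Existence

lemma integral_rpow_mul_fourier_le {s : ℝ} {f : E3 → ℂ}
    (hfi : Integrable f) (hf : HsNormSq s f < ⊤) (hs : 5 / 2 < s) :
    Integrable (fun ξ : E3 => (1 + ‖ξ‖ ^ 2) ^ (1 / 2 : ℝ) * ‖𝓕 f ξ‖) ∧
      ∫ ξ : E3, (1 + ‖ξ‖ ^ 2) ^ (1 / 2 : ℝ) * ‖𝓕 f ξ‖ ≤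
        √(∫ ξ : E3, (1 + ‖ξ‖ ^ 2) ^ (1 - s)) * √(HsNormSq s f).toReal := by
  have hF : Continuous (𝓕 f) := VectorFourier.fourierIntegral_continuous
    Real.continuous_fourierChar (by exact continuous_inner) hfi
  have h1 (ξ : E3) : 0 < 1 + ‖ξ‖ ^ 2 := by positivity
  have hc (r : ℝ) : Continuous fun ξ : E3 => (1 + ‖ξ‖ ^ 2) ^ r :=
    Continuous.rpow_const (by fun_prop) fun ξ => Or.inl (h1 ξ).ne'
  have hA : Integrable (fun ξ : E3 => (1 + ‖ξ‖ ^ 2) ^ (1 - s)) := by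
    have := integrable_rpow_neg_one_add_norm_sq (E := E3) (μ := volume) (r := 2 * s - 2)
      (by simp; linarith)
    refine this.congr (Filter.Eventually.of_forall fun ξ => ?_)
    show (1 + ‖ξ‖ ^ 2) ^ (-(2 * s - 2) / 2) = _
    congr 1; ring
  set g : E3 → ℝ≥0∞ := fun ξ => ENNReal.ofReal ((1 + ‖ξ‖ ^ 2) ^ ((1 - s) / 2))
  set h : E3 → ℝ≥0∞ := fun ξ => ENNReal.ofReal ((1 + ‖ξ‖ ^ 2) ^ (s / 2)) * (‖𝓕 f ξ‖₊ : ℝ≥0∞)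
  have hgm : Measurable g := (hc _).measurable.ennreal_ofReal
  have hhm : Measurable h := (hc _).measurable.ennreal_ofReal.mul hF.nnnorm.measurable.coe_nnreal_ennreal
  have hmul (ξ : E3) : (g * h) ξ = ENNReal.ofReal ((1 + ‖ξ‖ ^ 2) ^ (1 / 2 : ℝ) * ‖𝓕 f ξ‖) := by
    simp only [Pi.mul_apply, g, h]
    rw [← mul_assoc, ← ENNReal.ofReal_mul (by positivity), ← Real.rpow_add (h1 ξ),
      ENNReal.ofReal_mul (by positivity), ofReal_norm, enorm_eq_nnnorm]
    congr 3; ring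
  have hg2 : ∫⁻ ξ, g ξ ^ (2 : ℝ) = ENNReal.ofReal (∫ ξ : E3, (1 + ‖ξ‖ ^ 2) ^ (1 - s)) := by
    rw [ofReal_integral_eq_lintegral_ofReal hA
      (Filter.Eventually.of_forall fun ξ => by simp only [Pi.zero_apply]; positivity)]
    congr 1; funext ξ
    simp only [g]
    rw [ENNReal.ofReal_rpow_of_nonneg (by positivity) (by norm_num), ← Real.rpow_mul (h1 ξ).le]
    congr 2; ring
  have hh2 : ∫⁻ ξ, h ξ ^ (2 : ℝ) = HsNormSq s f := by
    unfold HsNormSq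
    congr 1; funext ξ
    simp only [h]
    rw [ENNReal.mul_rpow_of_nonneg _ _ (by norm_num),
      ENNReal.ofReal_rpow_of_nonneg (by positivity) (by norm_num), ← Real.rpow_mul (h1 ξ).le,
      ENNReal.rpow_two]
    congr 3; ring
  have hH := ENNReal.lintegral_mul_le_Lp_mul_Lq volume
    (Real.HolderConjugate.two_two : Real.HolderConjugate 2 2) hgm.aemeasurable hhm.aemeasurable
  rw [hg2, hh2] at hH
  simp only [hmul] at hH
  set A := ∫ ξ : E3, (1 + ‖ξ‖ ^ 2) ^ (1 - s)
  have hA0 : 0 ≤ A := integral_nonneg fun ξ => by simp only [Pi.zero_apply]; positivity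
  have hR : ENNReal.ofReal A ^ (1 / (2 : ℝ)) * HsNormSq s f ^ (1 / (2 : ℝ)) =
      ENNReal.ofReal (√A * √(HsNormSq s f).toReal) := by
    conv_lhs => rw [← ENNReal.ofReal_toReal hf.ne]
    rw [ENNReal.ofReal_rpow_of_nonneg hA0 (by norm_num),
      ENNReal.ofReal_rpow_of_nonneg (by positivity) (by norm_num), ← ENNReal.ofReal_mul (by positivity),
      Real.sqrt_eq_rpow, Real.sqrt_eq_rpow]
  rw [hR] at hH
  have hm : Continuous (fun ξ : E3 => (1 + ‖ξ‖ ^ 2) ^ (1 / 2 : ℝ) * ‖𝓕 f ξ‖) := (hc _).mul hF.norm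
  have hnn (ξ : E3) : 0 ≤ (1 + ‖ξ‖ ^ 2) ^ (1 / 2 : ℝ) * ‖𝓕 f ξ‖ := by positivity
  refine ⟨⟨hm.aestronglyMeasurable, ?_⟩, ?_⟩
  · rw [hasFiniteIntegral_iff_ofReal (Filter.Eventually.of_forall hnn)]
    exact hH.trans_lt ENNReal.ofReal_lt_top
  · rw [integral_eq_lintegral_of_nonneg_ae (Filter.Eventually.of_forall hnn) hm.aestronglyMeasurable]
    exact ENNReal.toReal_le_of_le_ofReal (by positivity) hH

lemma exists_sobolev_bound {s : ℝ} (hs : 5 / 2 < s) : ∃ C : ℝ, 0 ≤ C ∧ ∀ f : E3 → ℂ,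
    Continuous f → Integrable f → HsNormSq s f < ⊤ →
    (∀ y, ‖f y‖ ≤ C * √(HsNormSq s f).toReal) ∧
    ∀ y z, ‖f y - f z‖ ≤ C * √(HsNormSq s f).toReal * ‖y - z‖ := by
  refine ⟨2 * π * √(∫ ξ : E3, (1 + ‖ξ‖ ^ 2) ^ (1 - s)), by positivity, fun f hfc hfi hf => ?_⟩
  obtain ⟨hG, hGle⟩ := integral_rpow_mul_fourier_le hfi hf hs
  set G : E3 → ℝ := fun ξ => (1 + ‖ξ‖ ^ 2) ^ (1 / 2 : ℝ) * ‖𝓕 f ξ‖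
  have hF : Continuous (𝓕 f) := VectorFourier.fourierIntegral_continuous
    Real.continuous_fourierChar (by exact continuous_inner) hfi
  have h1 (ξ : E3) : 1 ≤ (1 + ‖ξ‖ ^ 2) ^ (1 / 2 : ℝ) :=
    Real.one_le_rpow (by linarith [sq_nonneg ‖ξ‖]) (by norm_num)
  have h2 (ξ : E3) : ‖ξ‖ ≤ (1 + ‖ξ‖ ^ 2) ^ (1 / 2 : ℝ) := by
    rw [← Real.sqrt_eq_rpow]
    exact Real.le_sqrt_of_sq_le (by linarith)
  have hFG (ξ : E3) : ‖𝓕 f ξ‖ ≤ G ξ := le_mul_of_one_le_left (norm_nonneg _) (h1 ξ)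
  have hFi : Integrable (𝓕 f) := hG.mono' hF.aestronglyMeasurable (Filter.Eventually.of_forall hFG)
  have hinv := Continuous.fourierInv_fourier_eq hfc hfi hFi
  have hrep (y : E3) : f y = ∫ v : E3, Complex.exp (↑(2 * π * inner ℝ v y) * Complex.I) • 𝓕 f v := by
    rw [← Real.fourierInv_eq', hinv]
  have hei (y : E3) : Integrable fun v : E3 =>
      Complex.exp (↑(2 * π * inner ℝ v y) * Complex.I) • 𝓕 f v := by
    refine hFi.norm.mono' (Continuous.aestronglyMeasurable (by fun_prop))
      (Filter.Eventually.of_forall fun v => ?_)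
    rw [norm_smul, Complex.norm_exp_ofReal_mul_I, one_mul]
  have hG0 : 0 ≤ ∫ ξ, G ξ := integral_nonneg fun ξ => by simp only [Pi.zero_apply, G]; positivity
  have hpi : 1 ≤ 2 * π := by linarith [Real.pi_gt_three]
  constructor
  · intro y
    calc ‖f y‖ ≤ ∫ v, ‖𝓕 f v‖ := by
          rw [hrep y]
          refine (norm_integral_le_integral_norm _).trans (le_of_eq ?_)
          congr 1; funext v
          rw [norm_smul, Complex.norm_exp_ofReal_mul_I, one_mul]
      _ ≤ ∫ v, G v := integral_mono hFi.norm hG hFG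
      _ ≤ 2 * π * ∫ v, G v := le_mul_of_one_le_left hG0 hpi
      _ ≤ _ := (mul_le_mul_of_nonneg_left hGle (by positivity)).trans_eq (by ring)
  · intro y z
    have hpt (v : E3) : ‖Complex.exp (↑(2 * π * inner ℝ v y) * Complex.I) • 𝓕 f v -
        Complex.exp (↑(2 * π * inner ℝ v z) * Complex.I) • 𝓕 f v‖ ≤
        2 * π * ‖y - z‖ * G v := by
      have e : Complex.exp (↑(2 * π * inner ℝ v y) * Complex.I) -
          Complex.exp (↑(2 * π * inner ℝ v z) * Complex.I) =
          Complex.exp (↑(2 * π * inner ℝ v z) * Complex.I) *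
            (Complex.exp (Complex.I * ↑(2 * π * inner ℝ v (y - z))) - 1) := by
        rw [mul_sub, ← Complex.exp_add, mul_one]
        congr 2
        rw [inner_sub_right]; push_cast; ring
      rw [← sub_smul, e, norm_smul, norm_mul, Complex.norm_exp_ofReal_mul_I, one_mul]
      have h3 : ‖Complex.exp (Complex.I * ↑(2 * π * inner ℝ v (y - z))) - 1‖ ≤
          2 * π * (‖v‖ * ‖y - z‖) := by
        refine Real.norm_exp_I_mul_ofReal_sub_one_le.trans ?_
        rw [norm_mul, Real.norm_of_nonneg (by positivity : (0:ℝ) ≤ 2 * π)]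
        gcongr
        exact norm_inner_le_norm v (y - z)
      calc _ ≤ 2 * π * (‖v‖ * ‖y - z‖) * ‖𝓕 f v‖ := by gcongr
        _ ≤ 2 * π * ((1 + ‖v‖ ^ 2) ^ (1 / 2 : ℝ) * ‖y - z‖) * ‖𝓕 f v‖ := by
          gcongr; exact h2 v
        _ = _ := by simp only [G]; ring
    calc ‖f y - f z‖ ≤ ∫ v, 2 * π * ‖y - z‖ * G v := by
          rw [hrep y, hrep z, ← integral_sub (hei y) (hei z)]
          exact norm_integral_le_of_norm_le (hG.const_mul _) (Filter.Eventually.of_forall hpt)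
      _ = 2 * π * ‖y - z‖ * ∫ v, G v := integral_const_mul _ _
      _ ≤ 2 * π * ‖y - z‖ * (√(∫ ξ : E3, (1 + ‖ξ‖ ^ 2) ^ (1 - s)) * √(HsNormSq s f).toReal) := by
          gcongr
      _ = _ := by ring

/-- The rescaled dyadic piece `(ψ_j u)_{2^j}`. -/
def piece (P : DyadicPartition) (j : ℕ) (u : E3 → ℝ) (x : E3) : ℂ :=
  ((P.ψ j (((2:ℝ) ^ (j:ℕ)) • x) * u (((2:ℝ) ^ (j:ℕ)) • x) : ℝ) : ℂ)

lemma exists_psi_eq_one (P : DyadicPartition) (x : E3) :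
    ∃ j : ℕ, P.ψ j x = 1 ∧ ‖x‖ ≤ (2 : ℝ) ^ j := by
  classical
  have hex : ∃ j : ℕ, ‖x‖ ≤ (2 : ℝ) ^ j :=
    (pow_unbounded_of_one_lt ‖x‖ one_lt_two).imp fun _ h => h.le
  refine ⟨Nat.find hex, ?_, Nat.find_spec hex⟩
  have hsp := Nat.find_spec hex
  rcases h : Nat.find hex with _ | k
  · rw [h] at hsp
    exact P.one_zero x (by simpa using hsp)
  · rw [h] at hsp
    have hk := Nat.find_min hex (show k < Nat.find hex by omega)
    refine P.one_succ (k + 1) (by omega) x ?_ (by exact_mod_cast hsp)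
    push Not at hk
    have : ((k + 1 : ℕ) : ℤ) - 1 = k := by push_cast; ring
    rw [this]
    exact_mod_cast hk.le

lemma continuous_piece (P : DyadicPartition) (j : ℕ) {u : E3 → ℝ} (hu : Continuous u) :
    Continuous (piece P j u) := by
  have := (P.smooth j).continuous
  unfold piece
  fun_prop

lemma hasCompactSupport_piece (P : DyadicPartition) (j : ℕ) (u : E3 → ℝ) :
    HasCompactSupport (piece P j u) := by
  have h := (P.compSupp j).comp_homeomorph (Homeomorph.smulOfNeZero ((2:ℝ) ^ j) (by positivity))
  refine h.mono fun x hx => ?_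
  simp only [piece, Function.mem_support, ne_eq, Complex.ofReal_eq_zero, mul_eq_zero, not_or] at hx
  simpa using hx.1

lemma integrable_piece (P : DyadicPartition) (j : ℕ) {u : E3 → ℝ} (hu : Continuous u) :
    Integrable (piece P j u) :=
  (continuous_piece P j hu).integrable_of_hasCompactSupport (hasCompactSupport_piece P j u)

lemma HsNormSq_piece_le (P : DyadicPartition) {s δ : ℝ} (j : ℕ) {u : E3 → ℝ}
    (hu : HwNormSq P s δ u < ⊤) : HsNormSq s (piece P j u) < ⊤ ∧
    √(HsNormSq s (piece P j u)).toReal ≤ ((2 : ℝ) ^ j)⁻¹ ^ (δ + 3 / 2) * Hnorm P s δ u := by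
  have hle : ENNReal.ofReal ((2:ℝ) ^ ((3 + 2 * δ) * (j:ℝ))) * HsNormSq s (piece P j u) ≤
    HwNormSq P s δ u := ENNReal.le_tsum j
  have hp : 0 < (2:ℝ) ^ ((3 + 2 * δ) * (j:ℝ)) := by positivity
  have hlt : HsNormSq s (piece P j u) < ⊤ := by
    by_contra hcon
    rw [not_lt, top_le_iff] at hcon
    rw [hcon, ENNReal.mul_top (by simpa using hp)] at hle
    exact absurd (hle.trans_lt hu) (lt_irrefl _)
  refine ⟨hlt, ?_⟩
  have h2 := ENNReal.toReal_mono hu.ne hle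
  rw [ENNReal.toReal_mul, ENNReal.toReal_ofReal hp.le] at h2
  have h3 : (HsNormSq s (piece P j u)).toReal ≤
      (((2 : ℝ) ^ j)⁻¹ ^ (δ + 3 / 2)) ^ 2 * (HwNormSq P s δ u).toReal := by
    have e : (((2 : ℝ) ^ j)⁻¹ ^ (δ + 3 / 2)) ^ 2 = ((2:ℝ) ^ ((3 + 2 * δ) * (j:ℝ)))⁻¹ := by
      rw [← Real.rpow_natCast 2 j, ← Real.rpow_neg two_pos.le, ← Real.rpow_mul two_pos.le,
        ← Real.rpow_natCast, ← Real.rpow_mul two_pos.le, ← Real.rpow_neg two_pos.le]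
      congr 1; push_cast; ring
    rw [e, inv_mul_eq_div, le_div_iff₀ hp, mul_comm]
    exact h2
  calc _ ≤ √((((2 : ℝ) ^ j)⁻¹ ^ (δ + 3 / 2)) ^ 2 * (HwNormSq P s δ u).toReal) := Real.sqrt_le_sqrt h3
    _ = _ := by rw [Real.sqrt_mul (by positivity), Real.sqrt_sq (by positivity), Hnorm]

lemma exists_embedding (P : DyadicPartition) {s δ : ℝ} (hs : 5 / 2 < s) (hδ : 0 ≤ δ + 3 / 2) :
    ∃ C : ℝ, 0 ≤ C ∧ ∀ u : E3 → ℝ, Differentiable ℝ u → HwNormSq P s δ u < ⊤ → ∀ x,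
      |u x| ≤ C * Hnorm P s δ u * wt x ^ (δ + 3 / 2) ∧ ‖fderiv ℝ u x‖ ≤ C * Hnorm P s δ u := by
  obtain ⟨C₀, hC₀, hsob⟩ := exists_sobolev_bound hs
  obtain ⟨C₁, hC₁⟩ := P.deriv_bound 1
  have hψ (j : ℕ) (x : E3) : ‖fderiv ℝ (P.ψ j) x‖ ≤ |C₁| := by
    rw [← norm_iteratedFDeriv_one]
    refine (hC₁ j x).trans ?_
    have : (2:ℝ) ^ (-((1:ℕ):ℤ) * (j:ℤ)) ≤ 1 := zpow_le_one_of_nonpos₀ one_le_two (by simp)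
    have h0 : 0 < (2:ℝ) ^ (-((1:ℕ):ℤ) * (j:ℤ)) := by positivity
    nlinarith [le_abs_self C₁, abs_nonneg C₁]
  refine ⟨C₀ * 2 ^ (δ + 3 / 2) * (1 + |C₁|), by positivity, fun u hu hfin x => ?_⟩
  obtain ⟨j, hj, hxj⟩ := exists_psi_eq_one P x
  obtain ⟨hlt, hle⟩ := HsNormSq_piece_le P j hfin
  obtain ⟨hsup, hlip⟩ := hsob _ (continuous_piece P j hu.continuous)
    (integrable_piece P j hu.continuous) hlt
  set N := Hnorm P s δ u
  have hN : 0 ≤ N := Real.sqrt_nonneg _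
  set q : ℝ := ((2 : ℝ) ^ j)⁻¹ ^ (δ + 3 / 2)
  have h2j : 0 < (2:ℝ) ^ j := by positivity
  have hw0 := wt_pos x
  have hq : q ≤ 2 ^ (δ + 3 / 2) * wt x ^ (δ + 3 / 2) := by
    rw [← Real.mul_rpow two_pos.le hw0.le]
    refine Real.rpow_le_rpow (by positivity) ?_ hδ
    rw [wt, ← div_eq_mul_inv, le_div_iff₀ (by positivity), inv_mul_le_iff₀ h2j]
    linarith [one_le_pow₀ (one_le_two : (1:ℝ) ≤ 2) (n := j)]
  have hval (z : E3) : piece P j u (((2:ℝ) ^ j)⁻¹ • z) = ((P.ψ j z * u z : ℝ) : ℂ) := by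
    simp only [piece, smul_inv_smul₀ h2j.ne']
  have hux : |u x| ≤ C₀ * q * N := by
    have := hsup (((2:ℝ) ^ j)⁻¹ • x)
    rw [hval, hj, one_mul, Complex.norm_real, Real.norm_eq_abs] at this
    calc _ ≤ _ := this
      _ ≤ C₀ * (q * N) := by gcongr
      _ = _ := by ring
  have hwr : wt x ^ (δ + 3 / 2) ≤ 1 := Real.rpow_le_one hw0.le (wt_le_one x) hδ
  have hwp : 0 < wt x ^ (δ + 3 / 2) := by positivity
  have h2p : 0 < (2 : ℝ) ^ (δ + 3 / 2) := by positivity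
  have hux' : |u x| ≤ C₀ * 2 ^ (δ + 3 / 2) * N * wt x ^ (δ + 3 / 2) := by
    calc _ ≤ _ := hux
      _ ≤ C₀ * (2 ^ (δ + 3 / 2) * wt x ^ (δ + 3 / 2)) * N := by gcongr
      _ = _ := by ring
  constructor
  · refine hux'.trans ?_
    have h : C₀ * 2 ^ (δ + 3 / 2) * N * wt x ^ (δ + 3 / 2) * 1 ≤
      C₀ * 2 ^ (δ + 3 / 2) * N * wt x ^ (δ + 3 / 2) * (1 + |C₁|) := by
      gcongr; linarith [abs_nonneg C₁]
    linarith
  · have hpd : DifferentiableAt ℝ (P.ψ j) x := (P.smooth j).differentiable (by simp) x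
    have hd : HasFDerivAt (fun z => P.ψ j z * u z)
        (P.ψ j x • fderiv ℝ u x + u x • fderiv ℝ (P.ψ j) x) x :=
      hpd.hasFDerivAt.mul (hu x).hasFDerivAt
    have hL : ‖P.ψ j x • fderiv ℝ u x + u x • fderiv ℝ (P.ψ j) x‖ ≤ C₀ * 2 ^ (δ + 3 / 2) * N := by
      refine hd.le_of_lip' (by positivity) (Filter.Eventually.of_forall fun z => ?_)
      have h := hlip (((2:ℝ) ^ j)⁻¹ • z) (((2:ℝ) ^ j)⁻¹ • x)
      rw [hval, hval, ← Complex.ofReal_sub, Complex.norm_real, ← smul_sub, norm_smul] at h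
      have h1 : ‖((2:ℝ) ^ j)⁻¹‖ ≤ 1 := by
        rw [norm_inv, norm_pow, Real.norm_ofNat]
        exact inv_le_one_of_one_le₀ (one_le_pow₀ one_le_two)
      calc _ ≤ _ := h
        _ ≤ C₀ * (q * N) * (1 * ‖z - x‖) := by gcongr
        _ ≤ C₀ * ((2 ^ (δ + 3 / 2) * wt x ^ (δ + 3 / 2)) * N) * (1 * ‖z - x‖) := by gcongr
        _ ≤ C₀ * ((2 ^ (δ + 3 / 2) * 1) * N) * (1 * ‖z - x‖) := by gcongr
        _ = _ := by ring
    rw [hj, one_smul] at hL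
    have h3 : ‖fderiv ℝ u x‖ ≤ C₀ * 2 ^ (δ + 3 / 2) * N + |u x| * |C₁| := by
      have e : fderiv ℝ u x = (fderiv ℝ u x + u x • fderiv ℝ (P.ψ j) x) - u x • fderiv ℝ (P.ψ j) x := by
        abel
      rw [e]
      refine (norm_sub_le _ _).trans (add_le_add hL ?_)
      rw [norm_smul, Real.norm_eq_abs]
      gcongr
      exact hψ j x
    have h4 : |u x| ≤ C₀ * 2 ^ (δ + 3 / 2) * N := hux'.trans (mul_le_of_le_one_right (by positivity) hwr)
    nlinarith [abs_nonneg C₁]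

lemma HsNormSq_sub_le (s : ℝ) {f g : E3 → ℂ} (hf : Integrable f) (hg : Integrable g) :
    HsNormSq s (fun x => f x - g x) ≤ 2 * HsNormSq s f + 2 * HsNormSq s g := by
  have hF : Continuous (𝓕 f) := VectorFourier.fourierIntegral_continuous
    Real.continuous_fourierChar (by exact continuous_inner) hf
  have hG : Continuous (𝓕 g) := VectorFourier.fourierIntegral_continuous
    Real.continuous_fourierChar (by exact continuous_inner) hg
  have hlin : 𝓕 (fun x => f x - g x) = fun ξ => 𝓕 f ξ - 𝓕 g ξ := by
    funext ξ
    simp only [Real.fourier_eq]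
    rw [← integral_sub]
    · simp only [smul_sub]
    · exact (Real.fourierIntegral_convergent_iff ξ).2 hf
    · exact (Real.fourierIntegral_convergent_iff ξ).2 hg
  have hc : Continuous fun ξ : E3 => (1 + ‖ξ‖ ^ 2) ^ s :=
    Continuous.rpow_const (by fun_prop) fun ξ => Or.inl (by positivity)
  unfold HsNormSq
  rw [hlin, ← lintegral_const_mul _ (by fun_prop), ← lintegral_const_mul _ (by fun_prop),
    ← lintegral_add_left (by fun_prop)]
  refine lintegral_mono fun ξ => ?_
  have hn : ((‖𝓕 f ξ - 𝓕 g ξ‖₊ : ℝ≥0∞)) ^ 2 ≤ 2 * (‖𝓕 f ξ‖₊ : ℝ≥0∞) ^ 2 + 2 * (‖𝓕 g ξ‖₊ : ℝ≥0∞) ^ 2 := by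
    have : ‖𝓕 f ξ - 𝓕 g ξ‖₊ ^ 2 ≤ 2 * ‖𝓕 f ξ‖₊ ^ 2 + 2 * ‖𝓕 g ξ‖₊ ^ 2 := by
      rw [← NNReal.coe_le_coe]
      push_cast
      have h1 := norm_sub_le (𝓕 f ξ) (𝓕 g ξ)
      nlinarith [norm_nonneg (𝓕 f ξ - 𝓕 g ξ), sq_nonneg (‖𝓕 f ξ‖ - ‖𝓕 g ξ‖)]
    exact_mod_cast this
  calc _ ≤ ENNReal.ofReal ((1 + ‖ξ‖ ^ 2) ^ s) *
        (2 * (‖𝓕 f ξ‖₊ : ℝ≥0∞) ^ 2 + 2 * (‖𝓕 g ξ‖₊ : ℝ≥0∞) ^ 2) := by gcongr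
    _ = _ := by ring

lemma HwNormSq_sub_lt_top (P : DyadicPartition) {s δ : ℝ} {u v : E3 → ℝ} (hu : Continuous u)
    (hv : Continuous v) (hu' : HwNormSq P s δ u < ⊤) (hv' : HwNormSq P s δ v < ⊤) :
    HwNormSq P s δ (fun x => u x - v x) < ⊤ := by
  have hle : HwNormSq P s δ (fun x => u x - v x) ≤ 2 * HwNormSq P s δ u + 2 * HwNormSq P s δ v := by
    unfold HwNormSq
    rw [← ENNReal.tsum_mul_left, ← ENNReal.tsum_mul_left, ← ENNReal.tsum_add]
    refine ENNReal.tsum_le_tsum fun j => ?_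
    have e : (fun x : E3 => ((P.ψ j (((2:ℝ) ^ j) • x) *
        (u (((2:ℝ) ^ j) • x) - v (((2:ℝ) ^ j) • x)) : ℝ) : ℂ)) =
        fun x => piece P j u x - piece P j v x := by
      funext x; simp only [piece]; push_cast; ring
    rw [e]
    calc _ ≤ ENNReal.ofReal ((2:ℝ) ^ ((3 + 2 * δ) * (j:ℝ))) *
          (2 * HsNormSq s (piece P j u) + 2 * HsNormSq s (piece P j v)) := by
            gcongr
            exact HsNormSq_sub_le s (integrable_piece P j hu) (integrable_piece P j hv)
      _ = _ := by unfold piece; ring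
  exact hle.trans_lt (ENNReal.add_lt_top.2 ⟨ENNReal.mul_lt_top (by simp) hu', ENNReal.mul_lt_top (by simp) hv'⟩)

lemma HContOn.exists_bound {P : DyadicPartition} {s δ T : ℝ} (hs : 5 / 2 < s) (hδ : -23 / 18 < δ)
    {u : ℝ → E3 → ℝ} (hu : HContOn P s δ T u)
    (hd : ∀ t ∈ Icc (0:ℝ) T, Differentiable ℝ (u t)) :
    ∃ M : ℝ, 0 ≤ M ∧ ∀ t ∈ Icc (0:ℝ) T, ∀ x, |u t x| ≤ M * wt x ^ (2 / 9 : ℝ) ∧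
      ‖fderiv ℝ (u t) x‖ ≤ M := by
  obtain ⟨C, hC, hemb⟩ := exists_embedding P (δ := δ) hs (by linarith)
  have hN (w : E3 → ℝ) : 0 ≤ Hnorm P s δ w := Real.sqrt_nonneg _
  have hemb' (w : E3 → ℝ) (hw : Differentiable ℝ w) (hf : HwNormSq P s δ w < ⊤) (x : E3) :
      |w x| ≤ C * Hnorm P s δ w * wt x ^ (2 / 9 : ℝ) ∧ ‖fderiv ℝ w x‖ ≤ C * Hnorm P s δ w := by
    refine ⟨(hemb w hw hf x).1.trans ?_, (hemb w hw hf x).2⟩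
    have := hN w
    exact mul_le_mul_of_nonneg_left
      (Real.rpow_le_rpow_of_exponent_ge (wt_pos x) (wt_le_one x) (by linarith)) (by positivity)
  have key := IsCompact.induction_on (isCompact_Icc (a := (0:ℝ)) (b := T))
    (p := fun S => ∃ M : ℝ, 0 ≤ M ∧ ∀ t ∈ S ∩ Icc (0:ℝ) T, ∀ x, |u t x| ≤ M * wt x ^ (2 / 9 : ℝ) ∧
      ‖fderiv ℝ (u t) x‖ ≤ M) ?_ ?_ ?_ ?_
  · obtain ⟨M, hM, h⟩ := key
    exact ⟨M, hM, fun t ht => h t ⟨ht, ht⟩⟩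
  · exact ⟨0, le_rfl, by simp⟩
  · rintro S S' hSS ⟨M, hM, h⟩
    exact ⟨M, hM, fun t ht => h t ⟨hSS ht.1, ht.2⟩⟩
  · rintro S S' ⟨M, hM, h⟩ ⟨M', hM', h'⟩
    refine ⟨M + M', by positivity, fun t ht x => ?_⟩
    have hw : 0 < wt x ^ (2 / 9 : ℝ) := Real.rpow_pos_of_pos (wt_pos x) _
    rcases ht.1 with h1 | h1
    · obtain ⟨a, b⟩ := h t ⟨h1, ht.2⟩ x
      exact ⟨a.trans (by gcongr; linarith), b.trans (by linarith)⟩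
    · obtain ⟨a, b⟩ := h' t ⟨h1, ht.2⟩ x
      exact ⟨a.trans (by gcongr; linarith), b.trans (by linarith)⟩
  · intro t ht
    obtain ⟨η, hη, hcl⟩ := hu.2 t ht 1 one_pos
    refine ⟨Metric.ball t η, mem_nhdsWithin_of_mem_nhds (Metric.ball_mem_nhds t hη),
      C * Hnorm P s δ (u t) + C, by have := hN (u t); positivity, fun t' ht' x => ?_⟩
    have hlt := hcl t' ht'.2 (by simpa [Real.dist_eq] using ht'.1)
    have hdiff : Differentiable ℝ (fun x => u t' x - u t x) := (hd t' ht'.2).sub (hd t ht)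
    obtain ⟨a, b⟩ := hemb' _ hdiff (HwNormSq_sub_lt_top P (hd t' ht'.2).continuous
      (hd t ht).continuous (hu.1 t' ht'.2).2 (hu.1 t ht).2) x
    obtain ⟨a', b'⟩ := hemb' _ (hd t ht) (hu.1 t ht).2 x
    have hfd : fderiv ℝ (fun x => u t' x - u t x) x = fderiv ℝ (u t') x - fderiv ℝ (u t) x :=
      fderiv_sub (hd t' ht'.2 x) (hd t ht x)
    rw [hfd] at b
    have hw : 0 < wt x ^ (2 / 9 : ℝ) := Real.rpow_pos_of_pos (wt_pos x) _
    have hCle : C * Hnorm P s δ (fun x => u t' x - u t x) ≤ C := mul_le_of_le_one_right hC hlt.le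
    constructor
    · calc |u t' x| = |(u t' x - u t x) + u t x| := by ring_nf
        _ ≤ |u t' x - u t x| + |u t x| := abs_add_le _ _
        _ ≤ C * wt x ^ (2 / 9 : ℝ) + C * Hnorm P s δ (u t) * wt x ^ (2 / 9 : ℝ) :=
          add_le_add (a.trans (by gcongr)) a'
        _ = _ := by ring
    · calc ‖fderiv ℝ (u t') x‖ = ‖(fderiv ℝ (u t') x - fderiv ℝ (u t) x) + fderiv ℝ (u t) x‖ := by
            rw [sub_add_cancel]
        _ ≤ _ := norm_add_le _ _
        _ ≤ _ := by linarith

lemma wt_sub_le (x z : E3) : wt (x - z) ≤ (1 + ‖x‖) * wt z := by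
  unfold wt
  rw [← div_eq_mul_inv, inv_le_iff_one_le_mul₀ (by positivity), div_mul_eq_mul_div,
    le_div_iff₀ (by positivity)]
  have h : ‖z‖ ≤ ‖x‖ + ‖x - z‖ := by
    calc ‖z‖ = ‖x - (x - z)‖ := by rw [sub_sub_cancel]
      _ ≤ _ := norm_sub_le _ _
  nlinarith [norm_nonneg x, norm_nonneg (x - z)]

lemma aestronglyMeasurable_riesz {σ : E3 → ℝ} (hσ : Continuous σ) (k : ℝ) (x : E3) :
    AEStronglyMeasurable (fun y => ‖x - y‖ ^ (-k) * σ y) volume :=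
  Measurable.aestronglyMeasurable (by fun_prop)

lemma integrable_riesz_mul {σ : E3 → ℝ} (hσ : Continuous σ) {C k β : ℝ} (hk0 : 0 < k) (hk : k < 3)
    (hβ : 0 < β) (hkβ : 3 < k + β) (hC : ∀ y, |σ y| ≤ C * wt y ^ β) (x : E3) :
    Integrable (fun y => ‖x - y‖ ^ (-k) * σ y) := by
  obtain ⟨R, -, hR⟩ := exists_riesz_bound hk0 hk hβ hkβ
  refine ((hR x).1.const_mul C).mono' (aestronglyMeasurable_riesz hσ k x)
    (Filter.Eventually.of_forall fun y => ?_)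
  rw [norm_mul, Real.norm_of_nonneg (by positivity), Real.norm_eq_abs]
  calc _ ≤ ‖x - y‖ ^ (-k) * (C * wt y ^ β) := by gcongr; exact hC y
    _ = _ := by ring

lemma continuous_riesz {σ : E3 → ℝ} (hσ : Continuous σ) {C : ℝ}
    (hC : ∀ y, |σ y| ≤ C * wt y ^ (20 / 9 : ℝ)) :
    Continuous fun x : E3 => ∫ y, ‖x - y‖ ^ (-(2 : ℝ)) * |σ y| := by
  have hC0 : 0 ≤ C := by
    have h := (abs_nonneg _).trans (hC 0)
    have : 0 < wt (0 : E3) ^ (20 / 9 : ℝ) := Real.rpow_pos_of_pos (wt_pos _) _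
    exact nonneg_of_mul_nonneg_left h this
  have e : (fun x : E3 => ∫ y, ‖x - y‖ ^ (-(2 : ℝ)) * |σ y|) =
      fun x : E3 => ∫ z, ‖z‖ ^ (-(2 : ℝ)) * |σ (x - z)| := by
    funext x
    rw [← integral_sub_left_eq_self (fun y => ‖x - y‖ ^ (-(2 : ℝ)) * |σ y|) volume x]
    simp only [sub_sub_cancel]
  rw [e, continuous_iff_continuousAt]
  intro x₀
  obtain ⟨R, -, hR⟩ := exists_riesz_bound (k := 2) (β := 20 / 9) (by norm_num) (by norm_num)
    (by norm_num) (by norm_num)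
  have hint := ((hR 0).1.const_mul (C * (2 + ‖x₀‖) ^ (20 / 9 : ℝ)))
  simp only [zero_sub, norm_neg] at hint
  refine continuousAt_of_dominated (bound := fun z => C * (2 + ‖x₀‖) ^ (20 / 9 : ℝ) *
    (‖z‖ ^ (-(2 : ℝ)) * wt z ^ (20 / 9 : ℝ))) ?_ ?_ hint ?_
  · refine Filter.Eventually.of_forall fun x => ?_
    exact Measurable.aestronglyMeasurable (by fun_prop)
  · filter_upwards [Metric.ball_mem_nhds x₀ one_pos] with x hx
    refine Filter.Eventually.of_forall fun z => ?_
    have hxn : 1 + ‖x‖ ≤ 2 + ‖x₀‖ := by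
      rw [mem_ball_iff_norm] at hx
      linarith [norm_sub_norm_le x x₀]
    rw [norm_mul, Real.norm_of_nonneg (by positivity), Real.norm_eq_abs, abs_abs]
    have hw := wt_pos z
    have hw' := wt_pos (x - z)
    calc _ ≤ ‖z‖ ^ (-(2 : ℝ)) * (C * ((2 + ‖x₀‖) * wt z) ^ (20 / 9 : ℝ)) := by
          gcongr
          refine (hC _).trans ?_
          gcongr
          exact (wt_sub_le x z).trans (by gcongr)
      _ = _ := by rw [Real.mul_rpow (by positivity) hw.le]; ring
  · exact Filter.Eventually.of_forall fun z => Continuous.continuousAt (by fun_prop)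

lemma abs_inv_sub_inv_le {p q h : ℝ} (hp : 0 < p) (hq : 0 < q) (h1 : |q - p| ≤ h) :
    |p⁻¹ - q⁻¹| ≤ h * (2⁻¹ * (p ^ (-(2 : ℝ)) + q ^ (-(2 : ℝ)))) := by
  have hh : 0 ≤ h := (abs_nonneg _).trans h1
  rw [Real.rpow_neg hp.le, Real.rpow_neg hq.le, Real.rpow_two, Real.rpow_two,
    inv_sub_inv hp.ne' hq.ne', abs_div, abs_of_pos (mul_pos hp hq), div_eq_mul_inv]
  gcongr
  rw [mul_inv, ← inv_pow, ← inv_pow]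
  nlinarith [sq_nonneg (p⁻¹ - q⁻¹)]

lemma integrable_div_norm_sub {σ : E3 → ℝ} (hσ : Continuous σ) {C : ℝ}
    (hC : ∀ y, |σ y| ≤ C * wt y ^ (20 / 9 : ℝ)) (x : E3) :
    Integrable fun y => σ y / ‖x - y‖ := by
  refine (integrable_riesz_mul hσ (k := 1) (β := 20 / 9) (by norm_num) (by norm_num)
    (by norm_num) (by norm_num) hC x).congr (Filter.Eventually.of_forall fun y => ?_)
  simp only [Real.rpow_neg_one]
  rw [div_eq_mul_inv, mul_comm]

lemma abs_newtonPotential_sub_le {σ : E3 → ℝ} (hσ : Continuous σ) {C : ℝ}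
    (hC : ∀ y, |σ y| ≤ C * wt y ^ (20 / 9 : ℝ)) (x z : E3) :
    |newtonPotential σ z - newtonPotential σ x| ≤
      2⁻¹ * ((∫ y, ‖z - y‖ ^ (-(2 : ℝ)) * |σ y|) + ∫ y, ‖x - y‖ ^ (-(2 : ℝ)) * |σ y|) * ‖z - x‖ := by
  have hJ (x : E3) : Integrable fun y => ‖x - y‖ ^ (-(2 : ℝ)) * |σ y| :=
    integrable_riesz_mul hσ.abs (k := 2) (β := 20 / 9) (by norm_num) (by norm_num)
      (by norm_num) (by norm_num) (fun y => by rw [abs_abs]; exact hC y) x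
  have hae : ∀ᵐ y : E3, y ≠ z ∧ y ≠ x := by
    rw [Filter.eventually_and]
    exact ⟨Measure.ae_ne volume z, Measure.ae_ne volume x⟩
  rw [newtonPotential, newtonPotential, neg_sub_neg, ← integral_sub (integrable_div_norm_sub hσ hC x) (integrable_div_norm_sub hσ hC z),
    ← Real.norm_eq_abs]
  calc _ ≤ ∫ y, 2⁻¹ * ‖z - x‖ * (‖z - y‖ ^ (-(2 : ℝ)) * |σ y| + ‖x - y‖ ^ (-(2 : ℝ)) * |σ y|) := by
        refine norm_integral_le_of_norm_le (((hJ z).add (hJ x)).const_mul _) ?_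
        filter_upwards [hae] with y hy
        have hp : 0 < ‖z - y‖ := norm_pos_iff.2 (sub_ne_zero.2 hy.1.symm)
        have hq : 0 < ‖x - y‖ := norm_pos_iff.2 (sub_ne_zero.2 hy.2.symm)
        have h1 : |‖x - y‖ - ‖z - y‖| ≤ ‖z - x‖ := by
          refine (abs_norm_sub_norm_le _ _).trans (le_of_eq ?_)
          rw [sub_sub_sub_cancel_right, norm_sub_rev]
        have := abs_inv_sub_inv_le hp hq h1
        rw [div_eq_mul_inv, div_eq_mul_inv, ← mul_sub, norm_mul, norm_sub_rev]
        simp only [Real.norm_eq_abs]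
        exact (mul_le_mul_of_nonneg_left this (abs_nonneg _)).trans_eq (by ring)
    _ = _ := by
        rw [integral_const_mul, integral_add (hJ z) (hJ x)]; ring

lemma norm_fderiv_newtonPotential_le {σ : E3 → ℝ} (hσ : Continuous σ) {C : ℝ}
    (hC : ∀ y, |σ y| ≤ C * wt y ^ (20 / 9 : ℝ)) {x : E3} {L : E3 →L[ℝ] ℝ}
    (hL : HasFDerivAt (newtonPotential σ) L x) :
    ‖L‖ ≤ ∫ y, ‖x - y‖ ^ (-(2 : ℝ)) * |σ y| := by
  have hc := continuous_riesz hσ hC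
  set J : E3 → ℝ := fun x => ∫ y, ‖x - y‖ ^ (-(2 : ℝ)) * |σ y|
  have hJ0 : 0 ≤ J x := integral_nonneg fun y => by simp only [Pi.zero_apply]; positivity
  refine le_of_forall_pos_le_add fun ε hε => hL.le_of_lip' (by positivity) ?_
  filter_upwards [hc.continuousAt.eventually (gt_mem_nhds (show J x < J x + ε by linarith))] with z hz
  refine (abs_newtonPotential_sub_le hσ hC x z).trans ?_
  gcongr
  change 2⁻¹ * (J z + J x) ≤ J x + ε
  linarith

lemma norm_fderiv_newtonPotential_sub_le {ρ₁ ρ₂ : E3 → ℝ} (h₁ : Continuous ρ₁) (h₂ : Continuous ρ₂)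
    {C : ℝ} (hC₁ : ∀ y, |ρ₁ y| ≤ C * wt y ^ (20 / 9 : ℝ)) (hC₂ : ∀ y, |ρ₂ y| ≤ C * wt y ^ (20 / 9 : ℝ))
    {x : E3} (hd₁ : DifferentiableAt ℝ (newtonPotential ρ₁) x)
    (hd₂ : DifferentiableAt ℝ (newtonPotential ρ₂) x) :
    ‖fderiv ℝ (newtonPotential ρ₁) x - fderiv ℝ (newtonPotential ρ₂) x‖ ≤
      ∫ y, ‖x - y‖ ^ (-(2 : ℝ)) * |ρ₁ y - ρ₂ y| := by
  have e : newtonPotential (fun y => ρ₁ y - ρ₂ y) =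
      fun x => newtonPotential ρ₁ x - newtonPotential ρ₂ x := by
    funext x
    simp only [newtonPotential, sub_div]
    rw [integral_sub (integrable_div_norm_sub h₁ hC₁ x) (integrable_div_norm_sub h₂ hC₂ x)]; ring
  refine norm_fderiv_newtonPotential_le (C := 2 * C) (h₁.sub h₂) (fun y => ?_) ?_
  · calc _ ≤ |ρ₁ y| + |ρ₂ y| := abs_sub _ _
      _ ≤ _ := by linarith [hC₁ y, hC₂ y]
  · change HasFDerivAt (newtonPotential fun y => ρ₁ y - ρ₂ y) _ x
    rw [e]
    exact hd₁.hasFDerivAt.sub hd₂.hasFDerivAt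

/-! ### The energy weight -/

/-- The weight `(1 + |x|²)^{-13/9}` used in the energy estimate. -/
def enW (x : E3) : ℝ := (1 + ‖x‖ ^ 2) ^ (-(13 / 9) : ℝ)

lemma enW_pos (x : E3) : 0 < enW x := by unfold enW; positivity

lemma hasFDerivAt_enW (x : E3) : HasFDerivAt enW
    ((2 * (-(13 / 9)) * (1 + ‖x‖ ^ 2) ^ (-(13 / 9) - 1 : ℝ)) • innerSL ℝ x) x :=
  hasFDerivAt_sq_add_rpow one_pos _ x

lemma differentiable_enW : Differentiable ℝ enW := fun x => (hasFDerivAt_enW x).differentiableAt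

lemma abs_pd_enW_le (i : Fin 3) (x : E3) : |pd enW i x| ≤ 3 * enW x := by
  rw [pd_eq (hasFDerivAt_enW x)]
  simp only [smul_apply, innerSL_single, smul_eq_mul]
  have h1 : 0 < 1 + ‖x‖ ^ 2 := by positivity
  rw [Real.rpow_sub_one h1.ne', ← enW, abs_mul, abs_mul, abs_div, abs_of_pos (enW_pos x),
    abs_of_pos h1]
  have h2 : |x i| / (1 + ‖x‖ ^ 2) ≤ 1 := by
    rw [div_le_one h1]
    nlinarith [abs_coord_le x i, sq_nonneg (‖x‖ - 1)]
  have h3 : |(2 * -(13 / 9) : ℝ)| ≤ 3 := by norm_num [abs_le]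
  calc |(2 * -(13 / 9) : ℝ)| * (enW x / (1 + ‖x‖ ^ 2)) * |x i|
      = |(2 * -(13 / 9) : ℝ)| * enW x * (|x i| / (1 + ‖x‖ ^ 2)) := by ring
    _ ≤ 3 * enW x * 1 := by have := enW_pos x; gcongr
    _ = _ := by ring

lemma wt_rpow_le_enW (x : E3) : wt x ^ (26 / 9 : ℝ) ≤ enW x := by
  rw [wt_rpow, enW, show (-(26 / 9) : ℝ) = 2 * -(13 / 9) by norm_num,
    Real.rpow_mul (by positivity), Real.rpow_two]
  exact Real.rpow_le_rpow_of_nonpos (by positivity) (by nlinarith [norm_nonneg x]) (by norm_num)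

lemma enW_le (x : E3) : enW x ≤ 4 * wt x ^ (26 / 9 : ℝ) := by
  have h2 : (1 : ℝ) ≤ 4 * (2 : ℝ) ^ (-(13 / 9) : ℝ) := by
    have : (2 : ℝ) ^ (-2 : ℝ) ≤ 2 ^ (-(13 / 9) : ℝ) :=
      Real.rpow_le_rpow_of_exponent_le one_le_two (by norm_num)
    rw [Real.rpow_neg two_pos.le, Real.rpow_two] at this
    linarith
  have h3 : (2 * (1 + ‖x‖ ^ 2)) ^ (-(13 / 9) : ℝ) ≤ wt x ^ (26 / 9 : ℝ) := by
    rw [wt_rpow, show (-(26 / 9) : ℝ) = 2 * -(13 / 9) by norm_num,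
      Real.rpow_mul (by positivity), Real.rpow_two]
    exact Real.rpow_le_rpow_of_nonpos (by positivity) (by nlinarith [sq_nonneg (‖x‖ - 1)])
      (by norm_num)
  rw [Real.mul_rpow two_pos.le (by positivity), ← enW] at h3
  nlinarith [enW_pos x]

lemma wt_rpow_pos (x : E3) (r : ℝ) : 0 < wt x ^ r := Real.rpow_pos_of_pos (wt_pos x) r

lemma wt_rpow_le_one (x : E3) {r : ℝ} (hr : 0 ≤ r) : wt x ^ r ≤ 1 :=
  Real.rpow_le_one (wt_pos x).le (wt_le_one x) hr

lemma enW_mul_le (x : E3) : enW x * wt x ^ (2 / 9 : ℝ) ≤ 4 * wt x ^ (28 / 9 : ℝ) := by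
  have h := wt_rpow_pos x (2 / 9)
  calc _ ≤ 4 * wt x ^ (26 / 9 : ℝ) * wt x ^ (2 / 9 : ℝ) := by gcongr; exact enW_le x
    _ = _ := by rw [mul_assoc, ← Real.rpow_add (wt_pos x)]; norm_num

lemma measurable_pd (f : E3 → ℝ) (i : Fin 3) : Measurable (pd f i) :=
  measurable_fderiv_apply_const ℝ f _

lemma integrable_enW_mul {f : E3 → ℝ} (hf : AEStronglyMeasurable f volume) {C : ℝ}
    (hC : ∀ x, |f x| ≤ C * wt x ^ (2 / 9 : ℝ)) : Integrable fun x => enW x * f x := by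
  refine ((integrable_wt_rpow (r := 28 / 9) (by norm_num)).const_mul (C * 4)).mono'
    (differentiable_enW.continuous.aestronglyMeasurable.mul hf) (Filter.Eventually.of_forall fun x => ?_)
  have hC0 : 0 ≤ C := nonneg_of_mul_nonneg_left ((abs_nonneg _).trans (hC x)) (wt_rpow_pos x _)
  rw [norm_mul, Real.norm_of_nonneg (enW_pos x).le, Real.norm_eq_abs]
  calc _ ≤ enW x * (C * wt x ^ (2 / 9 : ℝ)) := by have := enW_pos x; gcongr; exact hC x
    _ = C * (enW x * wt x ^ (2 / 9 : ℝ)) := by ring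
    _ ≤ C * (4 * wt x ^ (28 / 9 : ℝ)) := mul_le_mul_of_nonneg_left (enW_mul_le x) ‹_›
    _ = _ := by ring

/-- Differentiable functions of size `|x|^{-2/9}` with bounded gradient, with constant `M`. -/
structure Reg (M : ℝ) (f : E3 → ℝ) : Prop where
  diff : Differentiable ℝ f
  bd : ∀ x, |f x| ≤ M * wt x ^ (2 / 9 : ℝ)
  pd_bd : ∀ i x, |pd f i x| ≤ M

/-- Differentiable functions of size `|x|^{-2/9}` with gradient of the same size. -/
structure DReg (f : E3 → ℝ) : Prop where
  diff : Differentiable ℝ f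
  bd : ∃ N, ∀ x, |f x| ≤ N * wt x ^ (2 / 9 : ℝ)
  pd_bd : ∃ N, ∀ i x, |pd f i x| ≤ N * wt x ^ (2 / 9 : ℝ)

lemma Reg.nonneg {M : ℝ} {f : E3 → ℝ} (hf : Reg M f) : 0 ≤ M :=
  (abs_nonneg _).trans (hf.pd_bd 0 0)

lemma Reg.bd_le {M : ℝ} {f : E3 → ℝ} (hf : Reg M f) (x : E3) : |f x| ≤ M :=
  (hf.bd x).trans (mul_le_of_le_one_right hf.nonneg (wt_rpow_le_one x (by norm_num)))

lemma Reg.mono {M N : ℝ} {f : E3 → ℝ} (hf : Reg M f) (h : M ≤ N) : Reg N f :=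
  ⟨hf.diff, fun x => (hf.bd x).trans (by have := wt_rpow_pos x (2 / 9); gcongr),
    fun i x => (hf.pd_bd i x).trans h⟩

lemma Reg.sub {M N : ℝ} {f g : E3 → ℝ} (hf : Reg M f) (hg : Reg N g) :
    Reg (M + N) (fun x => f x - g x) := by
  refine ⟨hf.diff.sub hg.diff, fun x => ?_, fun i x => ?_⟩
  · rw [add_mul]
    exact (abs_sub _ _).trans (add_le_add (hf.bd x) (hg.bd x))
  · rw [pd_sub (hf.diff x) (hg.diff x)]
    exact (abs_sub _ _).trans (add_le_add (hf.pd_bd i x) (hg.pd_bd i x))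

lemma Reg.mul {M N : ℝ} {f g : E3 → ℝ} (hf : Reg M f) (hg : Reg N g) :
    DReg (fun x => f x * g x) := by
  have hM := hf.nonneg
  have hN := hg.nonneg
  refine ⟨hf.diff.mul hg.diff, ⟨M * N, fun x => ?_⟩, ⟨2 * (M * N), fun i x => ?_⟩⟩
  · rw [abs_mul]
    have := hf.bd x
    have := hg.bd_le x
    have := wt_rpow_pos x (2 / 9)
    calc |f x| * |g x| ≤ (M * wt x ^ (2 / 9 : ℝ)) * N := by gcongr
      _ = _ := by ring
  · rw [pd_mul (hf.diff x) (hg.diff x)]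
    have h1 := hf.bd x
    have h2 := hg.bd x
    have h3 := hf.pd_bd i x
    have h4 := hg.pd_bd i x
    have := wt_rpow_pos x (2 / 9)
    calc _ ≤ |f x| * |pd g i x| + |pd f i x| * |g x| := by
          rw [← abs_mul, ← abs_mul]; exact abs_add_le _ _
      _ ≤ (M * wt x ^ (2 / 9 : ℝ)) * N + M * (N * wt x ^ (2 / 9 : ℝ)) := by gcongr
      _ = _ := by ring

lemma DReg.exists_reg {f : E3 → ℝ} (hf : DReg f) : ∃ M, Reg M f := by
  obtain ⟨N, hN⟩ := hf.bd
  obtain ⟨N', hN'⟩ := hf.pd_bd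
  refine ⟨|N| + |N'|, hf.diff, fun x => (hN x).trans ?_, fun i x => (hN' i x).trans ?_⟩
  · have := wt_rpow_pos x (2 / 9)
    gcongr
    linarith [le_abs_self N, abs_nonneg N']
  · have h1 := wt_rpow_pos x (2 / 9)
    have h2 := wt_rpow_le_one x (r := 2 / 9) (by norm_num)
    nlinarith [le_abs_self N', abs_nonneg N', abs_nonneg N]

lemma DReg.mul {M : ℝ} {f g : E3 → ℝ} (hf : Reg M f) (hg : DReg g) : DReg (fun x => f x * g x) :=
  let ⟨_, h⟩ := hg.exists_reg
  hf.mul h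

lemma DReg.add {f g : E3 → ℝ} (hf : DReg f) (hg : DReg g) : DReg (fun x => f x + g x) := by
  obtain ⟨N₁, h₁⟩ := hf.bd
  obtain ⟨N₂, h₂⟩ := hg.bd
  obtain ⟨K₁, k₁⟩ := hf.pd_bd
  obtain ⟨K₂, k₂⟩ := hg.pd_bd
  refine ⟨hf.diff.add hg.diff, ⟨N₁ + N₂, fun x => ?_⟩, ⟨K₁ + K₂, fun i x => ?_⟩⟩
  · rw [add_mul]
    exact (abs_add_le _ _).trans (add_le_add (h₁ x) (h₂ x))
  · rw [pd_add (hf.diff x) (hg.diff x), add_mul]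
    exact (abs_add_le _ _).trans (add_le_add (k₁ i x) (k₂ i x))

lemma DReg.const_mul {f : E3 → ℝ} (hf : DReg f) (c : ℝ) : DReg (fun x => c * f x) := by
  obtain ⟨N, h⟩ := hf.bd
  obtain ⟨K, k⟩ := hf.pd_bd
  refine ⟨hf.diff.const_mul c, ⟨|c| * N, fun x => ?_⟩, ⟨|c| * K, fun i x => ?_⟩⟩
  · rw [abs_mul, mul_assoc]
    gcongr; exact h x
  · rw [pd_const_mul (hf.diff x), abs_mul, mul_assoc]
    gcongr; exact k i x

lemma DReg.integral_pd_enW_mul {Y : E3 → ℝ} (hY : DReg Y) (i : Fin 3) :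
    Integrable (pd (fun x => enW x * Y x) i) ∧ ∫ x, pd (fun x => enW x * Y x) i x = 0 := by
  obtain ⟨N, hN⟩ := hY.bd
  obtain ⟨K, hK⟩ := hY.pd_bd
  have hN0 : 0 ≤ N := nonneg_of_mul_nonneg_left ((abs_nonneg _).trans (hN 0)) (wt_rpow_pos 0 _)
  have hint : Integrable (pd (fun x => enW x * Y x) i) := by
    have e : pd (fun x => enW x * Y x) i =
        fun x => enW x * (pd Y i x + pd enW i x / enW x * Y x) := by
      funext x
      rw [pd_mul (differentiable_enW x) (hY.diff x)]
      have := (enW_pos x).ne'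
      field_simp
    rw [e]
    refine integrable_enW_mul (C := K + 3 * N) (Measurable.aestronglyMeasurable ?_) fun x => ?_
    · have h1 := measurable_pd Y i
      have h2 := measurable_pd enW i
      have h3 := differentiable_enW.continuous.measurable
      have h4 := hY.diff.continuous.measurable
      fun_prop
    · have h1 : |pd enW i x / enW x| ≤ 3 := by
        rw [abs_div, abs_of_pos (enW_pos x), div_le_iff₀ (enW_pos x)]
        exact abs_pd_enW_le i x
      calc _ ≤ |pd Y i x| + |pd enW i x / enW x| * |Y x| := by
            rw [← abs_mul]; exact abs_add_le _ _
        _ ≤ K * wt x ^ (2 / 9 : ℝ) + 3 * (N * wt x ^ (2 / 9 : ℝ)) := by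
            gcongr
            exacts [hK i x, hN x]
        _ = _ := by ring
  refine ⟨hint, integral_pd_eq_zero (C := 4 * N) i (differentiable_enW.mul hY.diff) (fun x => ?_) hint⟩
  have h3 : wt x ^ (28 / 9 : ℝ) ≤ wt x ^ 3 := by
    rw [← Real.rpow_natCast]
    exact Real.rpow_le_rpow_of_exponent_ge (wt_pos x) (wt_le_one x) (by norm_num)
  rw [abs_mul, abs_of_pos (enW_pos x)]
  calc _ ≤ enW x * (N * wt x ^ (2 / 9 : ℝ)) := by have := enW_pos x; gcongr; exact hN x
    _ = N * (enW x * wt x ^ (2 / 9 : ℝ)) := by ring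
    _ ≤ N * (4 * wt x ^ (28 / 9 : ℝ)) := mul_le_mul_of_nonneg_left (enW_mul_le x) ‹_›
    _ ≤ N * (4 * wt x ^ 3) := by gcongr
    _ = _ := by ring

lemma exists_integral_riesz_le : ∃ C : ℝ, 0 ≤ C ∧ ∀ g : E3 → ℝ, Measurable g → (∀ y, 0 ≤ g y) →
    Integrable g → Integrable (fun x => enW x * ∫ y, ‖x - y‖ ^ (-(2 : ℝ)) * g y) ∧
      ∫ x, enW x * ∫ y, ‖x - y‖ ^ (-(2 : ℝ)) * g y ≤ C * ∫ y, g y := by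
  obtain ⟨R, hR0, hR⟩ := exists_riesz_bound (k := 2) (β := 26 / 9) (by norm_num) (by norm_num)
    (by norm_num) (by norm_num)
  refine ⟨4 * R, by positivity, fun g hg hg0 hgi => ?_⟩
  have hen : Measurable enW := differentiable_enW.continuous.measurable
  set F : E3 × E3 → ℝ := fun p => enW p.1 * (‖p.1 - p.2‖ ^ (-(2 : ℝ)) * g p.2) with hFdef
  have hFm : Measurable F := by
    simp only [hFdef]
    fun_prop
  have hF0 (p : E3 × E3) : 0 ≤ F p := by
    have := enW_pos p.1
    have := hg0 p.2
    simp only [hFdef]; positivity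
  have hle (x y : E3) : F (x, y) ≤ 4 * g y * (‖y - x‖ ^ (-(2 : ℝ)) * wt x ^ (26 / 9 : ℝ)) := by
    have := hg0 y
    calc F (x, y) ≤ (4 * wt x ^ (26 / 9 : ℝ)) * (‖x - y‖ ^ (-(2 : ℝ)) * g y) := by
          simp only [hFdef]; gcongr; exact enW_le x
      _ = _ := by rw [norm_sub_rev]; ring
  have hsec (y : E3) : Integrable (fun x => F (x, y)) := by
    refine ((hR y).1.const_mul (4 * g y)).mono'
      (hFm.comp (measurable_id.prodMk measurable_const)).aestronglyMeasurable
      (Filter.Eventually.of_forall fun x => ?_)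
    rw [Real.norm_of_nonneg (hF0 _)]
    exact hle x y
  have hint_le (y : E3) : ∫ x, F (x, y) ≤ 4 * R * g y := by
    calc _ ≤ ∫ x, 4 * g y * (‖y - x‖ ^ (-(2 : ℝ)) * wt x ^ (26 / 9 : ℝ)) :=
          integral_mono (hsec y) ((hR y).1.const_mul _) fun x => hle x y
      _ = 4 * g y * ∫ x, ‖y - x‖ ^ (-(2 : ℝ)) * wt x ^ (26 / 9 : ℝ) := integral_const_mul _ _
      _ ≤ 4 * g y * R := by have := hg0 y; gcongr; exact (hR y).2
      _ = _ := by ring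
  have hFi : Integrable F (volume.prod volume) := by
    rw [integrable_prod_iff' hFm.aestronglyMeasurable]
    refine ⟨Filter.Eventually.of_forall hsec, (hgi.const_mul (4 * R)).mono' ?_ ?_⟩
    · exact (hFm.norm.aestronglyMeasurable (μ := volume.prod volume)).prod_swap.integral_prod_right'
    · refine Filter.Eventually.of_forall fun y => ?_
      simp only [Real.norm_of_nonneg (hF0 _)]
      rw [Real.norm_of_nonneg (integral_nonneg fun x => hF0 _)]
      exact hint_le y
  have e (x : E3) : enW x * ∫ y, ‖x - y‖ ^ (-(2 : ℝ)) * g y = ∫ y, F (x, y) :=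
    (integral_const_mul _ _).symm
  simp only [e]
  refine ⟨hFi.integral_prod_left, ?_⟩
  rw [integral_integral_swap (f := fun x y => F (x, y)) hFi, ← integral_const_mul]
  exact integral_mono hFi.integral_prod_right (hgi.const_mul _) hint_le

/-! ### The energy estimate at a fixed time -/

/-- The time derivative of `w` prescribed by the equation for `γ = 6/5`. -/
def rateW (w : E3 → ℝ) (v : Fin 3 → E3 → ℝ) (x : E3) : ℝ :=
  -(∑ a, v a x * pd w a x) - 1 / 10 * w x * ∑ a, pd (v a) a x

/-- The time derivative of `v` prescribed by the equation for `γ = 6/5`. -/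
def rateV (w : E3 → ℝ) (v : Fin 3 → E3 → ℝ) (φ : E3 → ℝ) (a : Fin 3) (x : E3) : ℝ :=
  -(∑ b, v b x * pd (v a) b x) - 1 / 10 * w x * pd w a x - pd φ a x

/-- The energy density of a difference of two solutions. -/
def enD (W : E3 → ℝ) (V : Fin 3 → E3 → ℝ) (x : E3) : ℝ :=
  W x * W x + (V 0 x * V 0 x + (V 1 x * V 1 x + V 2 x * V 2 x))

/-- The energy flux without the weight. -/
def flux (w : E3 → ℝ) (v : Fin 3 → E3 → ℝ) (W : E3 → ℝ) (V : Fin 3 → E3 → ℝ) (a : Fin 3)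
    (x : E3) : ℝ :=
  v a x * enD W V x + 1 / 5 * (w x * (W x * V a x))

section

variable {w₁ w₂ : E3 → ℝ} {v₁ v₂ : Fin 3 → E3 → ℝ}

lemma pd_enD {W : E3 → ℝ} {V : Fin 3 → E3 → ℝ} (hW : Differentiable ℝ W)
    (hV : ∀ a, Differentiable ℝ (V a)) (i : Fin 3) (x : E3) :
    pd (enD W V) i x = 2 * (W x * pd W i x + ∑ b, V b x * pd (V b) i x) := by
  have h (f : E3 → ℝ) (hf : Differentiable ℝ f) : Differentiable ℝ fun x => f x * f x := hf.mul hf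
  have e : enD W V = fun x => W x * W x + (V 0 x * V 0 x + (V 1 x * V 1 x + V 2 x * V 2 x)) := rfl
  have h12 : Differentiable ℝ fun x => V 1 x * V 1 x + V 2 x * V 2 x := (h _ (hV 1)).add (h _ (hV 2))
  have h012 : Differentiable ℝ fun x => V 0 x * V 0 x + (V 1 x * V 1 x + V 2 x * V 2 x) :=
    (h _ (hV 0)).add h12
  rw [e, pd_add (h _ hW x) (h012 x), pd_add (h _ (hV 0) x) (h12 x), pd_add (h _ (hV 1) x) (h _ (hV 2) x),
    pd_mul (hW x) (hW x), pd_mul (hV 0 x) (hV 0 x), pd_mul (hV 1 x) (hV 1 x),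
    pd_mul (hV 2 x) (hV 2 x), Fin.sum_univ_three]
  ring

lemma differentiable_enD {W : E3 → ℝ} {V : Fin 3 → E3 → ℝ} (hW : Differentiable ℝ W)
    (hV : ∀ a, Differentiable ℝ (V a)) : Differentiable ℝ (enD W V) :=
  (hW.mul hW).add (((hV 0).mul (hV 0)).add (((hV 1).mul (hV 1)).add ((hV 2).mul (hV 2))))

lemma pd_enW_mul_flux {w W : E3 → ℝ} {v V : Fin 3 → E3 → ℝ} (hw : Differentiable ℝ w)
    (hv : ∀ a, Differentiable ℝ (v a)) (hW : Differentiable ℝ W) (hV : ∀ a, Differentiable ℝ (V a))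
    (a : Fin 3) (x : E3) :
    pd (fun y => enW y * flux w v W V a y) a x =
      enW x * (v a x * (2 * (W x * pd W a x + ∑ b, V b x * pd (V b) a x)) + pd (v a) a x * enD W V x +
        1 / 5 * (w x * (W x * pd (V a) a x + pd W a x * V a x) + pd w a x * (W x * V a x))) +
      pd enW a x * flux w v W V a x := by
  have hE := differentiable_enD hW hV
  have hWV : Differentiable ℝ fun y => W y * V a y := hW.mul (hV a)
  have hwWV : Differentiable ℝ fun y => w y * (W y * V a y) := hw.mul hWV
  have h1 : Differentiable ℝ fun y => v a y * enD W V y := (hv a).mul hE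
  have h2 : Differentiable ℝ fun y => 1 / 5 * (w y * (W y * V a y)) := hwWV.const_mul _
  have hf : flux w v W V a = fun y => v a y * enD W V y + 1 / 5 * (w y * (W y * V a y)) := rfl
  have hfd : Differentiable ℝ (flux w v W V a) := h1.add h2
  rw [pd_mul (differentiable_enW x) (hfd x), hf, pd_add (h1 x) (h2 x), pd_mul (hv a x) (hE x),
    pd_const_mul (hwWV x), pd_mul (hw x) (hWV x), pd_mul (hW x) (hV a x), pd_enD hW hV]

lemma energy_identity (φ₁ φ₂ : E3 → ℝ) (hw₁ : Differentiable ℝ w₁) (hw₂ : Differentiable ℝ w₂)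
    (hv₁ : ∀ a, Differentiable ℝ (v₁ a)) (hv₂ : ∀ a, Differentiable ℝ (v₂ a))
    {W : E3 → ℝ} {V : Fin 3 → E3 → ℝ} (hW : W = fun x => w₁ x - w₂ x)
    (hV : V = fun a x => v₁ a x - v₂ a x) (x : E3) :
    enW x * (2 * (W x * (rateW w₁ v₁ x - rateW w₂ v₂ x) +
      ∑ a, V a x * (rateV w₁ v₁ φ₁ a x - rateV w₂ v₂ φ₂ a x))) =
    -(∑ a, pd (fun y => enW y * flux w₁ v₁ W V a y) a x) +
    ((∑ a, (pd enW a x * v₁ a x + enW x * pd (v₁ a) a x) * enD W V x) +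
      (∑ a, (1 / 5 * (pd enW a x * w₁ x + enW x * pd w₁ a x) -
        11 / 5 * (enW x * pd w₂ a x)) * (W x * V a x)) +
      (∑ a, (-(1 / 5) * (enW x * pd (v₂ a) a x)) * (W x * W x)) +
      (∑ a, ∑ b, (-2 * (enW x * pd (v₂ a) b x)) * (V a x * V b x)) +
      ∑ a, -2 * (enW x * V a x * (pd φ₁ a x - pd φ₂ a x))) := by
  have hWd : Differentiable ℝ W := hW ▸ hw₁.sub hw₂
  have hVd (a : Fin 3) : Differentiable ℝ (V a) := by
    rw [hV]; exact (hv₁ a).sub (hv₂ a)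
  simp only [pd_enW_mul_flux hw₁ hv₁ hWd hVd]
  have e1 (i : Fin 3) : pd w₂ i x = pd w₁ i x - pd W i x := by
    rw [hW, pd_sub (hw₁ x) (hw₂ x)]; ring
  have e2 (a i : Fin 3) : pd (v₂ a) i x = pd (v₁ a) i x - pd (V a) i x := by
    rw [hV, pd_sub (hv₁ a x) (hv₂ a x)]; ring
  have e3 : w₂ x = w₁ x - W x := by rw [hW]; ring
  have e4 (a : Fin 3) : v₂ a x = v₁ a x - V a x := by rw [hV]; ring
  simp only [rateW, rateV, e1, e2, e3, e4, flux, enD, Fin.sum_univ_three]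
  ring

lemma mul_le_of_abs_le {p q A B : ℝ} (hp : |p| ≤ A) (hq : |q| ≤ B) : p * q ≤ A * B :=
  (le_abs_self _).trans (by rw [abs_mul]; exact mul_le_mul hp hq (abs_nonneg _) ((abs_nonneg _).trans hp))

lemma abs_mul_le_enD (W : E3 → ℝ) (V : Fin 3 → E3 → ℝ) (x : E3) :
    |W x * W x| ≤ enD W V x ∧ (∀ a, |W x * V a x| ≤ enD W V x) ∧
      ∀ a b, |V a x * V b x| ≤ enD W V x := by
  unfold enD
  refine ⟨?_, fun a => ?_, fun a b => ?_⟩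
  · rw [abs_mul_self]
    nlinarith [sq_nonneg (V 0 x), sq_nonneg (V 1 x), sq_nonneg (V 2 x)]
  · rw [abs_le]
    fin_cases a <;> constructor <;> simp only [Fin.zero_eta, Fin.mk_one, Fin.reduceFinMk] <;>
      nlinarith [sq_nonneg (V 0 x), sq_nonneg (V 1 x), sq_nonneg (V 2 x), sq_nonneg (W x + V 0 x),
        sq_nonneg (W x + V 1 x), sq_nonneg (W x + V 2 x), sq_nonneg (W x - V 0 x),
        sq_nonneg (W x - V 1 x), sq_nonneg (W x - V 2 x), sq_nonneg (W x)]
  · rw [abs_le]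
    fin_cases a <;> fin_cases b <;> constructor <;>
      simp only [Fin.zero_eta, Fin.mk_one, Fin.reduceFinMk] <;>
      nlinarith [sq_nonneg (V 0 x), sq_nonneg (V 1 x), sq_nonneg (V 2 x), sq_nonneg (V 1 x + V 0 x),
        sq_nonneg (V 0 x + V 2 x), sq_nonneg (V 1 x + V 2 x), sq_nonneg (V 1 x - V 0 x),
        sq_nonneg (V 2 x - V 1 x), sq_nonneg (V 0 x - V 2 x), sq_nonneg (W x)]

lemma enD_nonneg (W : E3 → ℝ) (V : Fin 3 → E3 → ℝ) (x : E3) : 0 ≤ enD W V x :=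
  (abs_nonneg _).trans (abs_mul_le_enD W V x).1

lemma energy_remainder_le {M : ℝ} (hw₁ : Reg M w₁) (hw₂ : Reg M w₂) (hv₁ : ∀ a, Reg M (v₁ a))
    (hv₂ : ∀ a, Reg M (v₂ a)) (W : E3 → ℝ) (V : Fin 3 → E3 → ℝ) (x : E3) :
    (∑ a, (pd enW a x * v₁ a x + enW x * pd (v₁ a) a x) * enD W V x) +
      (∑ a, (1 / 5 * (pd enW a x * w₁ x + enW x * pd w₁ a x) -
        11 / 5 * (enW x * pd w₂ a x)) * (W x * V a x)) +
      (∑ a, (-(1 / 5) * (enW x * pd (v₂ a) a x)) * (W x * W x)) +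
      (∑ a, ∑ b, (-2 * (enW x * pd (v₂ a) b x)) * (V a x * V b x)) ≤
    40 * M * (enW x * enD W V x) := by
  obtain ⟨b1, b2, b3⟩ := abs_mul_le_enD W V x
  have hM := hw₁.nonneg
  have hϖ := enW_pos x
  have hE := enD_nonneg W V x
  have g1 {p : ℝ} (hp : |p| ≤ M) (i : Fin 3) : |pd enW i x * p| ≤ 3 * (M * enW x) := by
    rw [abs_mul]
    calc _ ≤ (3 * enW x) * M := by gcongr; exact abs_pd_enW_le i x
      _ = _ := by ring
  have g2 {p : ℝ} (hp : |p| ≤ M) : |enW x * p| ≤ M * enW x := by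
    rw [abs_mul, abs_of_pos hϖ, mul_comm]; gcongr
  have t1 (a : Fin 3) : (pd enW a x * v₁ a x + enW x * pd (v₁ a) a x) * enD W V x ≤
      4 * (M * enW x) * enD W V x := by
    refine mul_le_of_abs_le ((abs_add_le _ _).trans ?_) (abs_of_nonneg hE).le
    linarith [g1 ((hv₁ a).bd_le x) a, g2 ((hv₁ a).pd_bd a x)]
  have t2 (a : Fin 3) : (1 / 5 * (pd enW a x * w₁ x + enW x * pd w₁ a x) -
        11 / 5 * (enW x * pd w₂ a x)) * (W x * V a x) ≤ 3 * (M * enW x) * enD W V x := by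
    refine mul_le_of_abs_le ?_ (b2 a)
    have h1 := abs_le.1 (g1 (hw₁.bd_le x) a)
    have h2 := abs_le.1 (g2 (hw₁.pd_bd a x))
    have h3 := abs_le.1 (g2 (hw₂.pd_bd a x))
    rw [abs_le]
    constructor <;> linarith [h1.1, h1.2, h2.1, h2.2, h3.1, h3.2]
  have t3 (a : Fin 3) : (-(1 / 5) * (enW x * pd (v₂ a) a x)) * (W x * W x) ≤
      (1 / 3) * (M * enW x) * enD W V x := by
    refine mul_le_of_abs_le ?_ b1
    have h1 := abs_le.1 (g2 ((hv₂ a).pd_bd a x))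
    rw [abs_le]
    constructor <;> linarith [h1.1, h1.2]
  have t4 (a b : Fin 3) : (-2 * (enW x * pd (v₂ a) b x)) * (V a x * V b x) ≤
      2 * (M * enW x) * enD W V x := by
    refine mul_le_of_abs_le ?_ (b3 a b)
    have h1 := abs_le.1 (g2 ((hv₂ a).pd_bd b x))
    rw [abs_le]
    constructor <;> linarith [h1.1, h1.2]
  have s1 := Finset.sum_le_sum fun a (_ : a ∈ Finset.univ) => t1 a
  have s2 := Finset.sum_le_sum fun a (_ : a ∈ Finset.univ) => t2 a
  have s3 := Finset.sum_le_sum fun a (_ : a ∈ Finset.univ) => t3 a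
  have s4 := Finset.sum_le_sum fun a (_ : a ∈ Finset.univ) =>
    Finset.sum_le_sum fun b (_ : b ∈ Finset.univ) => t4 a b
  simp only [Finset.sum_const, Finset.card_univ, Fintype.card_fin, nsmul_eq_mul] at s1 s2 s3 s4
  push_cast at s1 s2 s3 s4
  linarith

end

lemma wt_rpow_pow (x : E3) (n : ℕ) : (wt x ^ (2 / 9 : ℝ)) ^ n = wt x ^ (2 / 9 * n : ℝ) := by
  rw [Real.rpow_mul (wt_pos x).le, Real.rpow_natCast]

section

variable {c M : ℝ} {w w₁ w₂ : E3 → ℝ} {v v₁ v₂ : Fin 3 → E3 → ℝ}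

lemma Reg.abs_density_le (hw : Reg M w) (c : ℝ) (y : E3) :
    |c * w y ^ 10| ≤ |c| * M ^ 10 * wt y ^ (20 / 9 : ℝ) := by
  have := pow_le_pow_left₀ (abs_nonneg _) (hw.bd y) 10
  rw [mul_pow, wt_rpow_pow] at this
  rw [abs_mul, abs_pow, mul_assoc]
  refine mul_le_mul_of_nonneg_left (this.trans_eq ?_) (abs_nonneg _)
  norm_num

lemma Reg.abs_density_sub_le (h₁ : Reg M w₁) (h₂ : Reg M w₂) (c : ℝ) (y : E3) :
    |c * w₁ y ^ 10 - c * w₂ y ^ 10| ≤ 10 * |c| * M ^ 9 * (wt y ^ (2 : ℝ) * |w₁ y - w₂ y|) := by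
  have h := abs_pow_sub_pow_le (w₁ y) (w₂ y) 10
  have hm : max |w₁ y| |w₂ y| ^ 9 ≤ M ^ 9 * wt y ^ (2 : ℝ) := by
    have := pow_le_pow_left₀ (le_max_of_le_left (abs_nonneg _)) (max_le (h₁.bd y) (h₂.bd y)) 9
    rw [mul_pow, wt_rpow_pow] at this
    refine this.trans_eq ?_
    norm_num
  rw [← mul_sub, abs_mul]
  calc _ ≤ |c| * (|w₁ y - w₂ y| * (10 : ℕ) * (M ^ 9 * wt y ^ (2 : ℝ))) := by
        gcongr
        refine h.trans ?_
        gcongr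
    _ = _ := by push_cast; ring

lemma Reg.continuous_density (hw : Reg M w) (c : ℝ) : Continuous fun y => c * w y ^ 10 := by
  have := hw.diff.continuous
  fun_prop

lemma exists_rate_bound (c M : ℝ) : ∃ B : ℝ, ∀ (w : E3 → ℝ) (v : Fin 3 → E3 → ℝ), Reg M w →
    (∀ a, Reg M (v a)) → Differentiable ℝ (newtonPotential fun y => c * w y ^ 10) → ∀ x,
      |rateW w v x| ≤ B ∧ ∀ a, |rateV w v (newtonPotential fun y => c * w y ^ 10) a x| ≤ B := by
  obtain ⟨R, hR0, hR⟩ := exists_riesz_bound (k := 2) (β := 20 / 9) (by norm_num) (by norm_num)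
    (by norm_num) (by norm_num)
  refine ⟨4 * (M * M) + |c| * M ^ 10 * R, fun w v hw hv hφ x => ?_⟩
  have hM := hw.nonneg
  have hp {p q : ℝ} (h1 : |p| ≤ M) (h2 : |q| ≤ M) : |p * q| ≤ M * M := by
    rw [abs_mul]; gcongr
  have hsum (f : Fin 3 → ℝ) (N : ℝ) (hf : ∀ a, |f a| ≤ N) : |∑ a, f a| ≤ 3 * N := by
    refine (Finset.abs_sum_le_sum_abs _ _).trans ((Finset.sum_le_sum fun a _ => hf a).trans ?_)
    simp
  have hc0 : 0 ≤ |c| * M ^ 10 * R := by positivity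
  have hMM : 0 ≤ M * M := by positivity
  constructor
  · have h1 := abs_le.1 (hsum (fun a => v a x * pd w a x) _ fun a => hp ((hv a).bd_le x) (hw.pd_bd a x))
    have h2 := abs_le.1 (hsum (fun a => w x * pd (v a) a x) _
      fun a => hp (hw.bd_le x) ((hv a).pd_bd a x))
    have e : 1 / 10 * w x * ∑ a, pd (v a) a x = 1 / 10 * ∑ a, w x * pd (v a) a x := by
      rw [mul_assoc, Finset.mul_sum]
    rw [rateW, abs_le, e]
    constructor <;> linarith [h1.1, h1.2, h2.1, h2.2]
  · intro a
    have h1 := abs_le.1 (hsum (fun b => v b x * pd (v a) b x) _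
      fun b => hp ((hv b).bd_le x) ((hv a).pd_bd b x))
    have h2 := abs_le.1 (hp (hw.bd_le x) (hw.pd_bd a x))
    have h3 : |pd (newtonPotential fun y => c * w y ^ 10) a x| ≤ |c| * M ^ 10 * R := by
      refine (abs_pd_le _ a x).trans ((norm_fderiv_newtonPotential_le (hw.continuous_density c)
        (hw.abs_density_le c) (hφ x).hasFDerivAt).trans ?_)
      calc _ ≤ ∫ y, |c| * M ^ 10 * (‖x - y‖ ^ (-(2 : ℝ)) * wt y ^ (20 / 9 : ℝ)) := by
            refine integral_mono (integrable_riesz_mul (hw.continuous_density c).abs (k := 2)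
              (β := 20 / 9) (by norm_num) (by norm_num) (by norm_num) (by norm_num)
              (fun y => by rw [abs_abs]; exact hw.abs_density_le c y) x) ((hR x).1.const_mul _)
              fun y => ?_
            calc _ ≤ ‖x - y‖ ^ (-(2 : ℝ)) * (|c| * M ^ 10 * wt y ^ (20 / 9 : ℝ)) :=
                  mul_le_mul_of_nonneg_left (hw.abs_density_le c y) (by positivity)
              _ = _ := by ring
        _ = |c| * M ^ 10 * ∫ y, ‖x - y‖ ^ (-(2 : ℝ)) * wt y ^ (20 / 9 : ℝ) := integral_const_mul _ _
        _ ≤ _ := mul_le_mul_of_nonneg_left (hR x).2 (by positivity)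
    have h3' := abs_le.1 h3
    rw [rateV, abs_le, mul_assoc (1 / 10) (w x)]
    constructor <;> linarith [h1.1, h1.2, h2.1, h2.2, h3'.1, h3'.2]

lemma measurable_rateW (hw : Continuous w) (hv : ∀ a, Continuous (v a)) :
    Measurable (rateW w v) := by
  have h1 := hw.measurable
  have h2 (a : Fin 3) := (hv a).measurable
  have h3 := measurable_pd
  unfold rateW
  fun_prop

lemma measurable_rateV (hw : Continuous w) (hv : ∀ a, Continuous (v a)) (φ : E3 → ℝ) (a : Fin 3) :
    Measurable (rateV w v φ a) := by
  have h1 := hw.measurable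
  have h2 (a : Fin 3) := (hv a).measurable
  have h3 := measurable_pd
  unfold rateV
  fun_prop

lemma exists_forcing_bound (c M : ℝ) : ∃ A B : ℝ, 0 ≤ A ∧ 0 ≤ B ∧ ∀ (w₁ w₂ : E3 → ℝ),
    Reg M w₁ → Reg M w₂ →
    Differentiable ℝ (newtonPotential fun y => c * w₁ y ^ 10) →
    Differentiable ℝ (newtonPotential fun y => c * w₂ y ^ 10) →
    ∀ (q : ℝ) (a : Fin 3) (x : E3),
      |q| * |pd (newtonPotential fun y => c * w₁ y ^ 10) a x -
        pd (newtonPotential fun y => c * w₂ y ^ 10) a x| ≤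
      A * (q * q) + B * ∫ y, ‖x - y‖ ^ (-(2 : ℝ)) * (wt y ^ (26 / 9 : ℝ) * (w₁ y - w₂ y) ^ 2) := by
  obtain ⟨R, hR0, hR⟩ := exists_riesz_bound (k := 2) (β := 10 / 9) (by norm_num) (by norm_num)
    (by norm_num) (by norm_num)
  set D := |(10 * |c| * M ^ 9)| with hD
  have hD0 : 0 ≤ D := abs_nonneg _
  refine ⟨D * R, D, by positivity, hD0, fun w₁ w₂ h₁ h₂ hφ₁ hφ₂ q a x => ?_⟩
  set φ₁ := newtonPotential fun y => c * w₁ y ^ 10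
  set φ₂ := newtonPotential fun y => c * w₂ y ^ 10
  have hM := h₁.nonneg
  have hgrad : |pd φ₁ a x - pd φ₂ a x| ≤
      ∫ y, ‖x - y‖ ^ (-(2 : ℝ)) * |c * w₁ y ^ 10 - c * w₂ y ^ 10| := by
    have h := norm_fderiv_newtonPotential_sub_le (h₁.continuous_density c) (h₂.continuous_density c)
      (h₁.abs_density_le c) (h₂.abs_density_le c) (hφ₁ x) (hφ₂ x)
    refine le_trans ?_ h
    have := (fderiv ℝ φ₁ x - fderiv ℝ φ₂ x).le_opNorm (EuclideanSpace.single a 1)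
    simpa [pd] using this
  have hi1 := (hR x).1.const_mul (D * (q * q))
  have hcont : Continuous fun y => wt y ^ (26 / 9 : ℝ) * (w₁ y - w₂ y) ^ 2 := by
    have := h₁.diff.continuous
    have := h₂.diff.continuous
    have : Continuous fun y => wt y ^ (26 / 9 : ℝ) :=
      continuous_wt.rpow_const fun y => Or.inl (wt_pos y).ne'
    fun_prop
  have hi2 : Integrable fun y => ‖x - y‖ ^ (-(2 : ℝ)) * (wt y ^ (26 / 9 : ℝ) * (w₁ y - w₂ y) ^ 2) := by
    refine integrable_riesz_mul hcont (k := 2) (β := 26 / 9) (C := (M + M) ^ 2) (by norm_num)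
      (by norm_num) (by norm_num) (by norm_num) (fun y => ?_) x
    have hb := pow_le_pow_left₀ (abs_nonneg _) ((h₁.sub h₂).bd_le y) 2
    rw [abs_mul, abs_of_pos (wt_rpow_pos y _), abs_pow, mul_comm]
    have := wt_rpow_pos y (26 / 9)
    gcongr
  have hpt (y : E3) : |q| * (‖x - y‖ ^ (-(2 : ℝ)) * |c * w₁ y ^ 10 - c * w₂ y ^ 10|) ≤
      D * (q * q) * (‖x - y‖ ^ (-(2 : ℝ)) * wt y ^ (10 / 9 : ℝ)) +
      D * (‖x - y‖ ^ (-(2 : ℝ)) * (wt y ^ (26 / 9 : ℝ) * (w₁ y - w₂ y) ^ 2)) := by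
    have hσ := h₁.abs_density_sub_le h₂ c y
    set α := wt y ^ (5 / 9 : ℝ)
    set β := wt y ^ (13 / 9 : ℝ)
    have hα : wt y ^ (10 / 9 : ℝ) = α ^ 2 := by
      rw [← Real.rpow_natCast, ← Real.rpow_mul (wt_pos y).le]; norm_num
    have hβ : wt y ^ (26 / 9 : ℝ) = β ^ 2 := by
      rw [← Real.rpow_natCast, ← Real.rpow_mul (wt_pos y).le]; norm_num
    have hαβ : wt y ^ (2 : ℝ) = α * β := by
      rw [← Real.rpow_add (wt_pos y)]; norm_num
    rw [hαβ] at hσ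
    rw [hα, hβ]
    have hk : 0 ≤ ‖x - y‖ ^ (-(2 : ℝ)) := by positivity
    have ham : |q| * (α * β * |w₁ y - w₂ y|) ≤ q * q * α ^ 2 + β ^ 2 * (w₁ y - w₂ y) ^ 2 := by
      have e1 : q * q * α ^ 2 = (|q| * α) ^ 2 := by rw [mul_pow, sq_abs]; ring
      have e2 : β ^ 2 * (w₁ y - w₂ y) ^ 2 = (β * |w₁ y - w₂ y|) ^ 2 := by rw [mul_pow, sq_abs]
      rw [e1, e2]
      nlinarith [sq_nonneg (|q| * α - β * |w₁ y - w₂ y|), sq_nonneg (|q| * α),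
        sq_nonneg (β * |w₁ y - w₂ y|)]
    have hα0 : 0 < α := wt_rpow_pos y _
    have hβ0 : 0 < β := wt_rpow_pos y _
    calc _ = ‖x - y‖ ^ (-(2 : ℝ)) * (|q| * |c * w₁ y ^ 10 - c * w₂ y ^ 10|) := by ring
      _ ≤ ‖x - y‖ ^ (-(2 : ℝ)) * (|q| * (D * (α * β * |w₁ y - w₂ y|))) := by
          gcongr
          refine hσ.trans ?_
          gcongr
          exact le_abs_self _
      _ = ‖x - y‖ ^ (-(2 : ℝ)) * D * (|q| * (α * β * |w₁ y - w₂ y|)) := by ring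
      _ ≤ ‖x - y‖ ^ (-(2 : ℝ)) * D * (q * q * α ^ 2 + β ^ 2 * (w₁ y - w₂ y) ^ 2) := by gcongr
      _ = _ := by ring
  have hi0 : Integrable fun y => ‖x - y‖ ^ (-(2 : ℝ)) * |c * w₁ y ^ 10 - c * w₂ y ^ 10| := by
    refine integrable_riesz_mul ((h₁.continuous_density c).sub (h₂.continuous_density c)).abs (k := 2)
      (β := 20 / 9) (C := 2 * (|c| * M ^ 10)) (by norm_num) (by norm_num) (by norm_num) (by norm_num)
      (fun y => ?_) x
    rw [abs_abs]
    refine (abs_sub _ _).trans ?_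
    linarith [h₁.abs_density_le c y, h₂.abs_density_le c y]
  calc _ ≤ |q| * ∫ y, ‖x - y‖ ^ (-(2 : ℝ)) * |c * w₁ y ^ 10 - c * w₂ y ^ 10| := by gcongr
    _ = ∫ y, |q| * (‖x - y‖ ^ (-(2 : ℝ)) * |c * w₁ y ^ 10 - c * w₂ y ^ 10|) :=
        (integral_const_mul _ _).symm
    _ ≤ ∫ y, (D * (q * q) * (‖x - y‖ ^ (-(2 : ℝ)) * wt y ^ (10 / 9 : ℝ)) +
          D * (‖x - y‖ ^ (-(2 : ℝ)) * (wt y ^ (26 / 9 : ℝ) * (w₁ y - w₂ y) ^ 2))) :=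
        integral_mono (hi0.const_mul _) (hi1.add (hi2.const_mul D)) hpt
    _ = D * (q * q) * (∫ y, ‖x - y‖ ^ (-(2 : ℝ)) * wt y ^ (10 / 9 : ℝ)) +
          D * ∫ y, ‖x - y‖ ^ (-(2 : ℝ)) * (wt y ^ (26 / 9 : ℝ) * (w₁ y - w₂ y) ^ 2) := by
        rw [integral_add hi1 (hi2.const_mul D), integral_const_mul, integral_const_mul]
    _ ≤ D * (q * q) * R +
          D * ∫ y, ‖x - y‖ ^ (-(2 : ℝ)) * (wt y ^ (26 / 9 : ℝ) * (w₁ y - w₂ y) ^ 2) := by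
        have := mul_self_nonneg q
        gcongr
        exact (hR x).2
    _ = _ := by ring

end

lemma Reg.integrable_enW_mul_enD {M : ℝ} {W : E3 → ℝ} {V : Fin 3 → E3 → ℝ} (hW : Reg M W)
    (hV : ∀ a, Reg M (V a)) : Integrable fun x => enW x * enD W V x := by
  have h : DReg (enD W V) :=
    (hW.mul hW).add (((hV 0).mul (hV 0)).add (((hV 1).mul (hV 1)).add ((hV 2).mul (hV 2))))
  obtain ⟨N, hN⟩ := h.bd
  exact integrable_enW_mul h.diff.continuous.aestronglyMeasurable hN

/-- The energy of the difference of two solutions grows at most exponentially. -/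
lemma exists_energy_rate_le (c M : ℝ) : ∃ C : ℝ, ∀ (w₁ w₂ : E3 → ℝ) (v₁ v₂ : Fin 3 → E3 → ℝ),
    Reg M w₁ → Reg M w₂ → (∀ a, Reg M (v₁ a)) → (∀ a, Reg M (v₂ a)) →
    ∀ φ₁ φ₂ : E3 → ℝ, φ₁ = newtonPotential (fun y => c * w₁ y ^ 10) →
    φ₂ = newtonPotential (fun y => c * w₂ y ^ 10) → Differentiable ℝ φ₁ → Differentiable ℝ φ₂ →
    ∀ (W : E3 → ℝ) (V : Fin 3 → E3 → ℝ), W = (fun x => w₁ x - w₂ x) →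
    V = (fun a x => v₁ a x - v₂ a x) →
    Integrable (fun x => enW x * (2 * (W x * (rateW w₁ v₁ x - rateW w₂ v₂ x) +
      ∑ a, V a x * (rateV w₁ v₁ φ₁ a x - rateV w₂ v₂ φ₂ a x)))) →
    ∫ x, enW x * (2 * (W x * (rateW w₁ v₁ x - rateW w₂ v₂ x) +
      ∑ a, V a x * (rateV w₁ v₁ φ₁ a x - rateV w₂ v₂ φ₂ a x))) ≤
      C * ∫ x, enW x * enD W V x := by
  obtain ⟨A, B, hA, hB, hAB⟩ := exists_forcing_bound c M
  obtain ⟨D, hD, hDg⟩ := exists_integral_riesz_le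
  refine ⟨40 * M + 2 * A + 6 * B * D, fun w₁ w₂ v₁ v₂ hw₁ hw₂ hv₁ hv₂ φ₁ φ₂ e₁ e₂ hφ₁ hφ₂ W V hW hV
    hS => ?_⟩
  have hWR : Reg (M + M) W := hW ▸ hw₁.sub hw₂
  have hVR (a : Fin 3) : Reg (M + M) (V a) := by rw [hV]; exact (hv₁ a).sub (hv₂ a)
  have hEi := hWR.integrable_enW_mul_enD hVR
  have hflux (a : Fin 3) : DReg (flux w₁ v₁ W V a) :=
    (DReg.mul (hv₁ a) ((hWR.mul hWR).add (((hVR 0).mul (hVR 0)).add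
      (((hVR 1).mul (hVR 1)).add ((hVR 2).mul (hVR 2)))))).add
      ((DReg.mul hw₁ (hWR.mul (hVR a))).const_mul (1 / 5))
  have hdi (a : Fin 3) := ((hflux a).integral_pd_enW_mul a).1
  have hd0 (a : Fin 3) := ((hflux a).integral_pd_enW_mul a).2
  have hsi := integrable_finsetSum Finset.univ fun a _ => hdi a
  have hs0 : ∫ x, ∑ a, pd (fun y => enW y * flux w₁ v₁ W V a y) a x = 0 := by
    rw [integral_finsetSum _ fun a _ => hdi a]
    exact Finset.sum_eq_zero fun a _ => hd0 a
  set g : E3 → ℝ := fun y => wt y ^ (26 / 9 : ℝ) * (w₁ y - w₂ y) ^ 2 with hg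
  have hgc : Continuous g := by
    have := hw₁.diff.continuous
    have := hw₂.diff.continuous
    have : Continuous fun y => wt y ^ (26 / 9 : ℝ) :=
      continuous_wt.rpow_const fun y => Or.inl (wt_pos y).ne'
    fun_prop
  have hg0 (y : E3) : 0 ≤ g y := by have := wt_rpow_pos y (26 / 9); positivity
  have hgE (y : E3) : g y ≤ enW y * enD W V y := by
    have h1 := (le_abs_self _).trans (abs_mul_le_enD W V y).1
    have h2 : (w₁ y - w₂ y) ^ 2 = W y * W y := by rw [hW, sq]
    simp only [hg, h2]
    have := enW_pos y
    have := mul_self_nonneg (W y)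
    gcongr
    exact wt_rpow_le_enW y
  have hgi : Integrable g := hEi.mono' hgc.aestronglyMeasurable (Filter.Eventually.of_forall fun y => by
    rw [Real.norm_of_nonneg (hg0 y)]; exact hgE y)
  obtain ⟨hHi, hHle⟩ := hDg g hgc.measurable hg0 hgi
  have hU (x : E3) : enW x * (2 * (W x * (rateW w₁ v₁ x - rateW w₂ v₂ x) +
      ∑ a, V a x * (rateV w₁ v₁ φ₁ a x - rateV w₂ v₂ φ₂ a x))) +
      ∑ a, pd (fun y => enW y * flux w₁ v₁ W V a y) a x ≤
      (40 * M + 2 * A) * (enW x * enD W V x) +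
        6 * B * (enW x * ∫ y, ‖x - y‖ ^ (-(2 : ℝ)) * g y) := by
    have hid := energy_identity φ₁ φ₂ hw₁.diff hw₂.diff (fun a => (hv₁ a).diff) (fun a => (hv₂ a).diff)
      hW hV x
    have hre := energy_remainder_le hw₁ hw₂ hv₁ hv₂ W V x
    have hf (a : Fin 3) : -2 * (enW x * V a x * (pd φ₁ a x - pd φ₂ a x)) ≤
        2 * A * (enW x * (V a x * V a x)) + 2 * B * (enW x * ∫ y, ‖x - y‖ ^ (-(2 : ℝ)) * g y) := by
      have h := hAB w₁ w₂ hw₁ hw₂ (e₁ ▸ hφ₁) (e₂ ▸ hφ₂) (V a x) a x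
      rw [← e₁, ← e₂, ← abs_mul] at h
      have h' := (neg_le_abs _).trans h
      have := mul_le_mul_of_nonneg_left h' (enW_pos x).le
      linarith
    have hf3 := Finset.sum_le_sum fun a (_ : a ∈ (Finset.univ : Finset (Fin 3))) => hf a
    have hVE : A * (enW x * (V 0 x * V 0 x + (V 1 x * V 1 x + V 2 x * V 2 x))) ≤
        A * (enW x * enD W V x) := by
      refine mul_le_mul_of_nonneg_left (mul_le_mul_of_nonneg_left ?_ (enW_pos x).le) hA
      rw [enD]
      linarith [mul_self_nonneg (W x)]
    have hs3 : ∑ a, (2 * A * (enW x * (V a x * V a x)) +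
        2 * B * (enW x * ∫ y, ‖x - y‖ ^ (-(2 : ℝ)) * g y)) =
        2 * (A * (enW x * (V 0 x * V 0 x + (V 1 x * V 1 x + V 2 x * V 2 x)))) +
        6 * B * (enW x * ∫ y, ‖x - y‖ ^ (-(2 : ℝ)) * g y) := by
      rw [Fin.sum_univ_three]; ring
    rw [hs3] at hf3
    rw [hid]
    linarith
  have hmono := integral_mono (hS.add hsi) ((hEi.const_mul (40 * M + 2 * A)).add
    (hHi.const_mul (6 * B))) hU
  simp only [Pi.add_apply] at hmono
  rw [integral_add hS hsi, hs0, add_zero, integral_add (hEi.const_mul _) (hHi.const_mul _),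
    integral_const_mul, integral_const_mul] at hmono
  have hgle : ∫ y, g y ≤ ∫ x, enW x * enD W V x := integral_mono hgi hEi hgE
  have : 6 * B * (∫ x, enW x * ∫ y, ‖x - y‖ ^ (-(2 : ℝ)) * g y) ≤
      6 * B * (D * ∫ x, enW x * enD W V x) := by
    gcongr
    exact hHle.trans (by gcongr)
  linarith

/-! ### Uniqueness -/

lemma integrable_enW_mul_bound (C : ℝ) :
    Integrable fun x => enW x * (C * wt x ^ (2 / 9 : ℝ)) := by
  have hc : Continuous fun x : E3 => C * wt x ^ (2 / 9 : ℝ) :=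
    (continuous_wt.rpow_const fun y => Or.inl (wt_pos y).ne').const_mul C
  refine integrable_enW_mul hc.aestronglyMeasurable (C := |C|) fun x => ?_
  rw [abs_mul, abs_of_pos (wt_rpow_pos x _)]

lemma norm_enW_mul_le {p N x} (hp : |p| ≤ N) : ‖enW x * p‖ ≤ enW x * N := by
  rw [norm_mul, Real.norm_of_nonneg (enW_pos x).le]
  exact mul_le_mul_of_nonneg_left hp (enW_pos x).le

section

variable {q dq : ℝ → E3 → ℝ} {T A B : ℝ}

lemma continuousOn_integral_enW_mul_self (hA : 0 ≤ A) (hc : ∀ t ∈ Icc 0 T, Continuous (q t))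
    (hb : ∀ t ∈ Icc 0 T, ∀ x, |q t x| ≤ A * wt x ^ (2 / 9 : ℝ))
    (hd : ∀ t ∈ Icc 0 T, ∀ x, HasDerivWithinAt (fun τ => q τ x) (dq t x) (Icc 0 T) t) :
    ContinuousOn (fun t => ∫ x, enW x * (q t x * q t x)) (Icc 0 T) := by
  refine continuousOn_of_dominated (bound := fun x => enW x * (A * A * wt x ^ (2 / 9 : ℝ)))
    (fun t ht => (differentiable_enW.continuous.mul ((hc t ht).mul (hc t ht))).aestronglyMeasurable)
    (fun t ht => Filter.Eventually.of_forall fun x => norm_enW_mul_le ?_)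
    (integrable_enW_mul_bound _) (Filter.Eventually.of_forall fun x => ?_)
  · have h := hb t ht x
    have h' : |q t x| ≤ A :=
      h.trans (mul_le_of_le_one_right hA (wt_rpow_le_one x (by norm_num)))
    rw [abs_mul, mul_assoc]
    gcongr
  · have h : ContinuousOn (fun τ => q τ x) (Icc 0 T) := fun t ht => (hd t ht x).continuousWithinAt
    exact (h.mul h).const_mul _

lemma hasDerivAt_integral_enW_mul_self (hA : 0 ≤ A) (hc : ∀ t ∈ Icc 0 T, Continuous (q t))
    (hb : ∀ t ∈ Icc 0 T, ∀ x, |q t x| ≤ A * wt x ^ (2 / 9 : ℝ))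
    (hd : ∀ t ∈ Icc 0 T, ∀ x, HasDerivWithinAt (fun τ => q τ x) (dq t x) (Icc 0 T) t)
    (hm : ∀ t ∈ Icc 0 T, Measurable (dq t)) (hB : ∀ t ∈ Icc 0 T, ∀ x, |dq t x| ≤ B)
    {t : ℝ} (ht : t ∈ Ioo 0 T) :
    Integrable (fun x => enW x * (2 * (q t x * dq t x))) ∧
    HasDerivAt (fun t => ∫ x, enW x * (q t x * q t x)) (∫ x, enW x * (2 * (q t x * dq t x))) t := by
  have hI := Ioo_subset_Icc_self ht
  have hen := differentiable_enW.continuous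
  refine hasDerivAt_integral_of_dominated_loc_of_deriv_le (s := Ioo 0 T)
    (F' := fun t x => enW x * (2 * (q t x * dq t x)))
    (bound := fun x => enW x * (2 * A * B * wt x ^ (2 / 9 : ℝ))) (Ioo_mem_nhds ht.1 ht.2) ?_ ?_ ?_ ?_
    (integrable_enW_mul_bound _) ?_
  · filter_upwards [Ioo_mem_nhds ht.1 ht.2] with τ hτ
    have := hc τ (Ioo_subset_Icc_self hτ)
    exact (hen.mul (this.mul this)).aestronglyMeasurable
  · refine integrable_enW_mul (C := A * A) ((hc t hI).mul (hc t hI)).aestronglyMeasurable fun x => ?_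
    have h := hb t hI x
    have h' : |q t x| ≤ A :=
      h.trans (mul_le_of_le_one_right hA (wt_rpow_le_one x (by norm_num)))
    rw [abs_mul, mul_assoc]
    gcongr
  · exact (hen.measurable.mul (((hc t hI).measurable.mul (hm t hI)).const_mul 2)).aestronglyMeasurable
  · refine Filter.Eventually.of_forall fun x τ hτ => norm_enW_mul_le ?_
    have hτ' := Ioo_subset_Icc_self hτ
    rw [abs_mul, abs_mul, abs_two]
    have := wt_rpow_pos x (2 / 9)
    calc 2 * (|q τ x| * |dq τ x|) ≤ 2 * (A * wt x ^ (2 / 9 : ℝ) * B) := by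
          have h1 := hb τ hτ' x
          have h2 := hB τ hτ' x
          gcongr
      _ = _ := by ring
  · refine Filter.Eventually.of_forall fun x τ hτ => ?_
    have h := (hd τ (Ioo_subset_Icc_self hτ) x).hasDerivAt (Icc_mem_nhds hτ.1 hτ.2)
    refine ((h.fun_mul h).const_mul (enW x)).congr_deriv ?_
    ring

end

/-- Solutions of the system for `γ = 6/5` with uniform bounds on `[0,T]`, where `c` is the constant
in the density. -/
structure MakinoFlow (c M T : ℝ) (w : ℝ → E3 → ℝ) (v : Fin 3 → ℝ → E3 → ℝ) : Prop where
  reg_w : ∀ t ∈ Icc 0 T, Reg M (w t)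
  reg_v : ∀ t ∈ Icc 0 T, ∀ a, Reg M (v a t)
  pot : ∀ t ∈ Icc 0 T, Differentiable ℝ (newtonPotential fun y => c * w t y ^ 10)
  deriv_w : ∀ t ∈ Icc 0 T, ∀ x,
    HasDerivWithinAt (fun τ => w τ x) (rateW (w t) (fun a => v a t) x) (Icc 0 T) t
  deriv_v : ∀ t ∈ Icc 0 T, ∀ x, ∀ a, HasDerivWithinAt (fun τ => v a τ x)
    (rateV (w t) (fun a => v a t) (newtonPotential fun y => c * w t y ^ 10) a x) (Icc 0 T) t

lemma MakinoFlow.mono {c M N T : ℝ} {w : ℝ → E3 → ℝ} {v : Fin 3 → ℝ → E3 → ℝ}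
    (h : MakinoFlow c M T w v) (hMN : M ≤ N) : MakinoFlow c N T w v :=
  ⟨fun t ht => (h.reg_w t ht).mono hMN, fun t ht a => (h.reg_v t ht a).mono hMN, h.pot, h.deriv_w,
    h.deriv_v⟩

lemma eq_zero_of_integral_enW_mul_enD {M : ℝ} {W : E3 → ℝ} {V : Fin 3 → E3 → ℝ} (hW : Reg M W)
    (hV : ∀ a, Reg M (V a)) (h : ∫ x, enW x * enD W V x = 0) (x : E3) :
    W x = 0 ∧ ∀ a, V a x = 0 := by
  have h0 := (integral_eq_zero_iff_of_nonneg
    (fun x => mul_nonneg (enW_pos x).le (enD_nonneg W V x)) (hW.integrable_enW_mul_enD hV)).1 h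
  have hc : Continuous fun x => enW x * enD W V x :=
    differentiable_enW.continuous.mul (differentiable_enD hW.diff fun a => (hV a).diff).continuous
  have hx : enW x * enD W V x = 0 :=
    congrFun ((hc.ae_eq_iff_eq (μ := volume) continuous_zero).1 h0) x
  have hE := (mul_eq_zero.1 hx).resolve_left (enW_pos x).ne'
  obtain ⟨b1, -, b3⟩ := abs_mul_le_enD W V x
  rw [hE] at b1 b3
  exact ⟨mul_self_eq_zero.1 (abs_nonpos_iff.1 b1),
    fun a => mul_self_eq_zero.1 (abs_nonpos_iff.1 (b3 a a))⟩

lemma nonpos_of_hasDerivAt_le_mul {E E' : ℝ → ℝ} {C T : ℝ} (hc : ContinuousOn E (Icc 0 T))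
    (hd : ∀ t ∈ Ioo 0 T, HasDerivAt E (E' t) t) (hle : ∀ t ∈ Ioo 0 T, E' t ≤ C * E t)
    (h0 : E 0 = 0) {t : ℝ} (ht : t ∈ Icc 0 T) : E t ≤ 0 := by
  have hexp (t : ℝ) : HasDerivAt (fun t => Real.exp (-C * t)) (Real.exp (-C * t) * -C) t := by
    simpa using ((hasDerivAt_id t).const_mul (-C)).exp
  have hG (t) (ht : t ∈ Ioo 0 T) := (hd t ht).fun_mul (hexp t)
  have hanti : AntitoneOn (fun t => E t * Real.exp (-C * t)) (Icc 0 T) := by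
    refine antitoneOn_of_deriv_nonpos (convex_Icc 0 T)
      (hc.mul (by fun_prop)) (fun t ht => ?_) fun t ht => ?_
    all_goals rw [interior_Icc] at ht
    · exact (hG t ht).differentiableAt.differentiableWithinAt
    · rw [(hG t ht).deriv]
      have := mul_nonneg (sub_nonneg.2 (hle t ht)) (Real.exp_pos (-C * t)).le
      linarith
  have := hanti (left_mem_Icc.2 (ht.1.trans ht.2)) ht ht.1
  simp only [h0, zero_mul] at this
  exact nonpos_of_mul_nonpos_left this (Real.exp_pos _)

/-- Two bounded solutions with the same initial data coincide. -/
lemma MakinoFlow.unique {c M T : ℝ} {w₁ w₂ : ℝ → E3 → ℝ} {v₁ v₂ : Fin 3 → ℝ → E3 → ℝ}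
    (h₁ : MakinoFlow c M T w₁ v₁) (h₂ : MakinoFlow c M T w₂ v₂) (hw0 : w₁ 0 = w₂ 0)
    (hv0 : ∀ a, v₁ a 0 = v₂ a 0) {t : ℝ} (ht : t ∈ Icc 0 T) :
    w₁ t = w₂ t ∧ ∀ a, v₁ a t = v₂ a t := by
  have hM : 0 ≤ M := (h₁.reg_w t ht).nonneg
  obtain ⟨B, hB⟩ := exists_rate_bound c M
  obtain ⟨C, hC⟩ := exists_energy_rate_le c M
  set W : ℝ → E3 → ℝ := fun t x => w₁ t x - w₂ t x with hW
  set V : Fin 3 → ℝ → E3 → ℝ := fun a t x => v₁ a t x - v₂ a t x with hV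
  set dW : ℝ → E3 → ℝ := fun t x =>
    rateW (w₁ t) (fun a => v₁ a t) x - rateW (w₂ t) (fun a => v₂ a t) x with hdW
  set dV : Fin 3 → ℝ → E3 → ℝ := fun a t x =>
    rateV (w₁ t) (fun a => v₁ a t) (newtonPotential fun y => c * w₁ t y ^ 10) a x -
      rateV (w₂ t) (fun a => v₂ a t) (newtonPotential fun y => c * w₂ t y ^ 10) a x with hdV
  have hWR (t) (ht : t ∈ Icc 0 T) : Reg (M + M) (W t) := (h₁.reg_w t ht).sub (h₂.reg_w t ht)
  have hVR (a : Fin 3) (t) (ht : t ∈ Icc 0 T) : Reg (M + M) (V a t) :=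
    (h₁.reg_v t ht a).sub (h₂.reg_v t ht a)
  have b₁ (t) (ht : t ∈ Icc 0 T) := hB _ _ (h₁.reg_w t ht) (h₁.reg_v t ht) (h₁.pot t ht)
  have b₂ (t) (ht : t ∈ Icc 0 T) := hB _ _ (h₂.reg_w t ht) (h₂.reg_v t ht) (h₂.pot t ht)
  have hWd (t) (ht : t ∈ Icc 0 T) (x : E3) :
      HasDerivWithinAt (fun τ => W τ x) (dW t x) (Icc 0 T) t :=
    (h₁.deriv_w t ht x).sub (h₂.deriv_w t ht x)
  have hVd (a : Fin 3) (t) (ht : t ∈ Icc 0 T) (x : E3) :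
      HasDerivWithinAt (fun τ => V a τ x) (dV a t x) (Icc 0 T) t :=
    (h₁.deriv_v t ht x a).sub (h₂.deriv_v t ht x a)
  have hWm (t) (ht : t ∈ Icc 0 T) : Measurable (dW t) :=
    (measurable_rateW (h₁.reg_w t ht).diff.continuous fun a => (h₁.reg_v t ht a).diff.continuous).sub
      (measurable_rateW (h₂.reg_w t ht).diff.continuous fun a => (h₂.reg_v t ht a).diff.continuous)
  have hVm (a : Fin 3) (t) (ht : t ∈ Icc 0 T) : Measurable (dV a t) :=
    (measurable_rateV (h₁.reg_w t ht).diff.continuous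
      (fun a => (h₁.reg_v t ht a).diff.continuous) _ a).sub
      (measurable_rateV (h₂.reg_w t ht).diff.continuous
        (fun a => (h₂.reg_v t ht a).diff.continuous) _ a)
  have hWB (t) (ht : t ∈ Icc 0 T) (x : E3) : |dW t x| ≤ B + B :=
    (abs_sub _ _).trans (add_le_add (b₁ t ht x).1 (b₂ t ht x).1)
  have hVB (a : Fin 3) (t) (ht : t ∈ Icc 0 T) (x : E3) : |dV a t x| ≤ B + B :=
    (abs_sub _ _).trans (add_le_add ((b₁ t ht x).2 a) ((b₂ t ht x).2 a))
  have hMM : 0 ≤ M + M := by positivity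
  have kW := fun t (ht : t ∈ Ioo 0 T) => hasDerivAt_integral_enW_mul_self hMM
    (fun t ht => (hWR t ht).diff.continuous) (fun t ht => (hWR t ht).bd) hWd hWm hWB ht
  have kV := fun (a : Fin 3) t (ht : t ∈ Ioo 0 T) => hasDerivAt_integral_enW_mul_self hMM
    (fun t ht => (hVR a t ht).diff.continuous) (fun t ht => (hVR a t ht).bd) (hVd a) (hVm a) (hVB a) ht
  have cW := continuousOn_integral_enW_mul_self hMM
    (fun t ht => (hWR t ht).diff.continuous) (fun t ht => (hWR t ht).bd) hWd
  have cV := fun a : Fin 3 => continuousOn_integral_enW_mul_self hMM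
    (fun t ht => (hVR a t ht).diff.continuous) (fun t ht => (hVR a t ht).bd) (hVd a)
  have iSq {f : E3 → ℝ} (hf : Reg (M + M) f) : Integrable fun x => enW x * (f x * f x) := by
    obtain ⟨N, hN⟩ := (hf.mul hf).bd
    exact integrable_enW_mul (hf.mul hf).diff.continuous.aestronglyMeasurable hN
  set J : (ℝ → E3 → ℝ) → ℝ → ℝ := fun q t => ∫ x, enW x * (q t x * q t x) with hJ
  have hE (t) (ht : t ∈ Icc 0 T) : ∫ x, enW x * enD (W t) (fun a => V a t) x =
      J W t + (J (V 0) t + (J (V 1) t + J (V 2) t)) := by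
    have i0 := iSq (hVR 0 t ht)
    have i1 := iSq (hVR 1 t ht)
    have i2 := iSq (hVR 2 t ht)
    simp only [hJ]
    rw [← integral_add' i1 i2, ← integral_add' i0 (i1.add i2),
      ← integral_add' (iSq (hWR t ht)) (i0.add (i1.add i2))]
    refine integral_congr_ae (Filter.Eventually.of_forall fun x => ?_)
    simp only [enD, Pi.add_apply]
    ring
  have hle : J W t + (J (V 0) t + (J (V 1) t + J (V 2) t)) ≤ 0 := by
    refine nonpos_of_hasDerivAt_le_mul (E := fun t => J W t + (J (V 0) t + (J (V 1) t + J (V 2) t)))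
      (C := C) (cW.add ((cV 0).add ((cV 1).add (cV 2))))
      (fun t ht => (kW t ht).2.add ((kV 0 t ht).2.add ((kV 1 t ht).2.add (kV 2 t ht).2)))
      (fun t ht => ?_) ?_ ht
    · have hI := Ioo_subset_Icc_self ht
      have i0 := (kV 0 t ht).1
      have i1 := (kV 1 t ht).1
      have i2 := (kV 2 t ht).1
      have hint := (kW t ht).1.add (i0.add (i1.add i2))
      have e : ((fun x => enW x * (2 * (W t x * dW t x))) + ((fun x => enW x * (2 * (V 0 t x * dV 0 t x)))
          + ((fun x => enW x * (2 * (V 1 t x * dV 1 t x))) +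
            fun x => enW x * (2 * (V 2 t x * dV 2 t x))))) =
          fun x => enW x * (2 * (W t x * dW t x + ∑ a, V a t x * dV a t x)) := by
        funext x
        simp only [Pi.add_apply, Fin.sum_univ_three]
        ring
      rw [e] at hint
      have := hC (w₁ t) (w₂ t) (fun a => v₁ a t) (fun a => v₂ a t) (h₁.reg_w t hI) (h₂.reg_w t hI)
        (h₁.reg_v t hI) (h₂.reg_v t hI) _ _ rfl rfl (h₁.pot t hI) (h₂.pot t hI) (W t)
        (fun a => V a t) rfl rfl hint
      rw [hE t hI] at this
      refine le_trans (le_of_eq ?_) this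
      rw [← integral_add' i1 i2, ← integral_add' i0 (i1.add i2),
        ← integral_add' (kW t ht).1 (i0.add (i1.add i2))]
      exact congrArg _ e
    · simp [hJ, hW, hV, hw0, hv0]
  have h0 := eq_zero_of_integral_enW_mul_enD (hWR t ht) (fun a => hVR a t ht)
    (le_antisymm ((hE t ht).trans_le hle) (integral_nonneg fun x =>
      mul_nonneg (enW_pos x).le (enD_nonneg _ _ x)))
  exact ⟨funext fun x => sub_eq_zero.1 (h0 x).1, fun a => funext fun x => sub_eq_zero.1 ((h0 x).2 a)⟩

lemma makinoDensity_six_fifths (K : ℝ) (w : E3 → ℝ) :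
    makinoDensity K (6 / 5) w = fun y => makinoConst K (6 / 5) * w y ^ 10 := by
  funext y
  rw [makinoDensity, show (2 / (6 / 5 - 1) : ℝ) = (10 : ℕ) by norm_num, Real.rpow_natCast]

lemma exists_makinoFlow {P : DyadicPartition} {K s δ T : ℝ} (hs : 5 / 2 < s) (hδ : -23 / 18 < δ)
    {w₀ : E3 → ℝ} {v₀ : Fin 3 → E3 → ℝ} {w : ℝ → E3 → ℝ} {v : Fin 3 → ℝ → E3 → ℝ}
    (h : MakinoClass P K (6 / 5) s δ T w₀ v₀ w v) :
    ∃ M, MakinoFlow (makinoConst K (6 / 5)) M T w v := by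
  obtain ⟨-, -, hsol, hw, hv, -⟩ := h
  have dw (t) (ht : t ∈ Icc 0 T) : Differentiable ℝ (w t) := fun x => (hsol t ht x).1
  have dv (a) (t) (ht : t ∈ Icc 0 T) : Differentiable ℝ (v a t) := fun x => (hsol t ht x).2.1 a
  obtain ⟨N, hN0, hN⟩ := HContOn.exists_bound hs hδ hw dw
  choose N' hN0' hN' using fun a => HContOn.exists_bound hs hδ (hv a) (dv a)
  have hreg {f : E3 → ℝ} {N : ℝ} (hf : Differentiable ℝ f)
      (hb : ∀ x, |f x| ≤ N * wt x ^ (2 / 9 : ℝ) ∧ ‖fderiv ℝ f x‖ ≤ N) : Reg N f :=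
    ⟨hf, fun x => (hb x).1, fun i x => (abs_pd_le f i x).trans (hb x).2⟩
  have hle (a : Fin 3) : N' a ≤ N + ∑ b, N' b := by
    have := Finset.single_le_sum (fun b _ => hN0' b) (Finset.mem_univ a)
    linarith
  refine ⟨N + ∑ b, N' b, fun t ht => (hreg (dw t ht) (hN t ht)).mono ?_,
    fun t ht a => (hreg (dv a t ht) (hN' a t ht)).mono (hle a), fun t ht x => ?_, fun t ht x => ?_,
    fun t ht x a => ?_⟩
  · linarith [Finset.sum_nonneg fun b (_ : b ∈ Finset.univ) => hN0' b]
  · rw [← makinoDensity_six_fifths]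
    exact (hsol t ht x).2.2.1
  · obtain ⟨d, hd, he⟩ := (hsol t ht x).2.2.2.1
    convert hd using 1
    rw [rateW]
    linarith
  · obtain ⟨d, hd, he⟩ := (hsol t ht x).2.2.2.2 a
    convert hd using 1
    rw [rateV, ← makinoDensity_six_fifths]
    linarith

end StaticMakino

/-- The static solutions for `γ = 6/5`.
Let `γ = 6/5`, `-23/18 < δ < -1`, `s > 5/2` and `a > 0`. Then
`w₀(x) = (a² + |x|²)^{-1/4}` belongs to `H_{s,δ}`, and for the initial data
`(w₀, 0)` there are `T > 0` and a unique solution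
`(w,v) ∈ C([0,T],H_{s,δ}) ∩ C¹([0,T],H_{s-1,δ+1})` of the Euler–Poisson–Makino
system with adiabatic exponent `γ = 6/5`. -/
theorem static_solution_gamma_six_fifths (P : DyadicPartition) (K γ s δ a : ℝ)
    (hK : 0 < K) (hγ : γ = 6/5)
    (hδ₁ : -23/18 < δ) (hδ₂ : δ < -1) (hs : 5/2 < s) (ha : 0 < a) :
    MemH P s δ (fun x : E3 => (a ^ 2 + ‖x‖ ^ 2) ^ (-(1/4) : ℝ)) ∧
    ∃ T : ℝ, 0 < T ∧ ∃ (w : ℝ → E3 → ℝ) (v : Fin 3 → ℝ → E3 → ℝ),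
      MakinoClass P K γ s δ T
        (fun x : E3 => (a ^ 2 + ‖x‖ ^ 2) ^ (-(1/4) : ℝ)) (fun _ _ => 0) w v ∧
      ∀ (w' : ℝ → E3 → ℝ) (v' : Fin 3 → ℝ → E3 → ℝ),
        MakinoClass P K γ s δ T
          (fun x : E3 => (a ^ 2 + ‖x‖ ^ 2) ^ (-(1/4) : ℝ)) (fun _ _ => 0) w' v' →
        ∀ t ∈ Icc (0:ℝ) T, w' t = w t ∧ ∀ b, v' b t = v b t := by
  subst hγ
  refine ⟨StaticMakino.memH_of_symS P s (by norm_num) (by linarith) (StaticMakino.symS_rtz ha), ?_⟩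
  obtain ⟨T, hT, w, v, h⟩ := StaticMakino.exists_makino_solution P K s δ a hδ₂ ha
  refine ⟨T, hT, w, v, h, fun w' v' h' t ht => ?_⟩
  obtain ⟨M, hM⟩ := StaticMakino.exists_makinoFlow hs hδ₁ h
  obtain ⟨M', hM'⟩ := StaticMakino.exists_makinoFlow hs hδ₁ h'
  exact (hM'.mono (le_max_right M M')).unique (hM.mono (le_max_left M M')) (h'.1.trans h.1.symm)
    (fun b => (h'.2.1 b).trans (h.2.1 b).symm) ht
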